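/- arXiv:1205.6964 — 5 statements merged into one kernel-verified Lean document; each statement's English description precedes it below -/
import Mathlib

section
/- For every finite Borel measure μ on [0,1), the Cesàro averages of the squared moduli of its Fourier coefficients converge to the sum of the squares of its atoms: lim_{N→∞} (1/(2N+1)) Σ_{n=-N}^{N} |μ̂(n)|² = Σ_{x∈[0,1)} μ({x})². In particular, if μ is atomless then (1/(2N+1)) Σ_{n=-N}^{N} |μ̂(n)|² → 0. -/
open MeasureTheory Filter

/-- The `n`-th Fourier coefficient of a (finite Borel) measure `μ` on `[0,1)`,
viewed as a measure on the circle `ℝ/ℤ`:  `μ̂(n) = ∫ e^{-2πi n x} dμ(x)`. -/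
noncomputable def fourierCoeffM (μ : Measure ℝ) (n : ℤ) : ℂ :=
  ∫ x, Complex.exp (-(2 * Real.pi * Complex.I * (n : ℂ) * (x : ℂ))) ∂μ

/-- The sum of `z ^ n` over `|n| ≤ N` telescopes after multiplication by `z - 1`. -/
theorem sub_one_mul_sum_zpow_Icc {K : Type*} [Field K] {z : K} (hz : z ≠ 0) (N : ℕ) :
    (z - 1) * ∑ n ∈ Finset.Icc (-(N : ℤ)) N, z ^ n = z ^ ((N : ℤ) + 1) - z ^ (-(N : ℤ)) := by
  induction N with
  | zero => simp
  | succ N ih =>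
    have hIcc : Finset.Icc (-((N + 1 : ℕ) : ℤ)) ((N + 1 : ℕ) : ℤ) =
        insert (-((N : ℤ) + 1)) (insert ((N : ℤ) + 1) (Finset.Icc (-(N : ℤ)) N)) := by
      ext k
      simp only [Finset.mem_Icc, Finset.mem_insert]
      push_cast
      omega
    rw [hIcc, Finset.sum_insert, Finset.sum_insert, mul_add, mul_add, ih]
    · have h1 : z ^ (((N + 1 : ℕ) : ℤ) + 1) = z * z ^ ((N : ℤ) + 1) := by
        rw [zpow_add_one₀ hz, mul_comm]; push_cast; rfl
      have h2 : z ^ (-(N : ℤ)) = z * z ^ (-((N : ℤ) + 1)) := by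
        rw [mul_comm, ← zpow_add_one₀ hz]; congr 1; ring
      rw [h1, h2]
      push_cast
      ring
    · simp
    · simp only [Finset.mem_Icc, Finset.mem_insert]
      omega

/-- The symmetric Cesàro averages of the powers of a unimodular number. -/
theorem tendsto_average_zpow {z : ℂ} (hz : ‖z‖ = 1) :
    Tendsto (fun N : ℕ => (1 / (2 * (N : ℂ) + 1)) * ∑ n ∈ Finset.Icc (-(N : ℤ)) N, z ^ n)
      atTop (nhds (if z = 1 then 1 else 0)) := by
  split_ifs with h
  · refine tendsto_const_nhds.congr fun N => ?_
    have h0 : (2 * (N : ℂ) + 1) ≠ 0 := by exact_mod_cast (by positivity : (2 * N + 1 : ℕ) ≠ 0)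
    have hc : (Finset.Icc (-(N : ℤ)) N).card = 2 * N + 1 := by
      rw [Int.card_Icc]; omega
    simp only [h, one_zpow, Finset.sum_const, hc, nsmul_eq_mul, mul_one]
    push_cast
    field_simp
  · have h0 : z ≠ 0 := by rintro rfl; simp at hz
    have h1 : 0 < ‖z - 1‖ := norm_pos_iff.2 (sub_ne_zero.2 h)
    have hlim : Tendsto (fun N : ℕ => (2 / ‖z - 1‖) / (N : ℝ)) atTop (nhds 0) :=
      tendsto_const_div_atTop_nhds_zero_nat _
    refine squeeze_zero_norm' ?_ hlim
    filter_upwards [eventually_gt_atTop 0] with N hN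
    have hN' : (0 : ℝ) < N := by exact_mod_cast hN
    have hb : ‖∑ n ∈ Finset.Icc (-(N : ℤ)) N, z ^ n‖ ≤ 2 / ‖z - 1‖ := by
      rw [le_div_iff₀ h1, mul_comm, ← norm_mul, sub_one_mul_sum_zpow_Icc h0]
      refine (norm_sub_le _ _).trans ?_
      simp only [norm_zpow, hz, one_zpow]
      norm_num
    have hn : ‖(1 / (2 * (N : ℂ) + 1))‖ ≤ 1 / (N : ℝ) := by
      have : (2 * (N : ℂ) + 1) = ((2 * N + 1 : ℕ) : ℂ) := by push_cast; rfl
      rw [this, norm_div, norm_one, Complex.norm_natCast]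
      push_cast
      gcongr
      linarith
    rw [norm_mul, div_eq_inv_mul _ (N : ℝ), ← one_div (N : ℝ)]
    gcongr

/-- The symmetric Cesàro averages of the powers of a unimodular number have norm at most `1`. -/
theorem norm_average_zpow_le {z : ℂ} (hz : ‖z‖ = 1) (N : ℕ) :
    ‖(1 / (2 * (N : ℂ) + 1)) * ∑ n ∈ Finset.Icc (-(N : ℤ)) N, z ^ n‖ ≤ 1 := by
  have hs : ‖∑ n ∈ Finset.Icc (-(N : ℤ)) N, z ^ n‖ ≤ 2 * (N : ℝ) + 1 := by
    refine (norm_sum_le _ _).trans ?_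
    have hc : (Finset.Icc (-(N : ℤ)) N).card = 2 * N + 1 := by
      rw [Int.card_Icc]; omega
    simp [norm_zpow, hz, hc]
  have hn : ‖(1 / (2 * (N : ℂ) + 1))‖ = 1 / (2 * (N : ℝ) + 1) := by
    have : (2 * (N : ℂ) + 1) = ((2 * N + 1 : ℕ) : ℂ) := by push_cast; rfl
    rw [this, norm_div, norm_one, Complex.norm_natCast]
    push_cast
    rfl
  rw [norm_mul, hn, one_div_mul_eq_div, div_le_one (by positivity)]
  exact hs

/-- The product measure of the diagonal is the sum of the squares of the atoms. -/
theorem prod_diagonal_eq_tsum_sq {α : Type*} [MeasurableSpace α] [MeasurableEq α]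
    [MeasurableSingletonClass α] (μ : Measure α) [IsFiniteMeasure μ] :
    (μ.prod μ) (Set.diagonal α) = ∑' x, μ {x} ^ 2 := by
  have hS : {x | 0 < μ {x}}.Countable :=
    Measure.countable_meas_pos_of_disjoint_iUnion (fun x => measurableSet_singleton x)
      fun x y hxy => Set.disjoint_singleton.2 hxy
  rw [Measure.prod_apply measurableSet_diagonal]
  have h1 : ∀ x : α, Prod.mk x ⁻¹' Set.diagonal α = {x} := by
    intro x; ext y; simp [eq_comm]
  simp only [h1]
  have h2 : (∫⁻ x, μ {x} ∂μ) = ∫⁻ x in {x | 0 < μ {x}}, μ {x} ∂μ := by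
    rw [← lintegral_indicator hS.measurableSet]
    congr with x
    by_cases hx : 0 < μ {x}
    · simp [Set.indicator, hx]
    · simp [Set.indicator, nonpos_iff_eq_zero.1 (not_lt.1 hx)]
  rw [h2, lintegral_countable _ hS, ← tsum_subtype_eq_of_support_subset (s := {x | 0 < μ {x}})]
  · simp only [sq]
  · intro x hx
    simp only [Function.mem_support] at hx
    exact pos_iff_ne_zero.2 fun h : μ {x} = 0 => hx (by simp [h])

/-- The squared modulus of a Fourier coefficient as a double integral. -/
theorem norm_sq_fourierCoeffM (μ : Measure ℝ) [IsFiniteMeasure μ] (n : ℤ) :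
    ((‖fourierCoeffM μ n‖ ^ 2 : ℝ) : ℂ) =
      ∫ p : ℝ × ℝ, Complex.exp (((2 * Real.pi * (p.2 - p.1) : ℝ) : ℂ) * Complex.I) ^ n
        ∂(μ.prod μ) := by
  have hconj : (starRingEnd ℂ) (fourierCoeffM μ n) =
      ∫ x, Complex.exp (2 * Real.pi * Complex.I * (n : ℂ) * (x : ℂ)) ∂μ := by
    rw [fourierCoeffM, ← integral_conj]
    congr with x
    rw [← Complex.exp_conj]
    simp [Complex.conj_ofNat]
  rw [Complex.ofReal_pow, ← Complex.mul_conj', hconj, fourierCoeffM, ← integral_prod_mul]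
  congr with p
  rw [← Complex.exp_add, ← Complex.exp_int_mul]
  congr 1
  push_cast
  ring

/-- The exponential `e^{2πi(y - x)}` equals `1` on `[0,1)²` exactly on the diagonal. -/
theorem exp_two_pi_sub_eq_one_iff {x y : ℝ} (hx : x ∈ Set.Ico (0 : ℝ) 1)
    (hy : y ∈ Set.Ico (0 : ℝ) 1) :
    Complex.exp (((2 * Real.pi * (y - x) : ℝ) : ℂ) * Complex.I) = 1 ↔ x = y := by
  constructor
  · intro h
    obtain ⟨k, hk⟩ := Complex.exp_eq_one_iff.1 h
    have hne : (2 * Real.pi * Complex.I : ℂ) ≠ 0 := Complex.two_pi_I_ne_zero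
    have hk' : ((y - x : ℝ) : ℂ) = ((k : ℝ) : ℂ) := by
      apply mul_right_cancel₀ hne
      push_cast at hk ⊢
      linear_combination hk
    have hk'' : y - x = k := by exact_mod_cast hk'
    have h1 : (k : ℝ) < 1 := by linarith [hx.1, hy.2]
    have h2 : (-1 : ℝ) < k := by linarith [hx.2, hy.1]
    have h1' : k < 1 := by exact_mod_cast h1
    have h2' : -1 < k := by exact_mod_cast h2
    obtain rfl : k = 0 := by omega
    push_cast at hk''
    linarith
  · rintro rfl
    simp

/-- Wiener's lemma: for every finite Borel measure `μ` on `[0,1)`, the Cesàro averages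
of the squared moduli of its Fourier coefficients converge to the sum of the squares
of its atoms: `(1/(2N+1)) Σ_{n=-N}^{N} |μ̂(n)|² → Σ_x μ({x})²`.  In particular, if `μ`
is atomless then `(1/(2N+1)) Σ_{n=-N}^{N} |μ̂(n)|² → 0`. -/
theorem stmt_8 (μ : Measure ℝ) [IsFiniteMeasure μ]
    (hsupp : μ (Set.Ico (0:ℝ) 1)ᶜ = 0) :
    Tendsto (fun N : ℕ => (1 / (2 * (N : ℝ) + 1)) *
        ∑ n ∈ Finset.Icc (-(N : ℤ)) (N : ℤ), ‖fourierCoeffM μ n‖ ^ 2)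
      atTop (nhds (∑' x : ℝ, ((μ {x}).toReal) ^ 2)) ∧
    ((∀ x : ℝ, μ {x} = 0) →
      Tendsto (fun N : ℕ => (1 / (2 * (N : ℝ) + 1)) *
          ∑ n ∈ Finset.Icc (-(N : ℤ)) (N : ℤ), ‖fourierCoeffM μ n‖ ^ 2)
        atTop (nhds 0)) := by
  have hmain : Tendsto (fun N : ℕ => (1 / (2 * (N : ℝ) + 1)) *
        ∑ n ∈ Finset.Icc (-(N : ℤ)) (N : ℤ), ‖fourierCoeffM μ n‖ ^ 2)
      atTop (nhds (∑' x : ℝ, ((μ {x}).toReal) ^ 2)) := by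
    let w : ℝ × ℝ → ℂ := fun p =>
      Complex.exp (((2 * Real.pi * (p.2 - p.1) : ℝ) : ℂ) * Complex.I)
    have hw : ∀ p, ‖w p‖ = 1 := fun p => Complex.norm_exp_ofReal_mul_I _
    have hwc : Continuous w := by fun_prop
    have hw0 : ∀ p, w p ≠ 0 := fun p => Complex.exp_ne_zero _
    have hzc : ∀ n : ℤ, Continuous fun p => w p ^ n := fun n =>
      hwc.zpow₀ n fun p => Or.inl (hw0 p)
    have hlim : Tendsto (fun N : ℕ => ∫ p, (1 / (2 * (N : ℂ) + 1)) *
        ∑ n ∈ Finset.Icc (-(N : ℤ)) N, w p ^ n ∂(μ.prod μ)) atTop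
        (nhds (∫ p, (if w p = 1 then 1 else 0) ∂(μ.prod μ))) := by
      refine tendsto_integral_of_dominated_convergence (fun _ => (1 : ℝ)) (fun N => ?_)
        (integrable_const _) (fun N => .of_forall fun p => norm_average_zpow_le (hw p) N)
        (.of_forall fun p => tendsto_average_zpow (hw p))
      exact (continuous_const.mul
        (continuous_finsetSum _ fun n _ => hzc n)).aestronglyMeasurable
    have hint : ∀ N : ℕ, (∫ p, (1 / (2 * (N : ℂ) + 1)) *
        ∑ n ∈ Finset.Icc (-(N : ℤ)) N, w p ^ n ∂(μ.prod μ)) =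
        (((1 / (2 * (N : ℝ) + 1)) *
          ∑ n ∈ Finset.Icc (-(N : ℤ)) (N : ℤ), ‖fourierCoeffM μ n‖ ^ 2 : ℝ) : ℂ) := by
      intro N
      rw [integral_const_mul, integral_finsetSum]
      · rw [Complex.ofReal_mul, Complex.ofReal_sum]
        simp only [norm_sq_fourierCoeffM]
        simp only [Complex.ofReal_div, Complex.ofReal_add, Complex.ofReal_mul,
          Complex.ofReal_one, Complex.ofReal_ofNat, Complex.ofReal_natCast, w]
      · intro n _
        refine (integrable_const (1 : ℝ)).mono' (hzc n).aestronglyMeasurable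
          (.of_forall fun p => ?_)
        rw [norm_zpow, hw, one_zpow]
    have hmem : ∀ᵐ x ∂μ, x ∈ Set.Ico (0 : ℝ) 1 := hsupp
    have hval : (∫ p, (if w p = 1 then (1 : ℂ) else 0) ∂(μ.prod μ)) =
        ((∑' x : ℝ, ((μ {x}).toReal) ^ 2 : ℝ) : ℂ) := by
      have hae : (fun p => if w p = 1 then (1 : ℂ) else 0) =ᵐ[μ.prod μ]
          (Set.diagonal ℝ).indicator fun _ => 1 := by
        filter_upwards [Measure.quasiMeasurePreserving_fst.ae hmem,
          Measure.quasiMeasurePreserving_snd.ae hmem] with p h1 h2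
        simp only [Set.indicator, Set.mem_diagonal_iff, w, exp_two_pi_sub_eq_one_iff h1 h2]
      rw [integral_congr_ae hae, integral_indicator_const _ measurableSet_diagonal,
        measureReal_def, prod_diagonal_eq_tsum_sq, ENNReal.tsum_toReal_eq
          fun x => ENNReal.pow_ne_top (measure_ne_top μ _)]
      simp
    rw [hval] at hlim
    simp only [hint] at hlim
    exact (Complex.continuous_re.tendsto _).comp hlim
  refine ⟨hmain, fun h => ?_⟩
  simpa [h] using hmain
end

section
/- The Fourier coefficients of the Cantor–Lebesgue measure μ_CL do not tend to zero: lim sup_{|n|→∞} |μ̂_CL(n)| > 0. Hence μ_CL is not a Menshov–Rajchman measure. -/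
open MeasureTheory Filter

/-- The real number whose ternary digits are `2 ε k`. -/
noncomputable def cantorSum (ε : ℕ → Bool) : ℝ :=
  ∑' k : ℕ, 2 * (if ε k then (1:ℝ) else 0) / 3 ^ (k + 1)

lemma hasSum_two_div_three_pow : HasSum (fun k : ℕ => (2:ℝ) / 3 ^ (k + 1)) 1 := by
  have h := (hasSum_geometric_of_lt_one (r := (1/3 : ℝ)) (by norm_num) (by norm_num)).mul_left (2/3)
  have hf : (fun k : ℕ => (2:ℝ) / 3 ^ (k + 1)) = fun k => 2 / 3 * (1 / 3) ^ k := by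
    funext k
    rw [one_div, inv_pow, pow_succ]
    field_simp
  have h1 : (2 / 3 * (1 - 1 / 3)⁻¹ : ℝ) = 1 := by norm_num
  rwa [h1, ← hf] at h

lemma cantorSum_term_nonneg (ε : ℕ → Bool) (k : ℕ) :
    0 ≤ 2 * (if ε k then (1:ℝ) else 0) / 3 ^ (k + 1) := by
  positivity

lemma cantorSum_term_le (ε : ℕ → Bool) (k : ℕ) :
    2 * (if ε k then (1:ℝ) else 0) / 3 ^ (k + 1) ≤ 2 / 3 ^ (k + 1) := by
  gcongr
  split_ifs <;> norm_num

lemma summable_cantorSum (ε : ℕ → Bool) :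
    Summable (fun k : ℕ => 2 * (if ε k then (1:ℝ) else 0) / 3 ^ (k + 1)) :=
  hasSum_two_div_three_pow.summable.of_nonneg_of_le (cantorSum_term_nonneg ε) (cantorSum_term_le ε)

lemma cantorSum_nonneg (ε : ℕ → Bool) : 0 ≤ cantorSum ε :=
  tsum_nonneg (cantorSum_term_nonneg ε)

lemma cantorSum_le_one (ε : ℕ → Bool) : cantorSum ε ≤ 1 :=
  hasSum_le (cantorSum_term_le ε) (summable_cantorSum ε).hasSum hasSum_two_div_three_pow

lemma three_mul_cantorSum (ε : ℕ → Bool) :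
    3 * cantorSum ε = 2 * (if ε 0 then (1:ℝ) else 0) + cantorSum (fun k => ε (k + 1)) := by
  unfold cantorSum
  rw [(summable_cantorSum ε).tsum_eq_zero_add, mul_add, ← tsum_mul_left]
  congr 1
  · ring
  · refine tsum_congr fun k => ?_
    rw [pow_succ 3 (k + 1)]
    field_simp

lemma measurable_cantorSum : Measurable cantorSum := by
  refine (continuous_tsum (u := fun k : ℕ => (2:ℝ) / 3 ^ (k + 1)) (fun k => ?_)
    hasSum_two_div_three_pow.summable fun k ε => ?_).measurable
  · exact (continuous_of_discreteTopology
      (f := fun b : Bool => 2 * (if b then (1:ℝ) else 0) / 3 ^ (k + 1))).comp (continuous_apply k)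
  · rw [Real.norm_of_nonneg (cantorSum_term_nonneg ε k)]
    exact cantorSum_term_le ε k

lemma cantorSum_le_third {ε : ℕ → Bool} (h : ε 0 = false) : cantorSum ε ≤ 1 / 3 := by
  have := three_mul_cantorSum ε
  have := cantorSum_le_one fun k => ε (k + 1)
  simp [h] at *
  linarith

lemma two_thirds_le_cantorSum {ε : ℕ → Bool} (h : ε 0 = true) : 2 / 3 ≤ cantorSum ε := by
  have := three_mul_cantorSum ε
  have := cantorSum_nonneg fun k => ε (k + 1)
  simp [h] at *
  linarith

lemma seven_tenths_le_cos {x : ℝ} (h0 : 0 ≤ x) (h1 : x ≤ 1 / 9) :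
    7 / 10 ≤ Real.cos (2 * Real.pi * x) := by
  have hpi := Real.pi_pos
  have h : Real.cos (Real.pi / 4) ≤ Real.cos (2 * Real.pi * x) :=
    Real.cos_le_cos_of_nonneg_of_le_pi (by positivity) (by linarith) (by nlinarith)
  rw [Real.cos_pi_div_four] at h
  have : (7 / 5 : ℝ) ≤ √2 := Real.le_sqrt_of_sq_le (by norm_num)
  linarith

lemma neg_half_le_cos {x : ℝ} (h0 : 0 ≤ x) (h1 : x ≤ 1 / 3) :
    -(1 / 2) ≤ Real.cos (2 * Real.pi * x) := by
  have hpi := Real.pi_pos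
  have h : Real.cos (Real.pi - Real.pi / 3) ≤ Real.cos (2 * Real.pi * x) :=
    Real.cos_le_cos_of_nonneg_of_le_pi (by positivity) (by linarith) (by nlinarith)
  rwa [Real.cos_pi_sub, Real.cos_pi_div_three] at h

lemma cos_two_pi_mul_one_sub (x : ℝ) :
    Real.cos (2 * Real.pi * (1 - x)) = Real.cos (2 * Real.pi * x) := by
  rw [mul_sub, mul_one, Real.cos_two_pi_sub]

lemma neg_half_le_cos_cantorSum (ε : ℕ → Bool) :
    -(1 / 2) ≤ Real.cos (2 * Real.pi * cantorSum ε) := by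
  cases h : ε 0
  · exact neg_half_le_cos (cantorSum_nonneg ε) (cantorSum_le_third h)
  · rw [← cos_two_pi_mul_one_sub]
    exact neg_half_le_cos (by linarith [cantorSum_le_one ε])
      (by linarith [two_thirds_le_cantorSum h])

lemma seven_tenths_le_cos_cantorSum {ε : ℕ → Bool} (h : ε 0 = ε 1) :
    7 / 10 ≤ Real.cos (2 * Real.pi * cantorSum ε) := by
  have h3 := three_mul_cantorSum ε
  cases h0 : ε 0
  · have h1 := cantorSum_le_third (ε := fun k => ε (k + 1)) (h.symm.trans h0)
    simp only [h0, Bool.false_eq_true, if_false] at h3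
    exact seven_tenths_le_cos (cantorSum_nonneg ε) (by linarith)
  · have h1 := two_thirds_le_cantorSum (ε := fun k => ε (k + 1)) (h.symm.trans h0)
    simp only [h0, if_true] at h3
    rw [← cos_two_pi_mul_one_sub]
    exact seven_tenths_le_cos (by linarith [cantorSum_le_one ε]) (by linarith)

lemma measurableSet_cylinder_bool (s : Finset ℕ) (v : ℕ → Bool) :
    MeasurableSet {ε : ℕ → Bool | ∀ i ∈ s, ε i = v i} := by
  have : {ε : ℕ → Bool | ∀ i ∈ s, ε i = v i} = ⋂ i ∈ s, (fun ε : ℕ → Bool => ε i) ⁻¹' {v i} := by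
    ext ε
    simp
  rw [this]
  exact s.measurableSet_biInter fun i _ => measurable_pi_apply i (measurableSet_singleton _)

/-- A finite measure on `ℕ → Bool` is determined by its values on cylinders. -/
lemma measure_ext_of_cylinder {P Q : Measure (ℕ → Bool)} [IsFiniteMeasure P]
    (h : ∀ (s : Finset ℕ) (v : ℕ → Bool),
      P {ε | ∀ i ∈ s, ε i = v i} = Q {ε | ∀ i ∈ s, ε i = v i}) : P = Q := by
  refine ext_of_generate_finite
    (Set.range fun p : Finset ℕ × (ℕ → Bool) => {ε : ℕ → Bool | ∀ i ∈ p.1, ε i = p.2 i})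
    (le_antisymm ?_ ?_) ?_ ?_ ?_
  · refine iSup_le fun i => ?_
    rw [← measurable_iff_comap_le]
    refine @measurable_to_countable' Bool (ℕ → Bool) _ _ (MeasurableSpace.generateFrom _) _ fun b => ?_
    refine MeasurableSpace.measurableSet_generateFrom ⟨({i}, fun _ => b), ?_⟩
    ext ε
    simp
  · refine MeasurableSpace.generateFrom_le ?_
    rintro _ ⟨p, rfl⟩
    exact measurableSet_cylinder_bool p.1 p.2
  · rintro _ ⟨⟨s, v⟩, rfl⟩ _ ⟨⟨t, w⟩, rfl⟩ ⟨u, hs, ht⟩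
    refine ⟨(s ∪ t, u), ?_⟩
    ext ε
    simp only [Set.mem_ofPred_eq, Set.mem_inter_iff, Finset.mem_union] at *
    constructor
    · exact fun h => ⟨fun i hi => (h i (.inl hi)).trans (hs i hi),
        fun i hi => (h i (.inr hi)).trans (ht i hi)⟩
    · rintro ⟨h1, h2⟩ i (hi | hi)
      · exact (h1 i hi).trans (hs i hi).symm
      · exact (h2 i hi).trans (ht i hi).symm
  · rintro _ ⟨p, rfl⟩
    exact h p.1 p.2
  · simpa using h ∅ fun _ => false

lemma measurePreserving_shift_bool {P : Measure (ℕ → Bool)} [IsFiniteMeasure P]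
    (hP : ∀ (s : Finset ℕ) (v : ℕ → Bool),
      P {ε | ∀ i ∈ s, ε i = v i} = (1 / 2 : ENNReal) ^ s.card) :
    MeasurePreserving (fun (ε : ℕ → Bool) k => ε (k + 1)) P P := by
  have hm : Measurable (fun (ε : ℕ → Bool) k => ε (k + 1)) :=
    measurable_pi_lambda _ fun k => measurable_pi_apply (k + 1)
  refine ⟨hm, (measure_ext_of_cylinder fun s v => ?_).symm⟩
  rw [Measure.map_apply hm (measurableSet_cylinder_bool s v), hP]
  have := hP (s.map ⟨(· + 1), add_left_injective 1⟩) fun k => v (k - 1)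
  rw [Finset.card_map] at this
  rw [← this]
  congr 1
  ext ε
  simp

lemma fourierCoeffM_map_cantorSum (P : Measure (ℕ → Bool)) (n : ℤ) :
    fourierCoeffM (P.map cantorSum) n =
      ∫ ε, Complex.exp (-(2 * Real.pi * Complex.I * (n : ℂ) * (cantorSum ε : ℂ))) ∂P := by
  unfold fourierCoeffM
  exact integral_map measurable_cantorSum.aemeasurable
    (by fun_prop : Continuous fun x : ℝ =>
      Complex.exp (-(2 * Real.pi * Complex.I * (n : ℂ) * (x : ℂ)))).aestronglyMeasurable

lemma norm_exp_neg_two_pi_I_mul (n : ℤ) (x : ℝ) :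
    ‖Complex.exp (-(2 * Real.pi * Complex.I * (n : ℂ) * (x : ℂ)))‖ = 1 := by
  rw [show -(2 * Real.pi * Complex.I * (n : ℂ) * (x : ℂ))
    = ((-(2 * Real.pi * n * x) : ℝ) : ℂ) * Complex.I by push_cast; ring]
  exact Complex.norm_exp_ofReal_mul_I _

lemma norm_fourierCoeffM_le_one (μ : Measure ℝ) [IsProbabilityMeasure μ] (n : ℤ) :
    ‖fourierCoeffM μ n‖ ≤ 1 := by
  simpa [fourierCoeffM] using norm_integral_le_of_norm_le_const (μ := μ)
    (Eventually.of_forall fun x => (norm_exp_neg_two_pi_I_mul n x).le)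

/-- The Fourier coefficients of the Cantor–Lebesgue measure are invariant under `n ↦ 3 n`. -/
lemma fourierCoeffM_three_mul {P : Measure (ℕ → Bool)} [IsFiniteMeasure P]
    (hP : ∀ (s : Finset ℕ) (v : ℕ → Bool),
      P {ε | ∀ i ∈ s, ε i = v i} = (1 / 2 : ENNReal) ^ s.card) (n : ℤ) :
    fourierCoeffM (P.map cantorSum) (3 * n) = fourierCoeffM (P.map cantorSum) n := by
  have hs := measurePreserving_shift_bool hP
  rw [fourierCoeffM_map_cantorSum, fourierCoeffM_map_cantorSum]
  nth_rewrite 2 [← hs.map_eq]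
  have hmeas : Measurable fun ε : ℕ → Bool =>
      Complex.exp (-(2 * Real.pi * Complex.I * (n : ℂ) * (cantorSum ε : ℂ))) := by
    have := measurable_cantorSum
    fun_prop
  rw [integral_map hs.measurable.aemeasurable hmeas.aestronglyMeasurable]
  refine integral_congr_ae (Eventually.of_forall fun ε => ?_)
  have h3 : (3 : ℂ) * cantorSum ε
      = 2 * (if ε 0 then (1:ℂ) else 0) + cantorSum (fun k => ε (k + 1)) := by
    have := congrArg Complex.ofReal (three_mul_cantorSum ε)
    split_ifs at this ⊢ <;> simpa using this
  refine Complex.exp_eq_exp_iff_exists_int.2 ⟨-(n * (2 * if ε 0 then 1 else 0)), ?_⟩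
  push_cast
  linear_combination (-(2 * Real.pi * Complex.I * (n : ℂ))) * h3

lemma fourierCoeffM_three_pow {P : Measure (ℕ → Bool)} [IsFiniteMeasure P]
    (hP : ∀ (s : Finset ℕ) (v : ℕ → Bool),
      P {ε | ∀ i ∈ s, ε i = v i} = (1 / 2 : ENNReal) ^ s.card) (m : ℕ) :
    fourierCoeffM (P.map cantorSum) (3 ^ m) = fourierCoeffM (P.map cantorSum) 1 := by
  induction m with
  | zero => simp
  | succ m ih => rw [pow_succ', fourierCoeffM_three_mul hP, ih]

lemma fourierCoeffM_one_re_pos {P : Measure (ℕ → Bool)} [IsProbabilityMeasure P]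
    (hP : ∀ (s : Finset ℕ) (v : ℕ → Bool),
      P {ε | ∀ i ∈ s, ε i = v i} = (1 / 2 : ENNReal) ^ s.card) :
    0 < (fourierCoeffM (P.map cantorSum) 1).re := by
  have hX := measurable_cantorSum
  have hexp : Integrable (fun ε : ℕ → Bool =>
      Complex.exp (-(2 * Real.pi * Complex.I * ((1 : ℤ) : ℂ) * (cantorSum ε : ℂ)))) P := by
    refine Integrable.of_bound (by fun_prop) 1 (Eventually.of_forall fun ε => ?_)
    exact (norm_exp_neg_two_pi_I_mul 1 _).le
  have hre : (fourierCoeffM (P.map cantorSum) 1).re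
      = ∫ ε, Real.cos (2 * Real.pi * cantorSum ε) ∂P := by
    rw [fourierCoeffM_map_cantorSum]
    refine (integral_re hexp).symm.trans (integral_congr_ae (Eventually.of_forall fun ε => ?_))
    have : -(2 * Real.pi * Complex.I * ((1 : ℤ) : ℂ) * (cantorSum ε : ℂ))
        = ((-(2 * Real.pi * cantorSum ε) : ℝ) : ℂ) * Complex.I := by push_cast; ring
    simp only [this]
    exact (Complex.exp_ofReal_mul_I_re _).trans (Real.cos_neg _)
  set C : Bool → Set (ℕ → Bool) := fun b => {ε | ∀ i ∈ Finset.range 2, ε i = b} with hC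
  have hCm (b) : MeasurableSet (C b) := measurableSet_cylinder_bool _ fun _ => b
  have hCP (b) : P.real (C b) = 1 / 4 := by
    rw [measureReal_def, hP (Finset.range 2) fun _ => b]
    norm_num
  have hCint (b) : Integrable ((C b).indicator fun _ => (6 / 5 : ℝ)) P :=
    (integrable_const _).indicator (hCm b)
  have hlow : ∫ ε, (-(1 / 2) + ((C true).indicator (fun _ => (6 / 5 : ℝ)) ε
      + (C false).indicator (fun _ => (6 / 5 : ℝ)) ε)) ∂P
      ≤ ∫ ε, Real.cos (2 * Real.pi * cantorSum ε) ∂P := by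
    refine integral_mono ((integrable_const _).add ((hCint _).add (hCint _))) ?_ fun ε => ?_
    · exact Integrable.of_bound (by fun_prop) 1
        (Eventually.of_forall fun ε => Real.abs_cos_le_one _)
    · have h1 := neg_half_le_cos_cantorSum ε
      have h2 := seven_tenths_le_cos_cantorSum (ε := ε)
      have hmem (b) : ε ∈ C b ↔ ε 0 = b ∧ ε 1 = b := by
        simp [hC, Finset.range_add_one, and_comm]
      simp only [Set.indicator_apply, hmem]
      cases h0 : ε 0 <;> cases h1 : ε 1 <;> simp [h0, h1] at h2 ⊢ <;> linarith
  have hsum : Integrable (fun ε => (C true).indicator (fun _ => (6 / 5 : ℝ)) ε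
      + (C false).indicator (fun _ => (6 / 5 : ℝ)) ε) P := (hCint _).add (hCint _)
  rw [integral_add (integrable_const _) hsum, integral_add (hCint _) (hCint _), integral_indicator_const _ (hCm _),
    integral_indicator_const _ (hCm _), hCP, hCP] at hlow
  rw [hre]
  refine lt_of_lt_of_le ?_ hlow
  norm_num

/-- Let `P` be the infinite product of Bernoulli(1/2) measures on `{0,1}^ℕ`
(characterized by its cylinder probabilities) and `μ_CL` the Cantor–Lebesgue measure,
the law of `Σ_{k=1}^∞ 2 ε_k 3^{-k}`.  Then the Fourier coefficients of `μ_CL` do not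
tend to zero: `lim sup_{|n|→∞} |μ̂_CL(n)| > 0`.  Hence `μ_CL` is not a
Menshov–Rajchman measure. -/
theorem stmt_11 (P : Measure (ℕ → Bool)) [IsProbabilityMeasure P]
    (hP : ∀ (s : Finset ℕ) (v : ℕ → Bool),
      P {ε | ∀ i ∈ s, ε i = v i} = (1 / 2 : ENNReal) ^ s.card)
    (μCL : Measure ℝ)
    (hμCL : μCL = Measure.map
      (fun ε : ℕ → Bool => ∑' k : ℕ, 2 * (if ε k then (1:ℝ) else 0) / 3 ^ (k + 1)) P) :
    0 < Filter.limsup (fun n : ℤ => ‖fourierCoeffM μCL n‖) cofinite ∧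
    ¬ Tendsto (fun n : ℤ => fourierCoeffM μCL n) cofinite (nhds 0) := by
  change μCL = P.map cantorSum at hμCL
  subst hμCL
  have hprob : IsProbabilityMeasure (P.map cantorSum) :=
    Measure.isProbabilityMeasure_map measurable_cantorSum.aemeasurable
  have hpos : 0 < ‖fourierCoeffM (P.map cantorSum) 1‖ :=
    (fourierCoeffM_one_re_pos hP).trans_le (Complex.re_le_norm _)
  have hfreq : ∃ᶠ n : ℤ in cofinite,
      ‖fourierCoeffM (P.map cantorSum) 1‖ ≤ ‖fourierCoeffM (P.map cantorSum) n‖ := by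
    rw [frequently_cofinite_iff_infinite]
    refine (Set.infinite_range_of_injective
      (pow_right_injective₀ (a := (3 : ℤ)) (by norm_num) (by norm_num))).mono ?_
    rintro _ ⟨m, rfl⟩
    exact (congrArg norm (fourierCoeffM_three_pow hP m)).ge
  refine ⟨hpos.trans_le (le_limsup_of_frequently_le hfreq ?_), fun ht => ?_⟩
  · exact isBoundedUnder_of ⟨1, norm_fourierCoeffM_le_one _⟩
  · have hlt := ht.norm.eventually_lt_const (norm_zero.trans_lt hpos)
    obtain ⟨n, h1, h2⟩ := (hfreq.and_eventually hlt).exists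
    exact h1.not_gt h2
end

section
/- Let (ω_n) be a sequence of positive integers with ω_{n+1}/ω_n ≥ q for some q > 3, let a_n ∈ (0,1] with Σ_{n=1}^∞ a_n² = ∞, and let φ_n ∈ ℝ. Then the probability measures ρ_N(x)dx on [0,1], where ρ_N(x) = Π_{n≤N} (1 + a_n cos(2π ω_n x + φ_n)), converge weakly as N → ∞ to a probability measure σ that is mutually singular with Lebesgue measure. -/
open MeasureTheory Filter

/-- The partial Riesz product `∏_{n < N} (1 + a_n cos (2π ω_n x + φ_n))`. -/
noncomputable def rieszProduct (ω : ℕ → ℕ) (a φ : ℕ → ℝ) (N : ℕ) (x : ℝ) : ℝ :=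
  ∏ n ∈ Finset.range N, (1 + a n * Real.cos (2 * Real.pi * (ω n : ℝ) * x + φ n))

section RieszProduct

variable {ω : ℕ → ℕ} {a φ : ℕ → ℝ}

lemma rieszProduct_succ (N : ℕ) (x : ℝ) :
    rieszProduct ω a φ (N + 1) x = rieszProduct ω a φ N x *
      (1 + a N * Real.cos (2 * Real.pi * (ω N : ℝ) * x + φ N)) :=
  Finset.prod_range_succ _ _

@[fun_prop]
lemma continuous_rieszProduct (N : ℕ) : Continuous (rieszProduct ω a φ N) := by
  unfold rieszProduct
  fun_prop

lemma rieszProduct_nonneg (ha0 : ∀ n, 0 ≤ a n) (ha1 : ∀ n, a n ≤ 1) (N : ℕ) (x : ℝ) :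
    0 ≤ rieszProduct ω a φ N x := by
  refine Finset.prod_nonneg fun n _ => ?_
  nlinarith [Real.neg_one_le_cos (2 * Real.pi * (ω n : ℝ) * x + φ n), ha0 n, ha1 n]

lemma integral_rieszProduct_succ_mul (N : ℕ) {g : ℝ → ℝ} (hg : Continuous g) :
    ∫ x in (0:ℝ)..1, rieszProduct ω a φ (N + 1) x * g x =
      (∫ x in (0:ℝ)..1, rieszProduct ω a φ N x * g x) +
      a N * ∫ x in (0:ℝ)..1, rieszProduct ω a φ N x *
        (Real.cos (2 * Real.pi * (ω N : ℝ) * x + φ N) * g x) := by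
  rw [← intervalIntegral.integral_const_mul, ← intervalIntegral.integral_add
    (Continuous.intervalIntegrable (by fun_prop) _ _)
    (Continuous.intervalIntegrable (by fun_prop) _ _)]
  refine intervalIntegral.integral_congr fun x _ => ?_
  simp only [rieszProduct_succ]
  ring

lemma integral_mul_cos_mul_cos {g : ℝ → ℝ} (hg : Continuous g) (k l : ℤ) (ψ χ : ℝ) :
    ∫ x in (0:ℝ)..1, g x * (Real.cos (2 * Real.pi * (k : ℝ) * x + ψ) *
        Real.cos (2 * Real.pi * (l : ℝ) * x + χ)) =
      ((∫ x in (0:ℝ)..1, g x * Real.cos (2 * Real.pi * ((k + l : ℤ) : ℝ) * x + (ψ + χ))) +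
      ∫ x in (0:ℝ)..1, g x * Real.cos (2 * Real.pi * ((k - l : ℤ) : ℝ) * x + (ψ - χ))) / 2 := by
  rw [← intervalIntegral.integral_add
    (Continuous.intervalIntegrable (by fun_prop) _ _)
    (Continuous.intervalIntegrable (by fun_prop) _ _), ← intervalIntegral.integral_div]
  refine intervalIntegral.integral_congr fun x _ => ?_
  have h1 : 2 * Real.pi * ((k + l : ℤ) : ℝ) * x + (ψ + χ) =
      (2 * Real.pi * (k : ℝ) * x + ψ) + (2 * Real.pi * (l : ℝ) * x + χ) := by push_cast; ring
  have h2 : 2 * Real.pi * ((k - l : ℤ) : ℝ) * x + (ψ - χ) =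
      (2 * Real.pi * (k : ℝ) * x + ψ) - (2 * Real.pi * (l : ℝ) * x + χ) := by push_cast; ring
  simp only [h1, h2, Real.cos_add _ (2 * Real.pi * (l : ℝ) * x + χ), Real.cos_sub]
  ring

/-- Multiplying by a partial Riesz product shifts frequencies by at most `∑ ω_n`, and costs a factor
`2 ^ N` in a bound for oscillatory integrals. -/
lemma abs_integral_mul_rieszProduct_mul_cos_le (ha0 : ∀ n, 0 ≤ a n) (ha1 : ∀ n, a n ≤ 1)
    {f : ℝ → ℝ} (hf : Continuous f) {B : ℝ} {μ : ℤ}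
    (hB : ∀ k : ℤ, μ ≤ k → ∀ ψ : ℝ,
      |∫ x in (0:ℝ)..1, f x * Real.cos (2 * Real.pi * (k : ℝ) * x + ψ)| ≤ B) (N : ℕ) :
    ∀ k : ℤ, μ + ∑ n ∈ Finset.range N, (ω n : ℤ) ≤ k → ∀ ψ : ℝ,
      |∫ x in (0:ℝ)..1, f x * rieszProduct ω a φ N x *
        Real.cos (2 * Real.pi * (k : ℝ) * x + ψ)| ≤ 2 ^ N * B := by
  induction N with
  | zero => simpa [rieszProduct] using hB
  | succ N ih =>
    intro k hk ψ
    rw [Finset.sum_range_succ] at hk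
    have key : ∫ x in (0:ℝ)..1, f x * rieszProduct ω a φ (N + 1) x *
          Real.cos (2 * Real.pi * (k : ℝ) * x + ψ) =
        (∫ x in (0:ℝ)..1, f x * rieszProduct ω a φ N x *
          Real.cos (2 * Real.pi * (k : ℝ) * x + ψ)) +
        a N * ∫ x in (0:ℝ)..1, (f x * rieszProduct ω a φ N x) *
          (Real.cos (2 * Real.pi * (k : ℝ) * x + ψ) *
            Real.cos (2 * Real.pi * ((ω N : ℤ) : ℝ) * x + φ N)) := by
      rw [← intervalIntegral.integral_const_mul, ← intervalIntegral.integral_add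
        (Continuous.intervalIntegrable (by fun_prop) _ _)
        (Continuous.intervalIntegrable (by fun_prop) _ _)]
      refine intervalIntegral.integral_congr fun x _ => ?_
      simp only [rieszProduct_succ, Int.cast_natCast]
      ring
    rw [key, integral_mul_cos_mul_cos (by fun_prop)]
    have h0 := abs_le.1 (ih k (by linarith [Int.natCast_nonneg (ω N)]) ψ)
    have h1 := abs_le.1 (ih (k + ω N) (by linarith [Int.natCast_nonneg (ω N)]) (ψ + φ N))
    have h2 := abs_le.1 (ih (k - ω N) (by linarith) (ψ - φ N))
    generalize (∫ x in (0:ℝ)..1, f x * rieszProduct ω a φ N x *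
          Real.cos (2 * Real.pi * (k : ℝ) * x + ψ)) = I0 at *
    generalize (∫ x in (0:ℝ)..1, f x * rieszProduct ω a φ N x *
          Real.cos (2 * Real.pi * ((k + ω N : ℤ) : ℝ) * x + (ψ + φ N))) = I1 at *
    generalize (∫ x in (0:ℝ)..1, f x * rieszProduct ω a φ N x *
          Real.cos (2 * Real.pi * ((k - ω N : ℤ) : ℝ) * x + (ψ - φ N))) = I2 at *
    have hI : |(I1 + I2) / 2| ≤ 2 ^ N * B := abs_le.2 ⟨by linarith, by linarith⟩
    have hI' : |a N * ((I1 + I2) / 2)| ≤ 2 ^ N * B := by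
      rw [abs_mul, abs_of_nonneg (ha0 N)]
      nlinarith [ha0 N, ha1 N, abs_nonneg ((I1 + I2) / 2)]
    calc _ ≤ |I0| + |a N * ((I1 + I2) / 2)| := abs_add_le _ _
      _ ≤ 2 ^ N * B + 2 ^ N * B := add_le_add (abs_le.2 h0) hI'
      _ = 2 ^ (N + 1) * B := by ring

lemma integral_cos_two_pi_int_mul_add {k : ℤ} (hk : k ≠ 0) (ψ : ℝ) :
    ∫ x in (0:ℝ)..1, Real.cos (2 * Real.pi * (k : ℝ) * x + ψ) = 0 := by
  have hk' : (2 * Real.pi * (k : ℝ)) ≠ 0 := by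
    have : (k : ℝ) ≠ 0 := by exact_mod_cast hk
    positivity
  rw [intervalIntegral.integral_comp_mul_add (fun x => Real.cos x) hk', integral_cos]
  have : 2 * Real.pi * (k : ℝ) * 1 + ψ = ψ + k * (2 * Real.pi) := by ring
  rw [this, Real.sin_add_int_mul_two_pi]
  simp

lemma integral_rieszProduct_mul_cos (ha0 : ∀ n, 0 ≤ a n) (ha1 : ∀ n, a n ≤ 1) {N : ℕ} {k : ℤ}
    (hk : ∑ n ∈ Finset.range N, (ω n : ℤ) < k) (ψ : ℝ) :
    ∫ x in (0:ℝ)..1, rieszProduct ω a φ N x * Real.cos (2 * Real.pi * (k : ℝ) * x + ψ) = 0 := by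
  have h := abs_integral_mul_rieszProduct_mul_cos_le (ω := ω) (φ := φ) ha0 ha1
    (continuous_const (y := (1:ℝ))) (B := 0) (μ := 1) (fun k hk ψ => by
      simp only [one_mul]
      rw [integral_cos_two_pi_int_mul_add (by omega), abs_zero]) N k (by omega) ψ
  simpa using h

lemma integral_rieszProduct_mul_cos_mul_cos (ha0 : ∀ n, 0 ≤ a n) (ha1 : ∀ n, a n ≤ 1)
    {N : ℕ} {k l : ℤ} (hl : 0 ≤ l)
    (hk : ∑ n ∈ Finset.range N, (ω n : ℤ) + l < k) (ψ χ : ℝ) :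
    ∫ x in (0:ℝ)..1, rieszProduct ω a φ N x * (Real.cos (2 * Real.pi * (k : ℝ) * x + ψ) *
      Real.cos (2 * Real.pi * (l : ℝ) * x + χ)) = 0 := by
  rw [integral_mul_cos_mul_cos (by fun_prop), integral_rieszProduct_mul_cos ha0 ha1 (by omega),
    integral_rieszProduct_mul_cos ha0 ha1 (by omega)]
  simp

lemma integral_rieszProduct_mul_cos_mul_cos_mul_cos (ha0 : ∀ n, 0 ≤ a n) (ha1 : ∀ n, a n ≤ 1)
    {N : ℕ} {k l m : ℤ} (hl : 0 ≤ l) (hm : 0 ≤ m)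
    (hk : ∑ n ∈ Finset.range N, (ω n : ℤ) + l + m < k) (ψ χ ξ : ℝ) :
    ∫ x in (0:ℝ)..1, rieszProduct ω a φ N x * (Real.cos (2 * Real.pi * (k : ℝ) * x + ψ) *
      (Real.cos (2 * Real.pi * (l : ℝ) * x + χ) *
        Real.cos (2 * Real.pi * (m : ℝ) * x + ξ))) = 0 := by
  have h := integral_mul_cos_mul_cos (g := fun x => rieszProduct ω a φ N x *
    Real.cos (2 * Real.pi * (m : ℝ) * x + ξ)) (by fun_prop) k l ψ χ
  have e (j : ℤ) (η : ℝ) (hj : ∑ n ∈ Finset.range N, (ω n : ℤ) + m < j) :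
      ∫ x in (0:ℝ)..1, rieszProduct ω a φ N x * Real.cos (2 * Real.pi * (m : ℝ) * x + ξ) *
        Real.cos (2 * Real.pi * (j : ℝ) * x + η) = 0 := by
    refine Eq.trans (intervalIntegral.integral_congr fun x _ => ?_)
      (integral_rieszProduct_mul_cos_mul_cos (φ := φ) ha0 ha1 hm hj η ξ)
    ring
  rw [e _ _ (by omega), e _ _ (by omega)] at h
  rw [add_zero, zero_div] at h
  refine Eq.trans (intervalIntegral.integral_congr fun x _ => ?_) h
  ring

lemma two_mul_sum_range_lt (hω : ∀ n, 0 < ω n) (h3 : ∀ n, 3 * ω n ≤ ω (n + 1)) (N : ℕ) :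
    2 * ∑ n ∈ Finset.range N, (ω n : ℤ) < ω N := by
  induction N with
  | zero => simpa using hω 0
  | succ N ih =>
    rw [Finset.sum_range_succ]
    have := h3 N
    omega

lemma three_pow_le (hω : ∀ n, 0 < ω n) (h3 : ∀ n, 3 * ω n ≤ ω (n + 1)) (N : ℕ) :
    3 ^ N ≤ ω N := by
  induction N with
  | zero => simpa using Nat.succ_le_of_lt (hω 0)
  | succ N ih =>
    have := h3 N
    rw [pow_succ]
    omega

lemma integral_rieszProduct_mul_eq_of_le {g : ℝ → ℝ} (hg : Continuous g) {M N : ℕ} (hMN : M ≤ N)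
    (h : ∀ k, M ≤ k → ∫ x in (0:ℝ)..1, rieszProduct ω a φ k x *
      (Real.cos (2 * Real.pi * (ω k : ℝ) * x + φ k) * g x) = 0) :
    ∫ x in (0:ℝ)..1, rieszProduct ω a φ N x * g x =
      ∫ x in (0:ℝ)..1, rieszProduct ω a φ M x * g x := by
  induction N, hMN using Nat.le_induction with
  | base => rfl
  | succ k hk ih => rw [integral_rieszProduct_succ_mul k hg, h k hk, ih, mul_zero, add_zero]

lemma integral_rieszProduct (hω : ∀ n, 0 < ω n) (h3 : ∀ n, 3 * ω n ≤ ω (n + 1))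
    (ha0 : ∀ n, 0 ≤ a n) (ha1 : ∀ n, a n ≤ 1) (N : ℕ) :
    ∫ x in (0:ℝ)..1, rieszProduct ω a φ N x = 1 := by
  have h := integral_rieszProduct_mul_eq_of_le (ω := ω) (a := a) (φ := φ)
    (continuous_const (y := (1:ℝ))) (Nat.zero_le N) (fun k _ => by
      have := two_mul_sum_range_lt hω h3 k
      have h0 : (0:ℤ) ≤ ∑ n ∈ Finset.range k, (ω n : ℤ) := by positivity
      simpa using integral_rieszProduct_mul_cos (φ := φ) (k := ω k) ha0 ha1 (by omega) (φ k))
  simpa [rieszProduct] using h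

lemma integral_rieszProduct_mul_cos_self (hω : ∀ n, 0 < ω n) (h3 : ∀ n, 3 * ω n ≤ ω (n + 1))
    (ha0 : ∀ n, 0 ≤ a n) (ha1 : ∀ n, a n ≤ 1) {n N : ℕ} (hn : n < N) :
    ∫ x in (0:ℝ)..1, rieszProduct ω a φ N x * Real.cos (2 * Real.pi * (ω n : ℝ) * x + φ n) =
      a n / 2 := by
  have hP := two_mul_sum_range_lt hω h3 n
  have h0 : (0:ℤ) ≤ ∑ j ∈ Finset.range n, (ω j : ℤ) := by positivity
  rw [integral_rieszProduct_mul_eq_of_le (by fun_prop) (Nat.succ_le_of_lt hn),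
    integral_rieszProduct_succ_mul _ (by fun_prop)]
  · have h1 := integral_rieszProduct_mul_cos (ω := ω) (φ := φ) (N := n) (k := ω n) ha0 ha1
      (by omega) (φ n)
    have h2 := integral_mul_cos_mul_cos (continuous_rieszProduct (ω := ω) (a := a) (φ := φ) n)
      (ω n) (ω n) (φ n) (φ n)
    rw [integral_rieszProduct_mul_cos ha0 ha1 (by omega)] at h2
    simp only [Int.cast_natCast] at h1 h2
    rw [h1, h2]
    simp [integral_rieszProduct hω h3 ha0 ha1]
    ring
  · intro k hk
    have hPk := two_mul_sum_range_lt hω h3 k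
    have hnk : (ω n : ℤ) ≤ ∑ j ∈ Finset.range k, (ω j : ℤ) :=
      Finset.single_le_sum (f := fun j => (ω j : ℤ)) (fun _ _ => by positivity)
        (Finset.mem_range.2 hk)
    simpa using integral_rieszProduct_mul_cos_mul_cos (φ := φ) (k := ω k) (l := ω n) ha0 ha1
      (by positivity) (by omega) (φ k) (φ n)

lemma integral_rieszProduct_mul_cos_mul_cos_of_lt (hω : ∀ n, 0 < ω n)
    (h3 : ∀ n, 3 * ω n ≤ ω (n + 1)) (ha0 : ∀ n, 0 ≤ a n) (ha1 : ∀ n, a n ≤ 1) {n m N : ℕ}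
    (hnm : n < m) (hm : m < N) :
    ∫ x in (0:ℝ)..1, rieszProduct ω a φ N x * (Real.cos (2 * Real.pi * (ω m : ℝ) * x + φ m) *
      Real.cos (2 * Real.pi * (ω n : ℝ) * x + φ n)) = a m / 2 * (a n / 2) := by
  have hPm := two_mul_sum_range_lt hω h3 m
  have hnm' : (ω n : ℤ) ≤ ∑ j ∈ Finset.range m, (ω j : ℤ) :=
    Finset.single_le_sum (f := fun j => (ω j : ℤ)) (fun _ _ => by positivity)
      (Finset.mem_range.2 hnm)
  rw [integral_rieszProduct_mul_eq_of_le (by fun_prop) (Nat.succ_le_of_lt hm),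
    integral_rieszProduct_succ_mul _ (by fun_prop)]
  · have h1 := integral_rieszProduct_mul_cos_mul_cos (ω := ω) (φ := φ) (N := m) (k := ω m)
      (l := ω n) ha0 ha1 (by positivity) (by omega) (φ m) (φ n)
    have h2 := integral_mul_cos_mul_cos (g := fun x => rieszProduct ω a φ m x *
      Real.cos (2 * Real.pi * (ω n : ℝ) * x + φ n)) (by fun_prop) (ω m) (ω m) (φ m) (φ m)
    have h4 := integral_rieszProduct_mul_cos_mul_cos (ω := ω) (φ := φ) (N := m)
      (k := ω m + ω m) (l := ω n) ha0 ha1 (by positivity) (by omega) (φ m + φ m) (φ n)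
    have h5 := integral_rieszProduct_mul_cos_self (φ := φ) hω h3 ha0 ha1 hnm
    simp only [Int.cast_natCast] at h1 h2 h4
    have h6 : ∫ x in (0:ℝ)..1, rieszProduct ω a φ m x *
        Real.cos (2 * Real.pi * (ω n : ℝ) * x + φ n) *
        Real.cos (2 * Real.pi * ((ω m + ω m : ℤ) : ℝ) * x + (φ m + φ m)) = 0 := by
      refine Eq.trans (intervalIntegral.integral_congr fun x _ => ?_) h4
      ring
    rw [h6] at h2
    simp only [sub_self, Int.cast_zero, mul_zero, zero_mul, add_zero, Real.cos_zero, mul_one,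
      zero_add, h5] at h2
    rw [h1, zero_add]
    have h7 : ∫ x in (0:ℝ)..1, rieszProduct ω a φ m x *
        (Real.cos (2 * Real.pi * (ω m : ℝ) * x + φ m) *
        (Real.cos (2 * Real.pi * (ω m : ℝ) * x + φ m) *
          Real.cos (2 * Real.pi * (ω n : ℝ) * x + φ n))) = a n / 2 / 2 := by
      rw [← h2]
      refine intervalIntegral.integral_congr fun x _ => ?_
      ring
    rw [h7]
    ring
  · intro k hk
    have hPk := two_mul_sum_range_lt hω h3 k
    have hsub : (∑ j ∈ Finset.range m, (ω j : ℤ)) + ω m ≤ ∑ j ∈ Finset.range k, (ω j : ℤ) := by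
      rw [← Finset.sum_range_succ]
      exact Finset.sum_le_sum_of_subset_of_nonneg (Finset.range_mono hk)
        (fun _ _ _ => by positivity)
    simpa using integral_rieszProduct_mul_cos_mul_cos_mul_cos (φ := φ) (k := ω k) (l := ω m)
      (m := ω n) ha0 ha1 (by positivity) (by positivity) (by omega) (φ k) (φ m) (φ n)

/-- The centred functions `cos (2π ω_n x + φ_n) - a_n / 2` are orthogonal with respect to every
partial Riesz product containing their factors. -/
lemma integral_rieszProduct_mul_sum_sq_le (hω : ∀ n, 0 < ω n)
    (h3 : ∀ n, 3 * ω n ≤ ω (n + 1)) (ha0 : ∀ n, 0 ≤ a n) (ha1 : ∀ n, a n ≤ 1) (b : ℕ → ℝ)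
    {M N : ℕ} (hMN : M ≤ N) :
    ∫ x in (0:ℝ)..1, rieszProduct ω a φ N x * (∑ n ∈ Finset.range M,
      b n * (Real.cos (2 * Real.pi * (ω n : ℝ) * x + φ n) - a n / 2)) ^ 2 ≤
    4 * ∑ n ∈ Finset.range M, b n ^ 2 := by
  set Y : ℕ → ℝ → ℝ := fun n x => Real.cos (2 * Real.pi * (ω n : ℝ) * x + φ n) - a n / 2 with hY
  have hYc (n : ℕ) : Continuous (Y n) := by simp only [hY]; fun_prop
  have off_lt {n m : ℕ} (hnm : n < m) (hm : m < N) :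
      ∫ x in (0:ℝ)..1, rieszProduct ω a φ N x * (Y n x * Y m x) = 0 := by
    have e : ∀ x, rieszProduct ω a φ N x * (Y n x * Y m x) =
        rieszProduct ω a φ N x * (Real.cos (2 * Real.pi * (ω m : ℝ) * x + φ m) *
          Real.cos (2 * Real.pi * (ω n : ℝ) * x + φ n)) -
        a m / 2 * (rieszProduct ω a φ N x * Real.cos (2 * Real.pi * (ω n : ℝ) * x + φ n)) -
        a n / 2 * (rieszProduct ω a φ N x * Real.cos (2 * Real.pi * (ω m : ℝ) * x + φ m)) +
        a m / 2 * (a n / 2) * rieszProduct ω a φ N x := fun x => by simp only [hY]; ring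
    simp only [e]
    rw [intervalIntegral.integral_add (Continuous.intervalIntegrable (by fun_prop) _ _)
        (Continuous.intervalIntegrable (by fun_prop) _ _),
      intervalIntegral.integral_sub (Continuous.intervalIntegrable (by fun_prop) _ _)
        (Continuous.intervalIntegrable (by fun_prop) _ _),
      intervalIntegral.integral_sub (Continuous.intervalIntegrable (by fun_prop) _ _)
        (Continuous.intervalIntegrable (by fun_prop) _ _),
      intervalIntegral.integral_const_mul, intervalIntegral.integral_const_mul,
      intervalIntegral.integral_const_mul,
      integral_rieszProduct_mul_cos_mul_cos_of_lt hω h3 ha0 ha1 hnm hm,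
      integral_rieszProduct_mul_cos_self hω h3 ha0 ha1 hm,
      integral_rieszProduct_mul_cos_self hω h3 ha0 ha1 (hnm.trans hm),
      integral_rieszProduct hω h3 ha0 ha1]
    ring
  have off {n m : ℕ} (hnm : n ≠ m) (hn : n < N) (hm : m < N) :
      ∫ x in (0:ℝ)..1, rieszProduct ω a φ N x * (Y n x * Y m x) = 0 := by
    rcases lt_or_gt_of_ne hnm with h | h
    · exact off_lt h hm
    · simpa only [mul_comm (Y m _)] using off_lt h hn
  have diag (n : ℕ) : ∫ x in (0:ℝ)..1, rieszProduct ω a φ N x * (Y n x * Y n x) ≤ 4 := by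
    calc _ ≤ ∫ x in (0:ℝ)..1, rieszProduct ω a φ N x * 4 := by
          refine intervalIntegral.integral_mono_on zero_le_one
            (Continuous.intervalIntegrable (by fun_prop) _ _)
            (Continuous.intervalIntegrable (by fun_prop) _ _) fun x _ => ?_
          refine mul_le_mul_of_nonneg_left ?_ (rieszProduct_nonneg ha0 ha1 N x)
          have h1 := Real.neg_one_le_cos (2 * Real.pi * (ω n : ℝ) * x + φ n)
          have h2 := Real.cos_le_one (2 * Real.pi * (ω n : ℝ) * x + φ n)
          have h3 : -2 ≤ Y n x := by simp only [hY]; linarith [ha1 n]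
          have h4 : Y n x ≤ 2 := by simp only [hY]; linarith [ha0 n]
          nlinarith
      _ = 4 := by rw [intervalIntegral.integral_mul_const, integral_rieszProduct hω h3 ha0 ha1,
          one_mul]
  have expand : ∀ x, rieszProduct ω a φ N x * (∑ n ∈ Finset.range M, b n * Y n x) ^ 2 =
      ∑ n ∈ Finset.range M, ∑ m ∈ Finset.range M,
        b n * b m * (rieszProduct ω a φ N x * (Y n x * Y m x)) := fun x => by
    rw [sq, Finset.sum_mul_sum, Finset.mul_sum]
    refine Finset.sum_congr rfl fun n _ => ?_
    rw [Finset.mul_sum]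
    exact Finset.sum_congr rfl fun m _ => by ring
  change ∫ x in (0:ℝ)..1, rieszProduct ω a φ N x * (∑ n ∈ Finset.range M, b n * Y n x) ^ 2 ≤ _
  simp only [expand]
  rw [intervalIntegral.integral_finsetSum
    fun n _ => Continuous.intervalIntegrable (by fun_prop) _ _, Finset.mul_sum]
  refine Finset.sum_le_sum fun n hn => ?_
  rw [intervalIntegral.integral_finsetSum
    fun m _ => Continuous.intervalIntegrable (by fun_prop) _ _,
    Finset.sum_eq_single_of_mem n hn fun m hm hmn => ?_]
  · rw [intervalIntegral.integral_const_mul]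
    nlinarith [diag n, sq_nonneg (b n)]
  · rw [intervalIntegral.integral_const_mul, off hmn.symm
      ((Finset.mem_range.1 hn).trans_le hMN) ((Finset.mem_range.1 hm).trans_le hMN), mul_zero]

lemma exists_abs_integral_mul_cos_le {f : ℝ → ℝ} (hf : ContDiff ℝ 1 f) :
    ∃ C : ℝ, 0 ≤ C ∧ ∀ k : ℤ, 0 < k → ∀ ψ : ℝ,
      |∫ x in (0:ℝ)..1, f x * Real.cos (2 * Real.pi * (k : ℝ) * x + ψ)| ≤ C / k := by
  have hf' : Continuous (deriv f) := hf.continuous_deriv le_rfl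
  have hI : 0 ≤ ∫ x in (0:ℝ)..1, |deriv f x| :=
    intervalIntegral.integral_nonneg zero_le_one fun x _ => abs_nonneg _
  refine ⟨|f 1| + |f 0| + ∫ x in (0:ℝ)..1, |deriv f x|, by positivity, fun k hk ψ => ?_⟩
  have hk' : (0:ℝ) < k := by exact_mod_cast hk
  set v : ℝ → ℝ := fun x => Real.sin (2 * Real.pi * (k : ℝ) * x + ψ) / (2 * Real.pi * k) with hv
  have hvc : Continuous v := by simp only [hv]; fun_prop
  have hvd (x : ℝ) : HasDerivAt v (Real.cos (2 * Real.pi * (k : ℝ) * x + ψ)) x := by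
    have h := ((((hasDerivAt_id x).const_mul (2 * Real.pi * (k : ℝ))).add_const ψ).sin).div_const
      (2 * Real.pi * k)
    convert! h using 1
    simp only [id]
    field_simp
  have hvb (x : ℝ) : |v x| ≤ 1 / k := by
    simp only [hv]
    rw [abs_div, abs_of_pos (by positivity : 0 < 2 * Real.pi * (k : ℝ))]
    refine div_le_div₀ zero_le_one (Real.abs_sin_le_one _) hk' ?_
    nlinarith [Real.pi_gt_three]
  rw [intervalIntegral.integral_mul_deriv_eq_deriv_mul
    (fun x _ => (hf.differentiable one_ne_zero x).hasDerivAt) (fun x _ => hvd x)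
    (hf'.intervalIntegrable _ _) (Continuous.intervalIntegrable (by fun_prop) _ _)]
  have h3 : |∫ x in (0:ℝ)..1, deriv f x * v x| ≤ (∫ x in (0:ℝ)..1, |deriv f x|) * (1 / k) := by
    rw [← intervalIntegral.integral_mul_const]
    refine (intervalIntegral.abs_integral_le_integral_abs zero_le_one).trans ?_
    refine intervalIntegral.integral_mono_on zero_le_one
      (Continuous.intervalIntegrable (by fun_prop) _ _)
      (Continuous.intervalIntegrable (by fun_prop) _ _) fun x _ => ?_
    rw [abs_mul]
    exact mul_le_mul_of_nonneg_left (hvb x) (abs_nonneg _)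
  have h1 : |f 1 * v 1| ≤ |f 1| * (1 / k) := by
    rw [abs_mul]; exact mul_le_mul_of_nonneg_left (hvb 1) (abs_nonneg _)
  have h0 : |f 0 * v 0| ≤ |f 0| * (1 / k) := by
    rw [abs_mul]; exact mul_le_mul_of_nonneg_left (hvb 0) (abs_nonneg _)
  calc _ ≤ |f 1 * v 1| + |f 0 * v 0| + |∫ x in (0:ℝ)..1, deriv f x * v x| :=
        (abs_sub _ _).trans (add_le_add_left (abs_sub _ _) _)
    _ ≤ |f 1| * (1 / k) + |f 0| * (1 / k) + (∫ x in (0:ℝ)..1, |deriv f x|) * (1 / k) := by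
        gcongr
    _ = _ := by ring

lemma cauchySeq_integral_rieszProduct_mul_of_contDiff (hω : ∀ n, 0 < ω n)
    (h3 : ∀ n, 3 * ω n ≤ ω (n + 1)) (ha0 : ∀ n, 0 ≤ a n) (ha1 : ∀ n, a n ≤ 1) {f : ℝ → ℝ}
    (hf : ContDiff ℝ 1 f) :
    CauchySeq fun N => ∫ x in (0:ℝ)..1, rieszProduct ω a φ N x * f x := by
  obtain ⟨C, hC0, hC⟩ := exists_abs_integral_mul_cos_le hf
  have hfc := hf.continuous
  refine cauchySeq_of_le_geometric (2 / 3) (2 * C) (by norm_num) fun N => ?_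
  rw [dist_comm, Real.dist_eq, integral_rieszProduct_succ_mul N hfc, add_sub_cancel_left, abs_mul,
    abs_of_nonneg (ha0 N)]
  have hP := two_mul_sum_range_lt hω h3 N
  have h3N := three_pow_le hω h3 N
  have hP0 : (0:ℤ) ≤ ∑ j ∈ Finset.range N, (ω j : ℤ) := by positivity
  obtain ⟨μ, hμ⟩ : ∃ μ : ℤ, μ = ω N - ∑ j ∈ Finset.range N, (ω j : ℤ) := ⟨_, rfl⟩
  have hμ0 : 0 < μ := by omega
  have hμ0' : (0:ℝ) < μ := by exact_mod_cast hμ0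
  have hμ3 : (3:ℝ) ^ N ≤ 2 * μ := by
    have : (3:ℤ) ^ N ≤ ω N := by exact_mod_cast h3N
    have : (3:ℤ) ^ N ≤ 2 * μ := by omega
    exact_mod_cast this
  have h := abs_integral_mul_rieszProduct_mul_cos_le (ω := ω) (φ := φ) ha0 ha1 hfc (B := C / μ)
    (μ := μ) (fun k hk ψ => (hC k (by omega) ψ).trans
      (div_le_div_of_nonneg_left hC0 hμ0' (by exact_mod_cast hk))) N (ω N) (by omega) (φ N)
  have e : ∫ x in (0:ℝ)..1, rieszProduct ω a φ N x *
        (Real.cos (2 * Real.pi * (ω N : ℝ) * x + φ N) * f x) =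
      ∫ x in (0:ℝ)..1, f x * rieszProduct ω a φ N x *
        Real.cos (2 * Real.pi * ((ω N : ℤ) : ℝ) * x + φ N) := by
    refine intervalIntegral.integral_congr fun x _ => ?_
    simp only [Int.cast_natCast]
    ring
  rw [e]
  calc _ ≤ 1 * (2 ^ N * (C / μ)) := mul_le_mul (ha1 N) h (abs_nonneg _) zero_le_one
    _ = 2 ^ N * C / μ := by ring
    _ ≤ 2 ^ N * C / (3 ^ N / 2) :=
        div_le_div_of_nonneg_left (by positivity) (by positivity) (by linarith)
    _ = 2 * C * (2 / 3) ^ N := by rw [div_pow]; field_simp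

lemma cauchySeq_integral_rieszProduct_mul (hω : ∀ n, 0 < ω n)
    (h3 : ∀ n, 3 * ω n ≤ ω (n + 1)) (ha0 : ∀ n, 0 ≤ a n) (ha1 : ∀ n, a n ≤ 1) {f : ℝ → ℝ}
    (hf : Continuous f) :
    CauchySeq fun N => ∫ x in (0:ℝ)..1, rieszProduct ω a φ N x * f x := by
  rw [Metric.cauchySeq_iff']
  intro ε hε
  obtain ⟨p, hp⟩ := exists_polynomial_near_of_continuousOn 0 1 f hf.continuousOn (ε / 4)
    (by positivity)
  have hpc : Continuous fun x => p.eval x := p.continuous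
  obtain ⟨K, hK⟩ := Metric.cauchySeq_iff'.1 (cauchySeq_integral_rieszProduct_mul_of_contDiff
    (φ := φ) hω h3 ha0 ha1 (f := fun x => p.eval x)
    (by simpa [Polynomial.aeval_def] using p.contDiff_aeval (𝕜 := ℝ) 1)) (ε / 4) (by positivity)
  have near (N : ℕ) : |(∫ x in (0:ℝ)..1, rieszProduct ω a φ N x * p.eval x) -
      ∫ x in (0:ℝ)..1, rieszProduct ω a φ N x * f x| ≤ ε / 4 := by
    rw [← intervalIntegral.integral_sub (Continuous.intervalIntegrable (by fun_prop) _ _)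
        (Continuous.intervalIntegrable (by fun_prop) _ _)]
    calc _ ≤ ∫ x in (0:ℝ)..1, |rieszProduct ω a φ N x * p.eval x - rieszProduct ω a φ N x * f x| :=
          intervalIntegral.abs_integral_le_integral_abs zero_le_one
      _ ≤ ∫ x in (0:ℝ)..1, rieszProduct ω a φ N x * (ε / 4) := by
          refine intervalIntegral.integral_mono_on zero_le_one
            (Continuous.intervalIntegrable (by fun_prop) _ _)
            (Continuous.intervalIntegrable (by fun_prop) _ _) fun x hx => ?_
          rw [← mul_sub, abs_mul, abs_of_nonneg (rieszProduct_nonneg ha0 ha1 N x)]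
          exact mul_le_mul_of_nonneg_left (hp x hx).le (rieszProduct_nonneg ha0 ha1 N x)
      _ = ε / 4 := by
          rw [intervalIntegral.integral_mul_const, integral_rieszProduct hω h3 ha0 ha1, one_mul]
  refine ⟨K, fun N hN => ?_⟩
  have h1 := abs_lt.1 (hK N hN)
  have h2 := abs_le.1 (near N)
  have h4 := abs_le.1 (near K)
  rw [Real.dist_eq, abs_lt]
  constructor <;> linarith

end RieszProduct

/-- Probability measures carried by a fixed compact set converge weakly as soon as the integrals of
bounded continuous functions are Cauchy. -/
lemma MeasureTheory.ProbabilityMeasure.exists_tendsto_of_cauchySeq_integral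
    {E : Type*} [TopologicalSpace E] [T2Space E] [NormalSpace E] [MeasurableSpace E] [BorelSpace E]
    {K : Set E} (hK : IsCompact K) {μ : ℕ → ProbabilityMeasure E}
    (hμ : ∀ n, (μ n : Measure E) Kᶜ = 0)
    (h : ∀ f : BoundedContinuousFunction E ℝ, CauchySeq fun n => ∫ x, f x ∂(μ n : Measure E)) :
    ∃ σ : ProbabilityMeasure E, Tendsto μ atTop (nhds σ) := by
  have hc := isCompact_setOfPred_probabilityMeasure_mass_eq_compl_isCompact_le (E := E)
    (u := fun _ => 0) (K := fun _ => K) tendsto_const_nhds (fun _ => hK) (Or.inl inferInstance)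
  obtain ⟨σ, -, hσ⟩ := hc.exists_mapClusterPt (f := atTop) (u := μ)
    (tendsto_principal.2 (Eventually.of_forall fun n _ =>
      ((ProbabilityMeasure.null_iff_toMeasure_null _ _).2 (hμ n)).le))
  refine ⟨σ, ProbabilityMeasure.tendsto_iff_forall_integral_tendsto.2 fun f => ?_⟩
  exact le_nhds_of_cauchy_adhp (h f) (hσ.continuousAt_comp
    (ProbabilityMeasure.continuous_integral_boundedContinuousFunction f).continuousAt)

lemma MeasureTheory.Measure.mutuallySingular_of_forall_exists_measure_le {α : Type*}
    [MeasurableSpace α] {μ ν : Measure α} [SigmaFinite μ] [SigmaFinite ν]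
    (h : ∀ ε : ℝ, 0 < ε → ∃ s, μ sᶜ ≤ ENNReal.ofReal ε ∧ ν s ≤ ENNReal.ofReal ε) : μ ⟂ₘ ν := by
  refine Measure.mutuallySingular_of_disjoint fun ρ hρμ hρν => ?_
  change ρ ≤ 0
  rw [Measure.nonpos_iff_eq_zero', ← Measure.measure_univ_eq_zero, ← nonpos_iff_eq_zero]
  refine ENNReal.le_of_forall_pos_le_add fun ε hε _ => ?_
  obtain ⟨s, hμs, hνs⟩ := h (ε / 2) (by positivity)
  calc ρ Set.univ = ρ (s ∪ sᶜ) := by rw [Set.union_compl_self]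
    _ ≤ ρ s + ρ sᶜ := measure_union_le _ _
    _ ≤ ENNReal.ofReal (ε / 2) + ENNReal.ofReal (ε / 2) :=
      add_le_add ((hρν s).trans hνs) ((hρμ sᶜ).trans hμs)
    _ = 0 + ε := by rw [← ENNReal.ofReal_add (by positivity) (by positivity), add_halves,
        ENNReal.ofReal_coe_nnreal, zero_add]

lemma measure_le_of_integral_sq_le {α : Type*} [MeasurableSpace α] {μ : Measure α}
    [IsFiniteMeasure μ] {g : α → ℝ} (hg : Integrable (fun x => g x ^ 2) μ) {A : ℝ} (hA : 0 < A)
    (h : ∫ x, g x ^ 2 ∂μ ≤ 4 * A) {s : Set α} (hs : ∀ x ∈ s, A / 4 ≤ |g x|) :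
    μ s ≤ ENNReal.ofReal (64 / A) := by
  have hsub : s ⊆ {x | (A / 4) ^ 2 ≤ g x ^ 2} := fun x hx => by
    rw [Set.mem_ofPred_eq, ← sq_abs (g x)]
    exact pow_le_pow_left₀ (by positivity) (hs x hx) 2
  refine (measure_mono hsub).trans ?_
  rw [← ofReal_measureReal]
  refine ENNReal.ofReal_le_ofReal ?_
  have hc := (mul_meas_ge_le_integral_of_nonneg (Eventually.of_forall fun x => sq_nonneg (g x))
    hg ((A / 4) ^ 2)).trans h
  rw [le_div_iff₀ hA]
  refine le_of_mul_le_mul_left ?_ hA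
  linarith

/-- Riesz products: let `ω` be positive integers with `ω_{n+1}/ω_n ≥ q` for some `q > 3`,
let `a_n ∈ (0,1]` with `Σ a_n² = ∞`, and `φ_n ∈ ℝ`.  Then the probability measures
`ρ_N(x)dx` on `[0,1]`, where `ρ_N(x) = Π_{n<N} (1 + a_n cos(2π ω_n x + φ_n))`, converge
weakly (i.e. against every bounded continuous function) to a probability measure `σ`
that is mutually singular with Lebesgue measure on `[0,1]`. -/
theorem stmt_12 (ω : ℕ → ℕ) (hωpos : ∀ n, 0 < ω n)
    (q : ℝ) (hq : 3 < q) (hqrat : ∀ n, q * (ω n : ℝ) ≤ (ω (n + 1) : ℝ))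
    (a : ℕ → ℝ) (ha : ∀ n, a n ∈ Set.Ioc (0:ℝ) 1)
    (hdiv : ¬ Summable (fun n => a n ^ 2))
    (φ : ℕ → ℝ) :
    ∃ σ : Measure ℝ, IsProbabilityMeasure σ ∧
      (∀ f : BoundedContinuousFunction ℝ ℝ,
        Tendsto (fun N : ℕ => ∫ x in Set.Icc (0:ℝ) 1,
            (∏ n ∈ Finset.range N,
              (1 + a n * Real.cos (2 * Real.pi * (ω n : ℝ) * x + φ n))) * f x)
          atTop (nhds (∫ x, f x ∂σ))) ∧
      σ ⟂ₘ (MeasureTheory.volume.restrict (Set.Icc (0:ℝ) 1)) := by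
  have h3 : ∀ n, 3 * ω n ≤ ω (n + 1) := fun n => by
    have h : (3:ℝ) * ω n ≤ ω (n + 1) :=
      (mul_le_mul_of_nonneg_right hq.le (Nat.cast_nonneg _)).trans (hqrat n)
    exact_mod_cast h
  have ha0 : ∀ n, 0 ≤ a n := fun n => (ha n).1.le
  have ha1 : ∀ n, a n ≤ 1 := fun n => (ha n).2
  have hIcc (g : ℝ → ℝ) : ∫ x in Set.Icc (0:ℝ) 1, g x = ∫ x in (0:ℝ)..1, g x := by
    rw [integral_Icc_eq_integral_Ioc, intervalIntegral.integral_of_le zero_le_one]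
  let m : ℕ → Measure ℝ := fun N => (volume.restrict (Set.Icc (0:ℝ) 1)).withDensity
    fun x => ENNReal.ofReal (rieszProduct ω a φ N x)
  have hm (N : ℕ) : IsProbabilityMeasure (m N) := by
    refine ⟨?_⟩
    rw [withDensity_apply _ MeasurableSet.univ, Measure.restrict_univ,
      ← ofReal_integral_eq_lintegral_ofReal
        ((continuous_rieszProduct N).continuousOn.integrableOn_Icc)
        (Eventually.of_forall fun x => rieszProduct_nonneg ha0 ha1 N x), hIcc,
      integral_rieszProduct hωpos h3 ha0 ha1, ENNReal.ofReal_one]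
  have hint (N : ℕ) (g : ℝ → ℝ) :
      ∫ x, g x ∂(m N) = ∫ x in (0:ℝ)..1, rieszProduct ω a φ N x * g x := by
    rw [← hIcc, integral_withDensity_eq_integral_toReal_smul (by fun_prop)
      (Eventually.of_forall fun _ => ENNReal.ofReal_lt_top)]
    simp only [ENNReal.toReal_ofReal (rieszProduct_nonneg ha0 ha1 N _), smul_eq_mul]
  obtain ⟨σ, hσ⟩ := ProbabilityMeasure.exists_tendsto_of_cauchySeq_integral
    (isCompact_Icc (a := (0:ℝ)) (b := 1)) (μ := fun N => ⟨m N, hm N⟩)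
    (fun N => withDensity_absolutelyContinuous _ _ (by simp))
    (fun f => by
      simpa only [ProbabilityMeasure.coe_mk, hint] using!
        cauchySeq_integral_rieszProduct_mul hωpos h3 ha0 ha1 f.continuous)
  have hlim := ProbabilityMeasure.tendsto_iff_forall_integral_tendsto.1 hσ
  simp only [ProbabilityMeasure.coe_mk, hint] at hlim
  refine ⟨σ, inferInstance, fun f => ?_, ?_⟩
  · simpa only [hIcc] using! hlim f
  refine Measure.mutuallySingular_of_forall_exists_measure_le fun ε hε => ?_
  obtain ⟨M, hM⟩ : ∃ M, 64 / ε < ∑ n ∈ Finset.range M, a n ^ 2 :=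
    (((not_summable_iff_tendsto_nat_atTop_of_nonneg fun n => sq_nonneg (a n)).1
      hdiv).eventually_gt_atTop _).exists
  obtain ⟨A, hA⟩ : ∃ A, A = ∑ n ∈ Finset.range M, a n ^ 2 := ⟨_, rfl⟩
  rw [← hA] at hM
  have hA0 : 0 < A := lt_trans (by positivity) hM
  have hAε : ENNReal.ofReal (64 / A) ≤ ENNReal.ofReal ε := by
    refine ENNReal.ofReal_le_ofReal ?_
    rw [div_le_iff₀ hA0]
    rw [div_lt_iff₀ hε] at hM
    linarith
  let S : ℝ → ℝ := fun x =>
    ∑ n ∈ Finset.range M, a n * Real.cos (2 * Real.pi * (ω n : ℝ) * x + φ n)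
  have hSc : Continuous S := by fun_prop
  have hSb (x : ℝ) : |S x| ≤ M := by
    refine (Finset.abs_sum_le_sum_abs _ _).trans ?_
    calc _ ≤ ∑ n ∈ Finset.range M, (1:ℝ) := Finset.sum_le_sum fun n _ => by
          rw [abs_mul, abs_of_nonneg (ha0 n)]
          exact mul_le_one₀ (ha1 n) (abs_nonneg _) (Real.abs_cos_le_one _)
      _ = M := by simp
  let F : BoundedContinuousFunction ℝ ℝ := BoundedContinuousFunction.ofNormedAddCommGroup
    (fun x => (S x - A / 2) ^ 2) (by fun_prop) ((M + A / 2) ^ 2) fun x => by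
      rw [Real.norm_eq_abs, abs_pow]
      refine pow_le_pow_left₀ (abs_nonneg _) ((abs_sub _ _).trans ?_) 2
      rw [abs_of_pos (half_pos hA0)]
      linarith [hSb x]
  have hσF : ∫ x, (S x - A / 2) ^ 2 ∂(σ : Measure ℝ) ≤ 4 * A := by
    refine le_of_tendsto (hlim F) ?_
    filter_upwards [eventually_ge_atTop M] with N hN
    rw [hA]
    refine le_of_eq_of_le (intervalIntegral.integral_congr fun x _ => ?_)
      (integral_rieszProduct_mul_sum_sq_le (φ := φ) hωpos h3 ha0 ha1 a hN)
    change _ * (S x - A / 2) ^ 2 = _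
    simp only [S, hA, mul_sub, Finset.sum_sub_distrib, Finset.sum_div]
    congr 3
    exact Finset.sum_congr rfl fun n _ => by ring
  have hLeb : ∫ x in Set.Icc (0:ℝ) 1, S x ^ 2 ≤ 4 * A := by
    have h := integral_rieszProduct_mul_sum_sq_le (φ := φ) (a := fun _ => 0) hωpos h3
      (fun _ => le_rfl) (fun _ => zero_le_one) a (le_refl M)
    rw [hIcc, hA]
    simpa [rieszProduct] using! h
  refine ⟨{x | A / 4 < S x}, ?_, ?_⟩
  · refine (measure_le_of_integral_sq_le (F.integrable _) hA0 hσF fun x hx => ?_).trans hAε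
    simp only [Set.mem_compl_iff, Set.mem_ofPred_eq, not_lt] at hx
    rw [le_abs]
    right
    linarith
  · refine (measure_le_of_integral_sq_le
      ((hSc.pow 2).continuousOn.integrableOn_Icc) hA0 hLeb fun x hx => ?_).trans hAε
    exact (le_of_lt hx).trans (le_abs_self _)
end

section
/- There exist a probability Borel measure σ on [0,1) that is mutually singular with Lebesgue measure and a constant c > 0 such that σ̂(n) = O(|n|^{-c}) as |n| → ∞. -/
open MeasureTheory Filter Asymptotics

open scoped Pointwise

/-- Reads the base `4` digits of the fractional part of a number in base `10`. -/
noncomputable def quaternaryToDecimal (x : ℝ) : ℝ :=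
  ∑' k : ℕ, ((⌊4 ^ (k + 1) * x⌋ % 4 : ℤ) : ℝ) / 10 ^ (k + 1)

lemma quaternaryDigit_nonneg (x : ℝ) (k : ℕ) :
    0 ≤ ((⌊4 ^ (k + 1) * x⌋ % 4 : ℤ) : ℝ) / 10 ^ (k + 1) := by
  have : (0 : ℤ) ≤ ⌊4 ^ (k + 1) * x⌋ % 4 := Int.emod_nonneg _ (by norm_num)
  have : (0 : ℝ) ≤ ((⌊4 ^ (k + 1) * x⌋ % 4 : ℤ) : ℝ) := by exact_mod_cast this
  positivity

lemma quaternaryDigit_le (x : ℝ) (k : ℕ) :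
    ((⌊4 ^ (k + 1) * x⌋ % 4 : ℤ) : ℝ) / 10 ^ (k + 1) ≤ 3 / 10 * (1 / 10) ^ k := by
  have : ⌊4 ^ (k + 1) * x⌋ % 4 ≤ (3 : ℤ) := by omega
  have h : ((⌊4 ^ (k + 1) * x⌋ % 4 : ℤ) : ℝ) ≤ 3 := by exact_mod_cast this
  calc _ ≤ (3 : ℝ) / 10 ^ (k + 1) := by gcongr
    _ = _ := by rw [pow_succ, one_div, inv_pow]; field_simp

lemma hasSum_quaternaryToDecimal_bound :
    HasSum (fun k : ℕ => (3 / 10 : ℝ) * (1 / 10) ^ k) (1 / 3) := by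
  have := (hasSum_geometric_of_lt_one (r := (1 / 10 : ℝ)) (by norm_num) (by norm_num)).mul_left
    (3 / 10 : ℝ)
  rwa [show (3 / 10 : ℝ) * (1 - 1 / 10)⁻¹ = 1 / 3 by norm_num] at this

lemma summable_quaternaryToDecimal (x : ℝ) :
    Summable fun k : ℕ => ((⌊4 ^ (k + 1) * x⌋ % 4 : ℤ) : ℝ) / 10 ^ (k + 1) :=
  Summable.of_nonneg_of_le (quaternaryDigit_nonneg x) (quaternaryDigit_le x)
    hasSum_quaternaryToDecimal_bound.summable

lemma quaternaryToDecimal_nonneg (x : ℝ) : 0 ≤ quaternaryToDecimal x :=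
  tsum_nonneg (quaternaryDigit_nonneg x)

lemma quaternaryToDecimal_le (x : ℝ) : quaternaryToDecimal x ≤ 1 / 3 := by
  rw [← hasSum_quaternaryToDecimal_bound.tsum_eq]
  exact (summable_quaternaryToDecimal x).tsum_le_tsum (quaternaryDigit_le x)
    hasSum_quaternaryToDecimal_bound.summable

lemma measurable_quaternaryToDecimal : Measurable quaternaryToDecimal := by
  refine measurable_of_tendsto_metrizable
    (f := fun n x => ∑ k ∈ Finset.range n, ((⌊4 ^ (k + 1) * x⌋ % 4 : ℤ) : ℝ) / 10 ^ (k + 1))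
    (fun n => ?_) ?_
  · refine Finset.measurable_fun_sum _ fun k _ => ?_
    have h : Measurable fun z : ℤ => ((z % 4 : ℤ) : ℝ) / 10 ^ (k + 1) := measurable_from_top
    exact h.comp (Int.measurable_floor.comp (measurable_const_mul _))
  · rw [tendsto_pi_nhds]
    exact fun x => (summable_quaternaryToDecimal x).hasSum.tendsto_sum_nat

lemma quaternaryToDecimal_eq {x : ℝ} (hx : x ∈ Set.Ico (0 : ℝ) 1) :
    quaternaryToDecimal x = (⌊4 * x⌋ + quaternaryToDecimal (Int.fract (4 * x))) / 10 := by
  have h0 : ⌊4 * x⌋ % 4 = ⌊4 * x⌋ := by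
    apply Int.emod_eq_of_lt
    · exact Int.floor_nonneg.2 (by linarith [hx.1])
    · exact Int.floor_lt.2 (by push_cast; linarith [hx.2])
  have hd (k : ℕ) : ⌊4 ^ (k + 2) * x⌋ % 4 = ⌊4 ^ (k + 1) * Int.fract (4 * x)⌋ % 4 := by
    have : (4 : ℝ) ^ (k + 1) * Int.fract (4 * x)
        = 4 ^ (k + 2) * x - ((4 ^ (k + 1) * ⌊4 * x⌋ : ℤ) : ℝ) := by
      rw [← Int.self_sub_floor]; push_cast; ring
    rw [this, Int.floor_sub_intCast, pow_succ (4 : ℤ), mul_right_comm, Int.sub_mul_emod_self_right]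
  unfold quaternaryToDecimal
  rw [(summable_quaternaryToDecimal x).tsum_eq_zero_add, add_div, ← tsum_div_const]
  congr 1
  · simp [h0]
  · refine tsum_congr fun k => ?_
    rw [hd, pow_succ (10 : ℝ) (k + 1), div_div]

lemma abs_sub_le_quaternaryToDecimal_add (n : ℕ) {x y : ℝ} (hx : x ∈ Set.Ico (0 : ℝ) 1)
    (hy : y ∈ Set.Ico (0 : ℝ) 1) :
    |x - y| ≤ 15 * |quaternaryToDecimal x - quaternaryToDecimal y| ^ (3 / 5 : ℝ)
      + (1 / 4) ^ n := by
  induction n generalizing x y with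
  | zero =>
    have : |x - y| ≤ 1 := abs_le.2 ⟨by linarith [hx.1, hy.2], by linarith [hx.2, hy.1]⟩
    have h : 0 ≤ |quaternaryToDecimal x - quaternaryToDecimal y| ^ (3 / 5 : ℝ) := by positivity
    simp; linarith
  | succ n ih =>
    have hex := quaternaryToDecimal_eq hx
    have hey := quaternaryToDecimal_eq hy
    have hx' : Int.fract (4 * x) ∈ Set.Ico (0 : ℝ) 1 := ⟨Int.fract_nonneg _, Int.fract_lt_one _⟩
    have hy' : Int.fract (4 * y) ∈ Set.Ico (0 : ℝ) 1 := ⟨Int.fract_nonneg _, Int.fract_lt_one _⟩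
    by_cases h : ⌊4 * x⌋ = ⌊4 * y⌋
    · have key := ih hx' hy'
      have e1 : Int.fract (4 * x) - Int.fract (4 * y) = 4 * (x - y) := by
        rw [← Int.self_sub_floor, ← Int.self_sub_floor, h]; ring
      have e2 : quaternaryToDecimal (Int.fract (4 * x)) - quaternaryToDecimal (Int.fract (4 * y))
          = 10 * (quaternaryToDecimal x - quaternaryToDecimal y) := by
        rw [hex, hey, h]; ring
      rw [e1, e2, abs_mul, abs_mul, Real.mul_rpow (by positivity) (by positivity)] at key
      have h10 : |(10 : ℝ)| ^ (3 / 5 : ℝ) ≤ 4 := by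
        rw [abs_of_pos (by norm_num), ← Real.rpow_le_rpow_iff (z := 5) (by positivity)
          (by norm_num) (by norm_num), ← Real.rpow_mul (by norm_num)]
        norm_num
      have hp : 0 ≤ |quaternaryToDecimal x - quaternaryToDecimal y| ^ (3 / 5 : ℝ) := by positivity
      have := mul_le_mul_of_nonneg_right h10 hp
      rw [abs_of_pos (by norm_num : (0 : ℝ) < 4)] at key
      rw [pow_succ]
      linarith
    · have : |x - y| ≤ 1 := abs_le.2 ⟨by linarith [hx.1, hy.2], by linarith [hx.2, hy.1]⟩
      have hd : 1 / 15 ≤ |quaternaryToDecimal x - quaternaryToDecimal y| := by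
        have hfl : (1 : ℝ) ≤ |(⌊4 * x⌋ : ℝ) - ⌊4 * y⌋| := by
          exact_mod_cast Int.one_le_abs (sub_ne_zero.2 h)
        have a1 := quaternaryToDecimal_nonneg (Int.fract (4 * x))
        have a2 := quaternaryToDecimal_nonneg (Int.fract (4 * y))
        have a3 := quaternaryToDecimal_le (Int.fract (4 * x))
        have a4 := quaternaryToDecimal_le (Int.fract (4 * y))
        rw [le_abs] at hfl ⊢
        rw [hex, hey]
        rcases hfl with hfl | hfl
        · left; linarith
        · right; linarith
      have h1 : 1 / 15 ≤ |quaternaryToDecimal x - quaternaryToDecimal y| ^ (3 / 5 : ℝ) :=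
        calc (1 / 15 : ℝ) ≤ (1 / 15 : ℝ) ^ (3 / 5 : ℝ) :=
            Real.self_le_rpow_of_le_one (by norm_num) (by norm_num) (by norm_num)
          _ ≤ _ := by gcongr
      have : (0 : ℝ) ≤ (1 / 4) ^ (n + 1) := by positivity
      linarith

/-- `quaternaryToDecimal` has a Hölder continuous inverse. -/
lemma abs_sub_le_quaternaryToDecimal {x y : ℝ} (hx : x ∈ Set.Ico (0 : ℝ) 1)
    (hy : y ∈ Set.Ico (0 : ℝ) 1) :
    |x - y| ≤ 15 * |quaternaryToDecimal x - quaternaryToDecimal y| ^ (3 / 5 : ℝ) := by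
  have h := (tendsto_pow_atTop_nhds_zero_of_lt_one (r := (1 / 4 : ℝ)) (by norm_num)
    (by norm_num)).const_add (15 * |quaternaryToDecimal x - quaternaryToDecimal y| ^ (3 / 5 : ℝ))
  rw [add_zero] at h
  exact ge_of_tendsto' h fun n => abs_sub_le_quaternaryToDecimal_add n hx hy

lemma volume_image_quaternaryToDecimal_add :
    volume ((fun p : ℝ × ℝ => quaternaryToDecimal p.1 + quaternaryToDecimal p.2) ''
      (Set.Ico 0 1 ×ˢ Set.Ico 0 1)) = 0 := by
  set S := (fun p : ℝ × ℝ => quaternaryToDecimal p.1 + quaternaryToDecimal p.2) ''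
      (Set.Ico 0 1 ×ˢ Set.Ico 0 1)
  have hfin : volume S ≠ ⊤ := by
    refine ne_top_of_le_ne_top (b := volume (Set.Icc (0 : ℝ) 1)) (by simp) (measure_mono ?_)
    rintro _ ⟨p, -, rfl⟩
    have h1 := quaternaryToDecimal_nonneg p.1
    have h2 := quaternaryToDecimal_nonneg p.2
    have h3 := quaternaryToDecimal_le p.1
    have h4 := quaternaryToDecimal_le p.2
    constructor <;> dsimp only <;> linarith
  have hsub : S ⊆ ⋃ d ∈ Finset.range 7, (fun s : ℝ => (d : ℝ) / 10 + s) '' ((1 / 10 : ℝ) • S) := by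
    rintro _ ⟨⟨x, y⟩, ⟨hx, hy⟩, rfl⟩
    have hfl {z : ℝ} (hz : z ∈ Set.Ico (0 : ℝ) 1) : 0 ≤ ⌊4 * z⌋ ∧ ⌊4 * z⌋ < 4 :=
      ⟨Int.floor_nonneg.2 (by linarith [hz.1]), Int.floor_lt.2 (by push_cast; linarith [hz.2])⟩
    obtain ⟨a, ha⟩ := Int.eq_ofNat_of_zero_le (hfl hx).1
    obtain ⟨b, hb⟩ := Int.eq_ofNat_of_zero_le (hfl hy).1
    have ha4 := (hfl hx).2
    have hb4 := (hfl hy).2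
    simp only [Set.mem_iUnion]
    refine ⟨a + b, Finset.mem_range.2 (by omega), _, Set.smul_mem_smul_set
      (Set.mem_image_of_mem _ (Set.mk_mem_prod
        (⟨Int.fract_nonneg (4 * x), Int.fract_lt_one _⟩)
        (⟨Int.fract_nonneg (4 * y), Int.fract_lt_one _⟩))), ?_⟩
    dsimp only
    rw [quaternaryToDecimal_eq hx, quaternaryToDecimal_eq hy, ha, hb, smul_eq_mul]
    push_cast
    ring
  have hle : volume S ≤ ENNReal.ofReal (7 / 10) * volume S :=
    calc volume S ≤ ∑ d ∈ Finset.range 7,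
          volume ((fun s : ℝ => (d : ℝ) / 10 + s) '' ((1 / 10 : ℝ) • S)) :=
        (measure_mono hsub).trans (measure_biUnion_finset_le _ _)
      _ = 7 * (ENNReal.ofReal (1 / 10) * volume S) := by
        simp only [Set.image_add_left, measure_preimage_add, Measure.addHaar_smul]
        simp
      _ = _ := by
        rw [← mul_assoc, show (7 / 10 : ℝ) = 7 * (1 / 10) by norm_num,
          ENNReal.ofReal_mul (by norm_num)]
        simp
  by_contra h0
  refine hle.not_gt ?_
  calc _ < 1 * volume S := by
        rw [ENNReal.mul_lt_mul_iff_left h0 hfin, ENNReal.ofReal_lt_one]; norm_num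
    _ = _ := one_mul _

lemma norm_setIntegral_cexp_le {s : ℝ} (hs : s ≠ 0) :
    ‖∫ t in Set.Ioc (-1 : ℝ) 2, Complex.exp ((s * t : ℝ) * Complex.I)‖
      ≤ 3 * |s| ^ (-(1 / 2) : ℝ) := by
  set z := ‖∫ t in Set.Ioc (-1 : ℝ) 2, Complex.exp ((s * t : ℝ) * Complex.I)‖ with hz
  have hs' : 0 < |s| := abs_pos.2 hs
  have h1 : z ≤ 3 := by
    have := norm_setIntegral_le_of_norm_le_const (μ := volume) (s := Set.Ioc (-1 : ℝ) 2) (C := 1)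
      (f := fun t : ℝ => Complex.exp ((s * t : ℝ) * Complex.I)) (by simp)
      (fun t _ => (Complex.norm_exp_ofReal_mul_I _).le)
    refine this.trans ?_
    norm_num
  have h2 : z ≤ 2 / |s| := by
    have hc : (s : ℂ) * Complex.I ≠ 0 := by simp [hs]
    have := integral_exp_mul_complex (a := -1) (b := 2) hc
    rw [intervalIntegral.integral_of_le (by norm_num)] at this
    have e : ∀ t : ℝ, ((s * t : ℝ) : ℂ) * Complex.I = s * Complex.I * t := by
      intro t; push_cast; ring
    rw [hz]
    simp_rw [e]
    rw [this, norm_div, norm_mul, Complex.norm_I, mul_one, Complex.norm_real, Real.norm_eq_abs]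
    gcongr
    refine (norm_sub_le _ _).trans ?_
    rw [← e, ← e, Complex.norm_exp_ofReal_mul_I, Complex.norm_exp_ofReal_mul_I]
    norm_num
  have h0 : 0 ≤ z := norm_nonneg _
  refine (sq_le_sq₀ h0 (by positivity)).1 ?_
  have : (|s| ^ (-(1 / 2) : ℝ)) ^ 2 = 1 / |s| := by
    rw [← Real.rpow_natCast, ← Real.rpow_mul hs'.le]
    norm_num [Real.rpow_neg_one]
  rw [mul_pow, this, sq]
  calc z * z ≤ 3 * (2 / |s|) := by gcongr
    _ ≤ _ := by
      have : 0 < 1 / |s| := by positivity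
      rw [show 3 * (2 / |s|) = 6 * (1 / |s|) by ring]
      linarith

lemma volume_setOf_abs_sub_le {ψ : ℝ → ℝ} {A : Set ℝ} {K : ℝ} (hK : 0 ≤ K)
    (hψ : ∀ x ∈ A, ∀ y ∈ A, |x - y| ≤ K * |ψ x - ψ y| ^ (3 / 5 : ℝ)) (t : ℝ) (δ : ℝ) :
    volume {x ∈ A | |ψ x - t| ≤ δ} ≤ ENNReal.ofReal (K * (2 * δ) ^ (3 / 5 : ℝ)) := by
  refine (Real.volume_le_diam _).trans (Metric.ediam_le fun x hx y hy => ?_)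
  rw [edist_dist, Real.dist_eq]
  refine ENNReal.ofReal_le_ofReal ((hψ x hx.1 y hy.1).trans ?_)
  gcongr
  have := abs_sub_le (ψ x) t (ψ y)
  rw [abs_sub_comm t] at this
  linarith [hx.2, hy.2]

lemma integrable_indicator_abs_rpow :
    Integrable ((Metric.ball (0 : ℝ) 2).indicator fun u => |u| ^ (-(5 / 6) : ℝ)) := by
  rw [integrable_indicator_iff Metric.isOpen_ball.measurableSet]
  refine integrableOn_ball_of_norm_le_rpow (C := 1) (α := 5 / 6) (by simp)
    (by simp; norm_num) (Eventually.of_forall fun u => ?_)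
    (by fun_prop : Measurable _).aestronglyMeasurable
  rw [one_mul, Real.norm_eq_abs, Real.norm_eq_abs, abs_of_nonneg (by positivity)]

/-- The function `t ↦ ∫ e^{iξψ(x)t} dx`, the integral being over `[0,1)`. -/
noncomputable def phaseIntegral (ψ : ℝ → ℝ) (ξ t : ℝ) : ℂ :=
  ∫ x in Set.Ico (0 : ℝ) 1, Complex.exp ((ξ * ψ x * t : ℝ) * Complex.I)

lemma integrable_cexp {α : Type*} [MeasurableSpace α] (μ : Measure α) [IsFiniteMeasure μ]
    {f : α → ℝ} (hf : Measurable f) :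
    Integrable (fun x => Complex.exp ((f x : ℝ) * Complex.I)) μ :=
  Integrable.of_bound (by fun_prop : Measurable _).aestronglyMeasurable 1
    (Eventually.of_forall fun _ => (Complex.norm_exp_ofReal_mul_I _).le)

lemma norm_phaseIntegral_le (ψ : ℝ → ℝ) (ξ t : ℝ) : ‖phaseIntegral ψ ξ t‖ ≤ 1 := by
  have := norm_setIntegral_le_of_norm_le_const (μ := volume) (s := Set.Ico (0 : ℝ) 1) (C := 1)
      (f := fun x : ℝ => Complex.exp ((ξ * ψ x * t : ℝ) * Complex.I)) (by simp)
      (fun t _ => (Complex.norm_exp_ofReal_mul_I _).le)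
  simpa [phaseIntegral] using this

lemma norm_cexp_sub_cexp_le (a b : ℝ) :
    ‖Complex.exp (a * Complex.I) - Complex.exp (b * Complex.I)‖ ≤ |a - b| := by
  have h : Complex.exp (a * Complex.I) - Complex.exp (b * Complex.I)
      = Complex.exp (b * Complex.I) * (Complex.exp (Complex.I * (a - b : ℝ)) - 1) := by
    rw [mul_sub, ← Complex.exp_add, mul_one]
    congr 2
    push_cast
    ring
  rw [h, norm_mul, Complex.norm_exp_ofReal_mul_I, one_mul]
  exact Real.norm_exp_I_mul_ofReal_sub_one_le

lemma norm_phaseIntegral_sub_le {ψ : ℝ → ℝ} (hm : Measurable ψ) (h1 : ∀ x, |ψ x| ≤ 1)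
    (ξ s t : ℝ) : ‖phaseIntegral ψ ξ s - phaseIntegral ψ ξ t‖ ≤ |ξ| * |s - t| := by
  unfold phaseIntegral
  rw [← integral_sub (integrable_cexp _ (by fun_prop)) (integrable_cexp _ (by fun_prop))]
  have := norm_setIntegral_le_of_norm_le_const (μ := volume) (s := Set.Ico (0 : ℝ) 1)
    (C := |ξ| * |s - t|)
    (f := fun x : ℝ => Complex.exp ((ξ * ψ x * s : ℝ) * Complex.I)
      - Complex.exp ((ξ * ψ x * t : ℝ) * Complex.I)) (by simp)
    (fun x _ => by
      refine (norm_cexp_sub_cexp_le _ _).trans ?_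
      rw [show ξ * ψ x * s - ξ * ψ x * t = ψ x * (ξ * (s - t)) by ring, abs_mul, abs_mul]
      exact mul_le_of_le_one_left (by positivity) (h1 x))
  simpa using this

lemma abs_norm_sq_phaseIntegral_sub_le {ψ : ℝ → ℝ} (hm : Measurable ψ) (h1 : ∀ x, |ψ x| ≤ 1)
    (ξ s t : ℝ) :
    |‖phaseIntegral ψ ξ s‖ ^ 2 - ‖phaseIntegral ψ ξ t‖ ^ 2| ≤ 2 * |ξ| * |s - t| := by
  rw [sq_sub_sq, abs_mul, mul_assoc]
  have hs := norm_phaseIntegral_le ψ ξ s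
  have ht := norm_phaseIntegral_le ψ ξ t
  refine mul_le_mul ?_ ((abs_norm_sub_norm_le _ _).trans (norm_phaseIntegral_sub_le hm h1 ξ s t))
    (abs_nonneg _) (by norm_num)
  rw [abs_of_nonneg (by positivity)]
  linarith

lemma setIntegral_norm_sq_phaseIntegral {ψ : ℝ → ℝ} (hm : Measurable ψ) (ξ : ℝ) :
    ((∫ t in Set.Ioc (-1 : ℝ) 2, ‖phaseIntegral ψ ξ t‖ ^ 2 : ℝ) : ℂ)
      = ∫ x in Set.Ico (0 : ℝ) 1, ∫ y in Set.Ico (0 : ℝ) 1, ∫ t in Set.Ioc (-1 : ℝ) 2,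
          Complex.exp ((ξ * (ψ y - ψ x) * t : ℝ) * Complex.I) := by
  have key (t : ℝ) : ((‖phaseIntegral ψ ξ t‖ ^ 2 : ℝ) : ℂ)
      = ∫ x in Set.Ico (0 : ℝ) 1, ∫ y in Set.Ico (0 : ℝ) 1,
          Complex.exp ((ξ * (ψ y - ψ x) * t : ℝ) * Complex.I) := by
    push_cast
    rw [← Complex.conj_mul']
    nth_rw 1 [phaseIntegral]
    rw [← integral_conj, ← integral_mul_const]
    congr 1
    ext x
    rw [phaseIntegral, ← integral_const_mul]
    congr 1
    ext y
    rw [← Complex.exp_conj, ← Complex.exp_add]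
    congr 1
    simp only [map_mul, Complex.conj_ofReal, Complex.conj_I]
    push_cast
    ring
  rw [← integral_complex_ofReal]
  simp_rw [key]
  rw [integral_integral_swap]
  · congr 1
    ext x
    rw [integral_integral_swap]
    exact integrable_cexp _ (f := fun p : ℝ × ℝ => ξ * (ψ p.2 - ψ x) * p.1) (by fun_prop)
  · refine Integrable.of_bound (C := 1) ?_ (Eventually.of_forall fun p => ?_)
    · refine StronglyMeasurable.aestronglyMeasurable ?_
      refine StronglyMeasurable.integral_prod_right' (f := fun q : (ℝ × ℝ) × ℝ =>
        Complex.exp ((ξ * (ψ q.2 - ψ q.1.2) * q.1.1 : ℝ) * Complex.I)) ?_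
      exact Measurable.stronglyMeasurable (by fun_prop)
    · have := norm_setIntegral_le_of_norm_le_const (μ := volume) (s := Set.Ico (0 : ℝ) 1) (C := 1)
        (f := fun y : ℝ => Complex.exp ((ξ * (ψ y - ψ p.2) * p.1 : ℝ) * Complex.I)) (by simp)
        (fun t _ => (Complex.norm_exp_ofReal_mul_I _).le)
      simpa [Function.uncurry] using this

/-- `L²` bound for the phase integral of a function with Hölder continuous inverse. -/
lemma exists_setIntegral_norm_sq_phaseIntegral_le {ψ : ℝ → ℝ} (hm : Measurable ψ) {K : ℝ}
    (hK : 0 < K) (hψ : ∀ x ∈ Set.Ico (0 : ℝ) 1, ∀ y ∈ Set.Ico (0 : ℝ) 1,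
      |x - y| ≤ K * |ψ x - ψ y| ^ (3 / 5 : ℝ)) :
    ∃ C : ℝ, 0 ≤ C ∧ ∀ ξ : ℝ, ξ ≠ 0 →
      ∫ t in Set.Ioc (-1 : ℝ) 2, ‖phaseIntegral ψ ξ t‖ ^ 2 ≤ C * |ξ| ^ (-(1 / 2) : ℝ) := by
  set h : ℝ → ℝ := (Metric.ball (0 : ℝ) 2).indicator fun u => |u| ^ (-(5 / 6) : ℝ) with hh
  have hint : Integrable h := integrable_indicator_abs_rpow
  have h0 (u : ℝ) : 0 ≤ h u := Set.indicator_nonneg (fun u _ => by positivity) u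
  refine ⟨3 * K ^ (5 / 6 : ℝ) * ∫ u, h u,
    mul_nonneg (by positivity) (integral_nonneg h0), fun ξ hξ => ?_⟩
  have hξ' : 0 < |ξ| := abs_pos.2 hξ
  have hpt {x y : ℝ} (hx : x ∈ Set.Ico (0 : ℝ) 1) (hy : y ∈ Set.Ico (0 : ℝ) 1) (hxy : y ≠ x) :
      ‖∫ t in Set.Ioc (-1 : ℝ) 2, Complex.exp ((ξ * (ψ y - ψ x) * t : ℝ) * Complex.I)‖
        ≤ 3 * K ^ (5 / 6 : ℝ) * |ξ| ^ (-(1 / 2) : ℝ) * h (x - y) := by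
    have hpos : 0 < |x - y| := abs_pos.2 (sub_ne_zero.2 hxy.symm)
    have hu : 0 < |ψ y - ψ x| := by
      rw [abs_sub_comm]
      by_contra hcon
      have : |ψ x - ψ y| = 0 := le_antisymm (not_lt.1 hcon) (abs_nonneg _)
      have := hψ x hx y hy
      simp_all [Real.zero_rpow]
    have hball : x - y ∈ Metric.ball (0 : ℝ) 2 := by
      rw [mem_ball_zero_iff, Real.norm_eq_abs, abs_lt]
      constructor <;> linarith [hx.1, hx.2, hy.1, hy.2]
    refine (norm_setIntegral_cexp_le (mul_ne_zero hξ (abs_pos.1 hu))).trans ?_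
    rw [hh, Set.indicator_of_mem hball, abs_mul, Real.mul_rpow hξ'.le hu.le]
    have hmain : |ψ y - ψ x| ^ (-(1 / 2) : ℝ) ≤ K ^ (5 / 6 : ℝ) * |x - y| ^ (-(5 / 6) : ℝ) := by
      have h1 := hψ x hx y hy
      rw [abs_sub_comm (ψ x)] at h1
      have h2 : |x - y| ^ (5 / 6 : ℝ) ≤ K ^ (5 / 6 : ℝ) * |ψ y - ψ x| ^ (1 / 2 : ℝ) := by
        have := Real.rpow_le_rpow hpos.le h1 (by norm_num : (0 : ℝ) ≤ 5 / 6)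
        rwa [Real.mul_rpow hK.le (by positivity), ← Real.rpow_mul hu.le,
          show (3 / 5 * (5 / 6) : ℝ) = 1 / 2 by norm_num] at this
      rw [Real.rpow_neg hu.le, Real.rpow_neg hpos.le, ← div_eq_mul_inv, inv_eq_one_div,
        div_le_div_iff₀ (by positivity) (by positivity), one_mul]
      exact h2
    calc _ ≤ 3 * (|ξ| ^ (-(1 / 2) : ℝ) * (K ^ (5 / 6 : ℝ) * |x - y| ^ (-(5 / 6) : ℝ))) := by gcongr
      _ = _ := by ring
  have hin {x : ℝ} (hx : x ∈ Set.Ico (0 : ℝ) 1) :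
      ‖∫ y in Set.Ico (0 : ℝ) 1, ∫ t in Set.Ioc (-1 : ℝ) 2,
          Complex.exp ((ξ * (ψ y - ψ x) * t : ℝ) * Complex.I)‖
        ≤ 3 * K ^ (5 / 6 : ℝ) * |ξ| ^ (-(1 / 2) : ℝ) * ∫ u, h u := by
    have hintx : Integrable fun y => 3 * K ^ (5 / 6 : ℝ) * |ξ| ^ (-(1 / 2) : ℝ) * h (x - y) :=
      (hint.comp_sub_left x).const_mul _
    refine (norm_integral_le_of_norm_le hintx.integrableOn ?_).trans ?_
    · have hne : ∀ᵐ y ∂(volume.restrict (Set.Ico (0 : ℝ) 1)), y ≠ x :=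
        ae_restrict_of_ae (Measure.ae_ne volume x)
      filter_upwards [hne, ae_restrict_mem measurableSet_Ico] with y hyx hy using hpt hx hy hyx
    · refine (setIntegral_le_integral hintx (Eventually.of_forall fun y => ?_)).trans_eq ?_
      · exact mul_nonneg (by positivity) (h0 _)
      · rw [integral_const_mul, integral_sub_left_eq_self]
  have e := setIntegral_norm_sq_phaseIntegral hm ξ
  have hnn : 0 ≤ ∫ t in Set.Ioc (-1 : ℝ) 2, ‖phaseIntegral ψ ξ t‖ ^ 2 :=
    integral_nonneg fun t => by positivity
  rw [← abs_of_nonneg hnn, ← Real.norm_eq_abs, ← Complex.norm_real, e]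
  refine (norm_setIntegral_le_of_norm_le_const (by simp) fun x hx => hin hx).trans_eq ?_
  simp
  ring

/-- Averaging a Lipschitz function over small intervals. -/
lemma setIntegral_comp_le_of_lipschitz {ψ f : ℝ → ℝ} (hm : Measurable ψ)
    (hr : ∀ x, ψ x ∈ Set.Icc (0 : ℝ) 1) {K L δ : ℝ} (hK : 0 ≤ K)
    (hψ : ∀ x ∈ Set.Ico (0 : ℝ) 1, ∀ y ∈ Set.Ico (0 : ℝ) 1,
      |x - y| ≤ K * |ψ x - ψ y| ^ (3 / 5 : ℝ))
    (hf0 : ∀ t, 0 ≤ f t) (hf1 : ∀ t, f t ≤ 1) (hL : 0 ≤ L) (hf : ∀ s t, |f s - f t| ≤ L * |s - t|)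
    (hδ : 0 < δ) (hδ1 : δ ≤ 1) :
    ∫ x in Set.Ico (0 : ℝ) 1, f (ψ x)
      ≤ L * δ + (2 * δ)⁻¹ * (K * (2 * δ) ^ (3 / 5 : ℝ)) * ∫ t in Set.Ioc (-1 : ℝ) 2, f t := by
  have hfc : Continuous f :=
    (LipschitzWith.of_dist_le_mul (K := ⟨L, hL⟩) hf).continuous
  have hfm : Measurable f := hfc.measurable
  set D : Set (ℝ × ℝ) := {p | p.2 ∈ Set.Ioc (ψ p.1 - δ) (ψ p.1 + δ)}
  have hDm : MeasurableSet D :=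
    (measurableSet_lt (f := fun p : ℝ × ℝ => ψ p.1 - δ) (g := Prod.snd) (by fun_prop)
      (by fun_prop)).inter
      (measurableSet_le (f := Prod.snd) (g := fun p : ℝ × ℝ => ψ p.1 + δ) (by fun_prop)
        (by fun_prop))
  set G : ℝ → ℝ → ℝ := fun x t => D.indicator (fun p => f p.2) (x, t)
  have hGm : Measurable (Function.uncurry G) := (hfm.comp measurable_snd).indicator hDm
  have hGb (p : ℝ × ℝ) : ‖Function.uncurry G p‖ ≤ 1 := by
    change ‖D.indicator (fun p => f p.2) p‖ ≤ 1
    refine (norm_indicator_le_norm_self _ _).trans ?_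
    rw [Real.norm_eq_abs, abs_of_nonneg (hf0 _)]
    exact hf1 _
  have hGi : Integrable (Function.uncurry G)
      ((volume.restrict (Set.Ico (0 : ℝ) 1)).prod (volume.restrict (Set.Ioc (-1 : ℝ) 2))) :=
    Integrable.of_bound hGm.aestronglyMeasurable 1 (Eventually.of_forall hGb)
  have hinner (x : ℝ) : ∫ t in Set.Ioc (-1 : ℝ) 2, G x t
      = ∫ t in Set.Ioc (ψ x - δ) (ψ x + δ), f t := by
    have : G x = (Set.Ioc (ψ x - δ) (ψ x + δ)).indicator f := rfl
    rw [this, setIntegral_indicator measurableSet_Ioc, Set.inter_eq_right.2]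
    exact Set.Ioc_subset_Ioc (by linarith [(hr x).1]) (by linarith [(hr x).2])
  have hpt (x : ℝ) : f (ψ x) ≤ L * δ + (2 * δ)⁻¹ * ∫ t in Set.Ioc (-1 : ℝ) 2, G x t := by
    have hle : ∫ t in Set.Ioc (ψ x - δ) (ψ x + δ), (f (ψ x) - L * δ)
        ≤ ∫ t in Set.Ioc (ψ x - δ) (ψ x + δ), f t := by
      refine setIntegral_mono_on (by simp) (hfc.integrableOn_Ioc) measurableSet_Ioc fun t ht => ?_
      have h1 := (le_abs_self _).trans (hf (ψ x) t)
      have h2 : |ψ x - t| ≤ δ := abs_le.2 ⟨by linarith [ht.2], by linarith [ht.1]⟩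
      have h3 := mul_le_mul_of_nonneg_left h2 hL
      linarith
    rw [hinner]
    rw [setIntegral_const, Real.volume_real_Ioc_of_le (by linarith), smul_eq_mul,
      show ψ x + δ - (ψ x - δ) = 2 * δ by ring] at hle
    have := (le_inv_mul_iff₀ (by positivity : 0 < 2 * δ)).2 hle
    linarith
  have hswap : ∫ x in Set.Ico (0 : ℝ) 1, ∫ t in Set.Ioc (-1 : ℝ) 2, G x t
      ≤ K * (2 * δ) ^ (3 / 5 : ℝ) * ∫ t in Set.Ioc (-1 : ℝ) 2, f t := by
    rw [integral_integral_swap hGi, ← integral_const_mul]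
    refine setIntegral_mono hGi.integral_prod_right
      (hfc.integrableOn_Ioc.const_mul _) fun t => ?_
    have hset : MeasurableSet {x | (x, t) ∈ D} := hDm.preimage (by fun_prop)
    have hGt : (fun x => G x t) = {x | (x, t) ∈ D}.indicator fun _ => f t := rfl
    dsimp only
    rw [hGt, setIntegral_indicator hset, setIntegral_const, smul_eq_mul]
    refine mul_le_mul_of_nonneg_right ?_ (hf0 t)
    refine ENNReal.toReal_le_of_le_ofReal (by positivity)
      ((measure_mono ?_).trans (volume_setOf_abs_sub_le hK hψ t δ))
    rintro x ⟨hx, hxD⟩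
    exact ⟨hx, abs_le.2 ⟨by linarith [hxD.2], by linarith [hxD.1]⟩⟩
  have hcst : ∫ x in Set.Ico (0 : ℝ) 1, L * δ = L * δ := by simp
  calc ∫ x in Set.Ico (0 : ℝ) 1, f (ψ x)
      ≤ ∫ x in Set.Ico (0 : ℝ) 1, (L * δ + (2 * δ)⁻¹ * ∫ t in Set.Ioc (-1 : ℝ) 2, G x t) := by
        refine setIntegral_mono (Integrable.of_bound (C := 1)
          (hfm.comp hm).aestronglyMeasurable (Eventually.of_forall fun x => ?_))
          ((integrable_const _).add (hGi.integral_prod_left.const_mul _)) hpt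
        rw [Real.norm_eq_abs, abs_of_nonneg (hf0 _)]
        exact hf1 _
    _ = L * δ + (2 * δ)⁻¹ * ∫ x in Set.Ico (0 : ℝ) 1, ∫ t in Set.Ioc (-1 : ℝ) 2, G x t := by
        have hGi' : Integrable (fun x => ∫ t in Set.Ioc (-1 : ℝ) 2, G x t)
            (volume.restrict (Set.Ico (0 : ℝ) 1)) := hGi.integral_prod_left
        rw [integral_add (integrable_const _) (hGi'.const_mul _), hcst, integral_const_mul]
    _ ≤ _ := by
        rw [mul_assoc (2 * δ)⁻¹]
        gcongr

lemma exists_setIntegral_norm_phaseIntegral_comp_le {ψ : ℝ → ℝ} (hm : Measurable ψ)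
    (hr : ∀ x, ψ x ∈ Set.Icc (0 : ℝ) 1) {K : ℝ} (hK : 0 < K)
    (hψ : ∀ x ∈ Set.Ico (0 : ℝ) 1, ∀ y ∈ Set.Ico (0 : ℝ) 1,
      |x - y| ≤ K * |ψ x - ψ y| ^ (3 / 5 : ℝ)) :
    ∃ C : ℝ, ∀ ξ : ℝ, 1 ≤ |ξ| →
      ∫ x in Set.Ico (0 : ℝ) 1, ‖phaseIntegral ψ ξ (ψ x)‖ ≤ C * |ξ| ^ (-(1 / 40) : ℝ) := by
  obtain ⟨C, hC, hCξ⟩ := exists_setIntegral_norm_sq_phaseIntegral_le hm hK hψ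
  refine ⟨3 + K * C, fun ξ hξ => ?_⟩
  have h1 (x : ℝ) : |ψ x| ≤ 1 := abs_le.2 ⟨by linarith [(hr x).1], (hr x).2⟩
  have hT : 0 < |ξ| := one_pos.trans_le hξ
  set T := |ξ|
  set δ : ℝ := T ^ (-(9 / 8) : ℝ) with hδdef
  have hδ : 0 < δ := by positivity
  have hcont : Continuous fun t => ‖phaseIntegral ψ ξ t‖ :=
    (LipschitzWith.of_dist_le_mul (K := ⟨|ξ|, abs_nonneg ξ⟩) fun s t => by
      rw [dist_eq_norm]; exact norm_phaseIntegral_sub_le hm h1 ξ s t).continuous.norm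
  have hsq : ∫ x in Set.Ico (0 : ℝ) 1, ‖phaseIntegral ψ ξ (ψ x)‖ ^ 2
      ≤ (2 + K * C) * T ^ (-(1 / 20) : ℝ) := by
    have havg := setIntegral_comp_le_of_lipschitz (f := fun t => ‖phaseIntegral ψ ξ t‖ ^ 2)
      (L := 2 * T) hm hr hK.le hψ (fun t => by positivity)
      (fun t => pow_le_one₀ (norm_nonneg _) (norm_phaseIntegral_le ψ ξ t)) (by positivity)
      (abs_norm_sq_phaseIntegral_sub_le hm h1 ξ) hδ
      (Real.rpow_le_one_of_one_le_of_nonpos hξ (by norm_num))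
    have hA : 2 * T * δ ≤ 2 * T ^ (-(1 / 20) : ℝ) := by
      rw [mul_assoc]
      gcongr
      calc T * δ = T ^ (1 + -(9 / 8) : ℝ) := by rw [Real.rpow_add hT, Real.rpow_one]
        _ ≤ _ := Real.rpow_le_rpow_of_exponent_le hξ (by norm_num)
    have hB : (2 * δ)⁻¹ * (2 * δ) ^ (3 / 5 : ℝ) ≤ T ^ (9 / 20 : ℝ) := by
      calc (2 * δ)⁻¹ * (2 * δ) ^ (3 / 5 : ℝ) = (2 * δ) ^ (-(2 / 5) : ℝ) := by
            rw [← Real.rpow_neg_one, ← Real.rpow_add (by positivity)]; norm_num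
        _ ≤ δ ^ (-(2 / 5) : ℝ) :=
            Real.rpow_le_rpow_of_nonpos hδ (by linarith) (by norm_num)
        _ = _ := by rw [hδdef, ← Real.rpow_mul hT.le]; norm_num
    refine havg.trans ?_
    calc _ ≤ 2 * T ^ (-(1 / 20) : ℝ) + T ^ (9 / 20 : ℝ) * K * (C * T ^ (-(1 / 2) : ℝ)) := by
          rw [mul_left_comm, mul_comm K]
          gcongr
          exact hCξ ξ (abs_pos.1 hT)
      _ = 2 * T ^ (-(1 / 20) : ℝ) + K * C * (T ^ (9 / 20 : ℝ) * T ^ (-(1 / 2) : ℝ)) := by ring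
      _ = _ := by rw [← Real.rpow_add hT]; norm_num; ring
  set η : ℝ := T ^ (-(1 / 40) : ℝ) with hη
  have hηpos : 0 < η := by positivity
  have hηsq : T ^ (-(1 / 20) : ℝ) = η * η := by
    rw [hη, ← Real.rpow_add hT]; norm_num
  have hint {f : ℝ → ℝ} (hf : Continuous f) (hb : ∀ t, ‖f t‖ ≤ 1) :
      Integrable (fun x => f (ψ x)) (volume.restrict (Set.Ico (0 : ℝ) 1)) :=
    Integrable.of_bound (hf.measurable.comp hm).aestronglyMeasurable 1
      (Eventually.of_forall fun x => hb _)
  have i1 := hint hcont fun t => by simpa using norm_phaseIntegral_le ψ ξ t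
  have i2 := hint (f := fun t => ‖phaseIntegral ψ ξ t‖ ^ 2) (hcont.pow 2) fun t => by
    simpa using pow_le_one₀ (n := 2) (norm_nonneg _) (norm_phaseIntegral_le ψ ξ t)
  calc ∫ x in Set.Ico (0 : ℝ) 1, ‖phaseIntegral ψ ξ (ψ x)‖
      ≤ ∫ x in Set.Ico (0 : ℝ) 1, (η + η⁻¹ * ‖phaseIntegral ψ ξ (ψ x)‖ ^ 2) := by
        refine setIntegral_mono i1 ((integrable_const _).add (i2.const_mul _)) fun x => ?_
        have hz := norm_nonneg (phaseIntegral ψ ξ (ψ x))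
        dsimp only
        rw [← sub_le_iff_le_add', le_inv_mul_iff₀ hηpos]
        nlinarith
    _ = η + η⁻¹ * ∫ x in Set.Ico (0 : ℝ) 1, ‖phaseIntegral ψ ξ (ψ x)‖ ^ 2 := by
        rw [integral_add (integrable_const _) (i2.const_mul _), integral_const_mul]
        simp
    _ ≤ η + η⁻¹ * ((2 + K * C) * (η * η)) := by rw [← hηsq]; gcongr
    _ = (3 + K * C) * η := by field_simp; ring

/-- The base `10` rereading of base `4` digits, composed with an exponential. -/
noncomputable def expQuaternaryToDecimal (x : ℝ) : ℝ := Real.exp (quaternaryToDecimal x - 1)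

lemma measurable_expQuaternaryToDecimal : Measurable expQuaternaryToDecimal :=
  (measurable_quaternaryToDecimal.sub_const 1).exp

lemma expQuaternaryToDecimal_mem (x : ℝ) : expQuaternaryToDecimal x ∈ Set.Ioo (0 : ℝ) 1 :=
  ⟨Real.exp_pos _, Real.exp_lt_one_iff.2 (by linarith [quaternaryToDecimal_le x])⟩

lemma abs_sub_le_three_mul_abs_exp_sub {a b : ℝ} (ha : 0 ≤ a) (hb : 0 ≤ b) :
    |a - b| ≤ 3 * |Real.exp (a - 1) - Real.exp (b - 1)| := by
  wlog hab : b ≤ a generalizing a b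
  · rw [abs_sub_comm a, abs_sub_comm (Real.exp _)]
    exact this hb ha (le_of_not_ge hab)
  have h1 : Real.exp (b - 1) ≤ Real.exp (a - 1) := by gcongr
  rw [abs_of_nonneg (sub_nonneg.2 hab), abs_of_nonneg (sub_nonneg.2 h1)]
  have h2 : Real.exp (a - 1) = Real.exp (b - 1) * Real.exp (a - b) := by
    rw [← Real.exp_add]; congr 1; ring
  have h3 := Real.add_one_le_exp (a - b)
  have h4 : 1 ≤ 3 * Real.exp (b - 1) := by
    have : Real.exp (-1) ≤ Real.exp (b - 1) := by gcongr; linarith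
    have h5 : (1 : ℝ) / 3 ≤ Real.exp (-1) := by
      rw [Real.exp_neg, ← one_div]
      exact one_div_le_one_div_of_le (Real.exp_pos 1) Real.exp_one_lt_three.le
    linarith
  rw [h2]
  nlinarith [Real.exp_pos (b - 1)]

lemma abs_sub_le_expQuaternaryToDecimal {x y : ℝ} (hx : x ∈ Set.Ico (0 : ℝ) 1)
    (hy : y ∈ Set.Ico (0 : ℝ) 1) :
    |x - y| ≤ 45 * |expQuaternaryToDecimal x - expQuaternaryToDecimal y| ^ (3 / 5 : ℝ) := by
  have h := abs_sub_le_three_mul_abs_exp_sub (quaternaryToDecimal_nonneg x)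
    (quaternaryToDecimal_nonneg y)
  have h3 : (3 : ℝ) ^ (3 / 5 : ℝ) ≤ 3 := Real.rpow_le_self_of_one_le (by norm_num) (by norm_num)
  calc |x - y| ≤ 15 * |quaternaryToDecimal x - quaternaryToDecimal y| ^ (3 / 5 : ℝ) :=
        abs_sub_le_quaternaryToDecimal hx hy
    _ ≤ 15 * (3 * |expQuaternaryToDecimal x - expQuaternaryToDecimal y|) ^ (3 / 5 : ℝ) := by
        gcongr
        exact h
    _ = 15 * (3 ^ (3 / 5 : ℝ) *
          |expQuaternaryToDecimal x - expQuaternaryToDecimal y| ^ (3 / 5 : ℝ)) := by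
        rw [Real.mul_rpow (by norm_num) (abs_nonneg _)]
    _ ≤ 15 * (3 * |expQuaternaryToDecimal x - expQuaternaryToDecimal y| ^ (3 / 5 : ℝ)) := by
        gcongr
    _ = _ := by ring

/-- The distribution of the product of two independent random variables, each distributed as
`expQuaternaryToDecimal` of a uniform random variable. -/
noncomputable def productMeasure : Measure ℝ :=
  ((volume.restrict (Set.Ico (0 : ℝ) 1)).prod (volume.restrict (Set.Ico (0 : ℝ) 1))).map
    fun p => expQuaternaryToDecimal p.1 * expQuaternaryToDecimal p.2

lemma measurable_expQuaternaryToDecimal_mul : Measurable fun p : ℝ × ℝ =>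
    expQuaternaryToDecimal p.1 * expQuaternaryToDecimal p.2 :=
  (measurable_expQuaternaryToDecimal.comp measurable_fst).mul
    (measurable_expQuaternaryToDecimal.comp measurable_snd)

instance : IsProbabilityMeasure productMeasure := by
  have : IsProbabilityMeasure (volume.restrict (Set.Ico (0 : ℝ) 1)) := ⟨by simp⟩
  exact Measure.isProbabilityMeasure_map measurable_expQuaternaryToDecimal_mul.aemeasurable

lemma productMeasure_compl_Ico : productMeasure (Set.Ico (0 : ℝ) 1)ᶜ = 0 := by
  rw [productMeasure, Measure.map_apply measurable_expQuaternaryToDecimal_mul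
    measurableSet_Ico.compl]
  refine measure_mono_null (t := ∅) (fun p hp => hp ?_) measure_empty
  have h1 := expQuaternaryToDecimal_mem p.1
  have h2 := expQuaternaryToDecimal_mem p.2
  exact ⟨(mul_pos h1.1 h2.1).le, mul_lt_one_of_nonneg_of_lt_one_left h1.1.le h1.2 h2.2.le⟩

lemma volume_image_expQuaternaryToDecimal_mul :
    volume ((fun p : ℝ × ℝ => expQuaternaryToDecimal p.1 * expQuaternaryToDecimal p.2) ''
      (Set.Ico 0 1 ×ˢ Set.Ico 0 1)) = 0 := by
  have h := addHaar_image_eq_zero_of_differentiableOn_of_addHaar_eq_zero volume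
    (f := fun s : ℝ => Real.exp (s - 2)) (by fun_prop) volume_image_quaternaryToDecimal_add
  rw [Set.image_image] at h
  have e (p : ℝ × ℝ) : expQuaternaryToDecimal p.1 * expQuaternaryToDecimal p.2
      = Real.exp (quaternaryToDecimal p.1 + quaternaryToDecimal p.2 - 2) := by
    rw [expQuaternaryToDecimal, expQuaternaryToDecimal, ← Real.exp_add]
    congr 1
    ring
  simpa only [e] using h

lemma productMeasure_mutuallySingular_volume : productMeasure ⟂ₘ volume := by
  set S := (fun p : ℝ × ℝ => expQuaternaryToDecimal p.1 * expQuaternaryToDecimal p.2) ''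
      (Set.Ico 0 1 ×ˢ Set.Ico 0 1)
  refine ⟨(toMeasurable volume S)ᶜ, (measurableSet_toMeasurable _ _).compl, ?_, ?_⟩
  · rw [productMeasure, Measure.prod_restrict, Measure.map_apply
      measurable_expQuaternaryToDecimal_mul (measurableSet_toMeasurable _ _).compl,
      Measure.restrict_apply (measurable_expQuaternaryToDecimal_mul
        (measurableSet_toMeasurable _ _).compl)]
    refine measure_mono_null (t := ∅)
      (fun p hp => hp.1 (subset_toMeasurable _ _ ?_)) measure_empty
    exact Set.mem_image_of_mem _ hp.2
  · rw [compl_compl, measure_toMeasurable, volume_image_expQuaternaryToDecimal_mul]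

lemma fourierCoeffM_productMeasure (n : ℤ) :
    fourierCoeffM productMeasure n = ∫ x in Set.Ico (0 : ℝ) 1,
      phaseIntegral expQuaternaryToDecimal (-(2 * Real.pi * n)) (expQuaternaryToDecimal x) := by
  have e (u : ℝ) : Complex.exp (-(2 * Real.pi * Complex.I * (n : ℂ) * (u : ℂ)))
      = Complex.exp ((-(2 * Real.pi * n) * u : ℝ) * Complex.I) := by
    congr 1
    push_cast
    ring
  have hm := measurable_expQuaternaryToDecimal_mul
  have hmeas : Measurable fun u : ℝ =>
      Complex.exp ((-(2 * Real.pi * n) * u : ℝ) * Complex.I) := by fun_prop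
  simp_rw [fourierCoeffM, e]
  rw [productMeasure, integral_map hm.aemeasurable hmeas.aestronglyMeasurable,
    integral_prod _ (integrable_cexp _ (hm.const_mul _))]
  have e' (x y : ℝ) : -(2 * Real.pi * n) * (expQuaternaryToDecimal x * expQuaternaryToDecimal y)
      = -(2 * Real.pi * n) * expQuaternaryToDecimal y * expQuaternaryToDecimal x := by ring
  simp only [phaseIntegral, e']

/-- (Littlewood) There exist a probability Borel measure `σ` on `[0,1)` mutually
singular with Lebesgue measure and a constant `c > 0` with `σ̂(n) = O(|n|^{-c})`. -/
theorem stmt_13 :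
    ∃ (σ : Measure ℝ) (c : ℝ), IsProbabilityMeasure σ ∧
      σ (Set.Ico (0:ℝ) 1)ᶜ = 0 ∧
      σ ⟂ₘ (MeasureTheory.volume.restrict (Set.Ico (0:ℝ) 1)) ∧
      0 < c ∧
      (fun n : ℤ => fourierCoeffM σ n) =O[cofinite]
        (fun n : ℤ => (|n| : ℝ) ^ (-c)) := by
  obtain ⟨C, hC⟩ := exists_setIntegral_norm_phaseIntegral_comp_le measurable_expQuaternaryToDecimal
    (fun x => Set.Ioo_subset_Icc_self (expQuaternaryToDecimal_mem x)) (by norm_num : (0 : ℝ) < 45)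
    fun x hx y hy => abs_sub_le_expQuaternaryToDecimal hx hy
  refine ⟨productMeasure, 1 / 40, inferInstance, productMeasure_compl_Ico,
    productMeasure_mutuallySingular_volume.mono_ac Measure.AbsolutelyContinuous.rfl
      Measure.absolutelyContinuous_restrict, by norm_num, IsBigO.of_bound |C| ?_⟩
  filter_upwards [(Set.finite_singleton (0 : ℤ)).compl_mem_cofinite] with n hn
  have hn1 : (1 : ℝ) ≤ |(n : ℝ)| := by exact_mod_cast Int.one_le_abs hn
  have hle : |(n : ℝ)| ≤ |(-(2 * Real.pi * n) : ℝ)| := by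
    rw [abs_neg, abs_mul, abs_of_pos Real.two_pi_pos]
    exact le_mul_of_one_le_left (abs_nonneg _) (by linarith [Real.pi_gt_three])
  rw [fourierCoeffM_productMeasure, Real.norm_of_nonneg (by positivity)]
  calc _ ≤ ∫ x in Set.Ico (0 : ℝ) 1, ‖phaseIntegral expQuaternaryToDecimal (-(2 * Real.pi * n))
          (expQuaternaryToDecimal x)‖ := norm_integral_le_integral_norm _
    _ ≤ C * |(-(2 * Real.pi * n) : ℝ)| ^ (-(1 / 40) : ℝ) := hC _ (hn1.trans hle)
    _ ≤ |C| * |(-(2 * Real.pi * n) : ℝ)| ^ (-(1 / 40) : ℝ) := by gcongr; exact le_abs_self C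
    _ ≤ |C| * |(n : ℝ)| ^ (-(1 / 40) : ℝ) :=
        mul_le_mul_of_nonneg_left
          (Real.rpow_le_rpow_of_nonpos (one_pos.trans_le hn1) hle (by norm_num)) (abs_nonneg C)
end

section
/- For every c with 0 < c < 1/2 there exists a probability Borel measure σ on [0,1) that is mutually singular with Lebesgue measure and satisfies σ̂(n) = O(|n|^{-c}) as |n| → ∞. -/
open MeasureTheory Filter Asymptotics

/-- The divisor bound `d(n) ≤ C n ^ η`. -/
lemma exists_card_divisors_le_rpow {η : ℝ} (hη : 0 < η) :
    ∃ C : ℝ, 0 < C ∧ ∀ n : ℕ, n ≠ 0 → (n.divisors.card : ℝ) ≤ C * (n : ℝ) ^ η := by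
  have hlog : 0 < Real.log 2 := Real.log_pos one_lt_two
  set K : ℝ := max 1 (η * Real.log 2)⁻¹ with hK
  have hK1 : 1 ≤ K := le_max_left _ _
  have hK2 : 1 ≤ K * (η * Real.log 2) := by
    have : (η * Real.log 2)⁻¹ ≤ K := le_max_right _ _
    rwa [inv_le_iff_one_le_mul₀ (by positivity)] at this
  have small (p a : ℕ) (hp : 2 ≤ p) : (a + 1 : ℝ) ≤ K * ((p : ℝ) ^ a) ^ η := by
    have h1 : (2 : ℝ) ≤ p := by exact_mod_cast hp
    have h2 : ((2 : ℝ) ^ a) ^ η ≤ ((p : ℝ) ^ a) ^ η := by gcongr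
    have h3 : 1 + a * (η * Real.log 2) ≤ ((2 : ℝ) ^ a) ^ η := by
      rw [Real.rpow_def_of_pos (by positivity), Real.log_pow]
      have := Real.add_one_le_exp (a * Real.log 2 * η)
      linarith
    calc (a + 1 : ℝ) ≤ a * (K * (η * Real.log 2)) + K := by
          have := mul_le_mul_of_nonneg_left hK2 (Nat.cast_nonneg (α := ℝ) a)
          linarith
      _ = K * (1 + a * (η * Real.log 2)) := by ring
      _ ≤ _ := by gcongr; exact h3.trans h2
  set P : ℕ := ⌈(2 : ℝ) ^ η⁻¹⌉₊ with hP
  have large (p a : ℕ) (hp : P ≤ p) : (a + 1 : ℝ) ≤ ((p : ℝ) ^ a) ^ η := by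
    have h1 : (2 : ℝ) ^ η⁻¹ ≤ p := (Nat.le_ceil _).trans (by exact_mod_cast hp)
    have h2 : (2 : ℝ) ≤ (p : ℝ) ^ η := by
      calc (2 : ℝ) = ((2 : ℝ) ^ η⁻¹) ^ η := by
            rw [← Real.rpow_mul (by norm_num), inv_mul_cancel₀ hη.ne', Real.rpow_one]
        _ ≤ _ := by gcongr
    rw [← Real.rpow_natCast, ← Real.rpow_mul (by positivity), mul_comm, Real.rpow_mul (by positivity),
      Real.rpow_natCast]
    calc (a + 1 : ℝ) ≤ 2 ^ a := by exact_mod_cast Nat.succ_le_of_lt a.lt_two_pow_self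
      _ ≤ _ := by gcongr
  refine ⟨K ^ P, by positivity, fun n hn ↦ ?_⟩
  have hprod : (n : ℝ) ^ η = ∏ p ∈ n.primeFactors, ((p : ℝ) ^ n.factorization p) ^ η := by
    rw [Real.finsetProd_rpow _ _ (fun _ _ ↦ by positivity)]
    congr 1
    exact_mod_cast (Nat.prod_factorization_pow_eq_self hn).symm
  have hcard : ∏ p ∈ n.primeFactors, (if p < P then K else 1) ≤ K ^ P := by
    rw [Finset.prod_ite, Finset.prod_const, Finset.prod_const_one, mul_one]
    refine pow_le_pow_right₀ hK1 ?_
    calc _ ≤ (Finset.range P).card := Finset.card_le_card (fun p ↦ by simp)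
      _ = P := Finset.card_range P
  calc (n.divisors.card : ℝ) = ∏ p ∈ n.primeFactors, ((n.factorization p : ℝ) + 1) := by
        rw [Nat.card_divisors hn]; push_cast; rfl
    _ ≤ ∏ p ∈ n.primeFactors, ((if p < P then K else 1) * ((p : ℝ) ^ n.factorization p) ^ η) := by
        refine Finset.prod_le_prod (fun _ _ ↦ by positivity) fun p hp ↦ ?_
        split_ifs with h
        · exact small p _ (Nat.prime_of_mem_primeFactors hp).two_le
        · rw [one_mul]; exact large p _ (not_lt.mp h)
    _ ≤ _ := by
        rw [Finset.prod_mul_distrib, ← hprod]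
        gcongr

/-- The complexification of a real continuous function on the circle. -/
noncomputable def circleOfReal (f : C(UnitAddCircle, ℝ)) : C(UnitAddCircle, ℂ) :=
  ⟨fun x ↦ (f x : ℂ), by fun_prop⟩

@[simp]
lemma circleOfReal_apply (f : C(UnitAddCircle, ℝ)) (x : UnitAddCircle) :
    circleOfReal f x = (f x : ℂ) := rfl

lemma fourierCoeff_zero_circleOfReal (f : C(UnitAddCircle, ℝ)) :
    fourierCoeff (circleOfReal f) 0 = ((∫ x, f x ∂AddCircle.haarAddCircle : ℝ) : ℂ) := by
  simp [fourierCoeff, integral_complex_ofReal]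

lemma norm_fourierCoeff_circleOfReal_le (f : C(UnitAddCircle, ℝ)) (hf : ∀ x, 0 ≤ f x) (n : ℤ) :
    ‖fourierCoeff (circleOfReal f) n‖ ≤ ∫ x, f x ∂AddCircle.haarAddCircle := by
  refine (norm_integral_le_integral_norm _).trans_eq (integral_congr_ae (ae_of_all _ fun x ↦ ?_))
  simp [abs_of_nonneg (hf x), fourier_apply, Circle.norm_coe]

/-- The tent function on the circle with support `‖x‖ ≤ ε` and mean `1`. -/
noncomputable def circleTent (ε : ℝ) : C(UnitAddCircle, ℝ) :=
  ⟨fun x ↦ ε⁻¹ * max 0 (1 - ‖x‖ / ε), by fun_prop⟩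

lemma circleTent_apply (ε : ℝ) (x : UnitAddCircle) :
    circleTent ε x = ε⁻¹ * max 0 (1 - ‖x‖ / ε) := rfl

lemma circleTent_nonneg {ε : ℝ} (hε : 0 < ε) (x : UnitAddCircle) : 0 ≤ circleTent ε x := by
  rw [circleTent_apply]; positivity

lemma circleTent_eq_zero {ε : ℝ} (hε : 0 < ε) {x : UnitAddCircle} (hx : ε ≤ ‖x‖) :
    circleTent ε x = 0 := by
  rw [circleTent_apply, max_eq_left, mul_zero]
  rw [sub_nonpos, one_le_div hε]
  exact hx

lemma circleTent_coe {ε : ℝ} {x : ℝ} (hx : |x| ≤ 1 / 2) :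
    circleTent ε (x : UnitAddCircle) = ε⁻¹ * max 0 (1 - |x| / ε) := by
  rw [circleTent_apply, (AddCircle.norm_coe_eq_abs_iff (p := (1 : ℝ)) one_ne_zero).2 (by simpa using hx)]

lemma fourierCoeff_circleTent {ε : ℝ} (hε : 0 < ε) (hε' : ε ≤ 1 / 2) (n : ℤ) :
    fourierCoeff (circleOfReal (circleTent ε)) n =
      (ε : ℂ)⁻¹ * ((∫ x in (-ε)..0, (1 + x / ε) * Complex.exp (-(2 * Real.pi * Complex.I * n) * x)) +
        ∫ x in (0 : ℝ)..ε, (1 - x / ε) * Complex.exp (-(2 * Real.pi * Complex.I * n) * x)) := by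
  rw [fourierCoeff_eq_intervalIntegral _ n (-1 / 2)]
  set g : ℝ → ℂ := fun x ↦ fourier (-n) (x : UnitAddCircle) • circleOfReal (circleTent ε) x with hg
  have hgc : Continuous g := by
    have : Continuous fun x : ℝ ↦ (x : UnitAddCircle) := AddCircle.continuous_mk' 1
    simp only [hg]
    fun_prop
  have hI (a b : ℝ) : IntervalIntegrable g volume a b := hgc.intervalIntegrable a b
  have hexp (x : ℝ) : (fourier (-n) (x : UnitAddCircle) : ℂ) =
      Complex.exp (-(2 * Real.pi * Complex.I * n) * x) := by
    rw [fourier_coe_apply]; congr 1; push_cast; ring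
  have h1 : ∫ x in (-1 / 2 : ℝ)..(-ε), g x = 0 := by
    refine (intervalIntegral.integral_congr (g := fun _ ↦ 0) fun x hx ↦ ?_).trans (by simp)
    rw [Set.uIcc_of_le (by linarith)] at hx
    have hx0 : |x| = -x := abs_of_nonpos (by linarith [hx.2])
    have : circleTent ε (x : UnitAddCircle) = 0 := by
      rw [circleTent_coe (by rw [hx0]; linarith [hx.1]), hx0, max_eq_left, mul_zero]
      rw [sub_nonpos, one_le_div hε]; linarith [hx.2]
    simp [hg, this]
  have h4 : ∫ x in ε..(1 / 2 : ℝ), g x = 0 := by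
    refine (intervalIntegral.integral_congr (g := fun _ ↦ 0) fun x hx ↦ ?_).trans (by simp)
    rw [Set.uIcc_of_le (by linarith)] at hx
    have hx0 : |x| = x := abs_of_nonneg (by linarith [hx.1])
    have : circleTent ε (x : UnitAddCircle) = 0 := by
      rw [circleTent_coe (by rw [hx0]; linarith [hx.2]), hx0, max_eq_left, mul_zero]
      rw [sub_nonpos, one_le_div hε]; linarith [hx.1]
    simp [hg, this]
  have h2 : ∫ x in (-ε)..0, g x = (ε : ℂ)⁻¹ *
      ∫ x in (-ε)..0, (1 + x / ε) * Complex.exp (-(2 * Real.pi * Complex.I * n) * x) := by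
    rw [← intervalIntegral.integral_const_mul]
    refine intervalIntegral.integral_congr fun x hx ↦ ?_
    rw [Set.uIcc_of_le (by linarith)] at hx
    have hx0 : |x| = -x := abs_of_nonpos (by linarith [hx.2])
    have : circleTent ε (x : UnitAddCircle) = ε⁻¹ * (1 + x / ε) := by
      rw [circleTent_coe (by rw [hx0]; linarith [hx.1]), hx0, max_eq_right]
      · ring
      rw [sub_nonneg, div_le_one hε]; linarith [hx.1]
    simp only [hg, hexp, circleOfReal_apply, this, smul_eq_mul]
    push_cast
    ring
  have h3 : ∫ x in (0 : ℝ)..ε, g x = (ε : ℂ)⁻¹ *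
      ∫ x in (0 : ℝ)..ε, (1 - x / ε) * Complex.exp (-(2 * Real.pi * Complex.I * n) * x) := by
    rw [← intervalIntegral.integral_const_mul]
    refine intervalIntegral.integral_congr fun x hx ↦ ?_
    rw [Set.uIcc_of_le (by linarith)] at hx
    have hx0 : |x| = x := abs_of_nonneg (by linarith [hx.1])
    have : circleTent ε (x : UnitAddCircle) = ε⁻¹ * (1 - x / ε) := by
      rw [circleTent_coe (by rw [hx0]; linarith [hx.2]), hx0, max_eq_right]
      rw [sub_nonneg, div_le_one hε]; linarith [hx.2]
    simp only [hg, hexp, circleOfReal_apply, this, smul_eq_mul]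
    push_cast
    ring
  rw [show (-1 / 2 + 1 : ℝ) = 1 / 2 by norm_num,
    ← intervalIntegral.integral_add_adjacent_intervals (hI _ ε) (hI _ _),
    ← intervalIntegral.integral_add_adjacent_intervals (hI _ 0) (hI _ _),
    ← intervalIntegral.integral_add_adjacent_intervals (hI _ (-ε)) (hI _ _), h1, h2, h3, h4]
  simp
  ring

lemma integral_circleTent {ε : ℝ} (hε : 0 < ε) (hε' : ε ≤ 1 / 2) :
    ∫ x, circleTent ε x ∂AddCircle.haarAddCircle = 1 := by
  have h := fourierCoeff_circleTent hε hε' 0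
  rw [fourierCoeff_zero_circleOfReal] at h
  have hε0 : (ε : ℂ) ≠ 0 := by exact_mod_cast hε.ne'
  have h1 : ∫ x : ℝ in (-ε)..0, (1 + x / ε : ℂ) = ((ε / 2 : ℝ) : ℂ) := by
    have : ∫ x : ℝ in (-ε)..0, (1 + x / ε) = ε / 2 := by
      rw [intervalIntegral.integral_add (by simp) (by simp), intervalIntegral.integral_div]
      simp
      field_simp
      ring
    rw [← this, ← intervalIntegral.integral_ofReal]
    push_cast
    rfl
  have h2 : ∫ x : ℝ in (0 : ℝ)..ε, (1 - x / ε : ℂ) = ((ε / 2 : ℝ) : ℂ) := by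
    have : ∫ x : ℝ in (0 : ℝ)..ε, (1 - x / ε) = ε / 2 := by
      rw [intervalIntegral.integral_sub (by simp) (by simp), intervalIntegral.integral_div]
      simp
      field_simp
      ring
    rw [← this, ← intervalIntegral.integral_ofReal]
    push_cast
    rfl
  simp only [Int.cast_zero, mul_zero, neg_zero, zero_mul, Complex.exp_zero, mul_one, h1, h2] at h
  have h3 : (ε : ℂ)⁻¹ * (((ε / 2 : ℝ) : ℂ) + ((ε / 2 : ℝ) : ℂ)) = 1 := by
    push_cast; field_simp; ring
  rw [h3] at h
  exact_mod_cast h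

lemma norm_fourierCoeff_circleTent_le {ε : ℝ} (hε : 0 < ε) (hε' : ε ≤ 1 / 2) {n : ℤ} (hn : n ≠ 0) :
    ‖fourierCoeff (circleOfReal (circleTent ε)) n‖ ≤ ((ε * |(n : ℝ)|) ^ 2)⁻¹ := by
  have hε0 : (ε : ℂ) ≠ 0 := by exact_mod_cast hε.ne'
  have hn' : 0 < |(n : ℝ)| := by positivity
  set b : ℂ := -(2 * Real.pi * Complex.I * n) with hb
  have hbn : ‖b‖ = 2 * Real.pi * |(n : ℝ)| := by
    simp [hb, abs_of_pos Real.pi_pos]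
  have hb0 : b ≠ 0 := by
    rw [← norm_pos_iff, hbn]; positivity
  have hd (x : ℝ) : HasDerivAt (fun x : ℝ ↦ Complex.exp (b * x)) (Complex.exp (b * x) * b) x := by
    have h : HasDerivAt (fun x : ℝ ↦ b * (x : ℂ)) b x := by
      simpa using (Complex.ofRealCLM.hasDerivAt (x := x)).const_mul b
    exact h.cexp
  have hl (x : ℝ) : HasDerivAt (fun x : ℝ ↦ (x : ℂ) / ε) (1 / ε) x :=
    (Complex.ofRealCLM.hasDerivAt (x := x)).div_const _
  have h1 : ∫ x in (-ε)..0, (1 + x / ε) * Complex.exp (b * x) =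
      1 / b - 1 / (ε * b ^ 2) + Complex.exp (-(b * ε)) / (ε * b ^ 2) := by
    rw [intervalIntegral.integral_eq_sub_of_hasDerivAt (f := fun x : ℝ ↦
      (1 + x / ε) * Complex.exp (b * x) / b - Complex.exp (b * x) / (ε * b ^ 2)) (fun x _ ↦ ?_)
      (Continuous.intervalIntegrable (by fun_prop) _ _)]
    · simp
      field_simp
      ring
    · refine (((((hl x).const_add 1).mul (hd x)).div_const b).sub
        ((hd x).div_const (ε * b ^ 2))).congr_deriv ?_
      field_simp
      ring
  have h2 : ∫ x in (0 : ℝ)..ε, (1 - x / ε) * Complex.exp (b * x) =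
      -1 / b - 1 / (ε * b ^ 2) + Complex.exp (b * ε) / (ε * b ^ 2) := by
    rw [intervalIntegral.integral_eq_sub_of_hasDerivAt (f := fun x : ℝ ↦
      (1 - x / ε) * Complex.exp (b * x) / b + Complex.exp (b * x) / (ε * b ^ 2)) (fun x _ ↦ ?_)
      (Continuous.intervalIntegrable (by fun_prop) _ _)]
    · simp
      field_simp
      ring
    · refine (((((hl x).const_sub 1).mul (hd x)).div_const b).add
        ((hd x).div_const (ε * b ^ 2))).congr_deriv ?_
      field_simp
      ring
  have key : fourierCoeff (circleOfReal (circleTent ε)) n =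
      (Complex.exp (b * ε) + Complex.exp (-(b * ε)) - 2) / (ε * b) ^ 2 := by
    rw [fourierCoeff_circleTent hε hε', ← hb, h1, h2]
    field_simp
    ring
  have he1 : ‖Complex.exp (b * ε)‖ = 1 := by
    rw [Complex.norm_exp]; simp [hb]
  have he2 : ‖Complex.exp (-(b * ε))‖ = 1 := by
    rw [Complex.norm_exp]; simp [hb]
  have hnum : ‖Complex.exp (b * ε) + Complex.exp (-(b * ε)) - 2‖ ≤ 4 := by
    refine (norm_sub_le _ _).trans ?_
    have := norm_add_le (Complex.exp (b * ε)) (Complex.exp (-(b * ε)))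
    rw [he1, he2] at this
    norm_num
    linarith
  rw [key, norm_div, norm_pow, norm_mul, hbn, Complex.norm_real, Real.norm_eq_abs, abs_of_pos hε]
  calc _ ≤ 4 / (ε * (2 * Real.pi * |(n : ℝ)|)) ^ 2 := by gcongr
    _ = (Real.pi ^ 2)⁻¹ * ((ε * |(n : ℝ)|) ^ 2)⁻¹ := by field_simp; norm_num
    _ ≤ 1 * ((ε * |(n : ℝ)|) ^ 2)⁻¹ := by
        gcongr
        refine inv_le_one_of_one_le₀ (one_le_pow₀ ?_)
        linarith [Real.pi_gt_three]
    _ = _ := one_mul _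

lemma hasSum_integral_const_mul {a : ℤ → ℂ} (ha : Summable a) (G : ℤ → C(UnitAddCircle, ℂ)) {B : ℝ}
    (hG : ∀ m x, ‖G m x‖ ≤ B) (μ : Measure UnitAddCircle) [IsProbabilityMeasure μ] :
    HasSum (fun m ↦ a m * ∫ x, G m x ∂μ) (∫ x, ∑' m, a m * G m x ∂μ) := by
  have hint (m : ℤ) : Integrable (fun x ↦ a m * G m x) μ :=
    ((G m).continuous.integrable_of_hasCompactSupport
      (HasCompactSupport.of_compactSpace _)).const_mul (a m)
  have hle (m : ℤ) : ∫ x, ‖a m * G m x‖ ∂μ ≤ ‖a m‖ * B := by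
    have h := norm_integral_le_of_norm_le_const (μ := μ) (C := ‖a m‖ * B)
      (f := fun x ↦ ‖a m * G m x‖) (ae_of_all _ fun x ↦ by
        rw [norm_norm, norm_mul]
        exact mul_le_mul_of_nonneg_left (hG m x) (norm_nonneg _))
    rw [probReal_univ, mul_one] at h
    exact (le_abs_self _).trans h
  have key := hasSum_integral_of_summable_integral_norm hint
    (Summable.of_nonneg_of_le (fun m ↦ integral_nonneg fun x ↦ norm_nonneg _) hle
      (ha.norm.mul_right B))
  refine key.congr_fun fun m ↦ ?_
  rw [integral_const_mul]

lemma hasSum_fourierCoeff_mul {a : ℤ → ℂ} (ha : Summable a) (k : ℤ → ℤ) (h g : C(UnitAddCircle, ℂ))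
    (hh : ∀ x, HasSum (fun m ↦ a m * fourier (k m) x) (h x)) (n : ℤ) :
    HasSum (fun m ↦ a m * fourierCoeff g (n - k m)) (fourierCoeff (h * g) n) := by
  have key := hasSum_integral_const_mul ha (fun m ↦ fourier (-(n - k m)) * g) (B := ‖g‖)
    (fun m x ↦ by
      rw [ContinuousMap.mul_apply, norm_mul, fourier_apply, Circle.norm_coe, one_mul]
      exact g.norm_coe_le_norm x) AddCircle.haarAddCircle
  have h1 : fourierCoeff (h * g) n =
      ∫ x, ∑' m, a m * (fourier (-(n - k m)) * g : C(UnitAddCircle, ℂ)) x ∂AddCircle.haarAddCircle := by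
    refine integral_congr_ae (ae_of_all _ fun x ↦ ?_)
    have h2 := ((hh x).mul_left (fourier (-n) x)).mul_right (g x)
    change fourier (-n) x • (h x * g x) = ∑' m, a m * (fourier (-(n - k m)) * g : C(UnitAddCircle, ℂ)) x
    rw [smul_eq_mul, ← mul_assoc, ← h2.tsum_eq]
    refine tsum_congr fun m ↦ ?_
    rw [ContinuousMap.mul_apply, neg_sub, sub_eq_add_neg, fourier_add]
    ring
  rw [h1]
  exact key

lemma hasSum_fourierCoeff_conv {f : C(UnitAddCircle, ℂ)} (hf : Summable (fourierCoeff f))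
    (g : C(UnitAddCircle, ℂ)) (n : ℤ) :
    HasSum (fun m ↦ fourierCoeff f m * fourierCoeff g (n - m)) (fourierCoeff (f * g) n) :=
  hasSum_fourierCoeff_mul hf id f g
    (fun x ↦ by simpa using has_pointwise_sum_fourier_series_of_summable hf x) n

/-- Multiplication by `q` on the circle. -/
def circleNsmul (q : ℕ) : C(UnitAddCircle, UnitAddCircle) := ⟨fun x ↦ q • x, by fun_prop⟩

@[simp]
lemma circleNsmul_apply (q : ℕ) (x : UnitAddCircle) : circleNsmul q x = q • x := rfl

lemma fourierCoeff_continuousMap_one (n : ℤ) :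
    fourierCoeff (1 : C(UnitAddCircle, ℂ)) n = if n = 0 then 1 else 0 := by
  have h : (1 : C(UnitAddCircle, ℂ)) = fourier 0 := by ext; simp
  rw [h, fourierCoeff_fourier, Pi.single_apply]

lemma fourierCoeff_comp_nsmul {f : C(UnitAddCircle, ℂ)} (hf : Summable (fourierCoeff f)) {q : ℕ}
    (hq : q ≠ 0) (n : ℤ) :
    fourierCoeff (f.comp (circleNsmul q)) n =
      if (q : ℤ) ∣ n then fourierCoeff f (n / q) else 0 := by
  have key := hasSum_fourierCoeff_mul hf (fun m ↦ q * m) (f.comp (circleNsmul q)) 1 (fun x ↦ by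
    refine (has_pointwise_sum_fourier_series_of_summable hf (q • x)).congr_fun fun m ↦ ?_
    rw [smul_eq_mul]
    congr 1
    simp only [fourier_apply]
    rw [mul_comm, mul_zsmul, natCast_zsmul]) n
  rw [mul_one] at key
  simp only [fourierCoeff_continuousMap_one] at key
  refine key.unique ?_
  have hq' : (q : ℤ) ≠ 0 := by exact_mod_cast hq
  split_ifs with hd
  · obtain ⟨j, rfl⟩ := hd
    rw [Int.mul_ediv_cancel_left _ hq']
    have := hasSum_single (f := fun m ↦ fourierCoeff f m *
      if (q : ℤ) * j - q * m = 0 then (1 : ℂ) else 0) j (fun m hm ↦ by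
        rw [if_neg, mul_zero]
        rw [← mul_sub]
        exact mul_ne_zero hq' (sub_ne_zero.2 hm.symm))
    simpa using this
  · have (m : ℤ) : fourierCoeff f m * (if n - q * m = 0 then (1 : ℂ) else 0) = 0 := by
      rw [if_neg, mul_zero]
      exact fun h ↦ hd ⟨m, by linarith⟩
    simp only [this]
    exact hasSum_zero

/-- The weights `(1 + |n|) ^ c`. -/
noncomputable def circleWeight (c : ℝ) (n : ℤ) : ℝ := (1 + |(n : ℝ)|) ^ c

lemma circleWeight_nonneg (c : ℝ) (n : ℤ) : 0 ≤ circleWeight c n := by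
  unfold circleWeight; positivity

lemma one_le_circleWeight {c : ℝ} (hc : 0 ≤ c) (n : ℤ) : 1 ≤ circleWeight c n :=
  Real.one_le_rpow (by linarith [abs_nonneg (n : ℝ)]) hc

lemma circleWeight_add_le {c : ℝ} (hc : 0 ≤ c) (m n : ℤ) :
    circleWeight c (m + n) ≤ circleWeight c m * circleWeight c n := by
  unfold circleWeight
  rw [← Real.mul_rpow (by positivity) (by positivity)]
  refine Real.rpow_le_rpow (by positivity) ?_ hc
  push_cast
  nlinarith [abs_add_le (m : ℝ) n, mul_nonneg (abs_nonneg (m : ℝ)) (abs_nonneg (n : ℝ))]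

/-- The Fourier coefficients of `f` are summable against the weights `(1 + |n|) ^ c`. -/
def BeurlingSummable (c : ℝ) (f : C(UnitAddCircle, ℂ)) : Prop :=
  Summable fun n ↦ circleWeight c n * ‖fourierCoeff f n‖

lemma BeurlingSummable.summable {c : ℝ} (hc : 0 ≤ c) {f : C(UnitAddCircle, ℂ)}
    (hf : BeurlingSummable c f) : Summable (fourierCoeff f) := by
  refine Summable.of_norm_bounded hf fun n ↦ ?_
  exact le_mul_of_one_le_left (norm_nonneg _) (one_le_circleWeight hc n)

lemma circleWeight_mul_norm_le {c : ℝ} (hc : 0 ≤ c) (f g : C(UnitAddCircle, ℂ)) (m n : ℤ) :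
    circleWeight c n * ‖fourierCoeff f m * fourierCoeff g (n - m)‖ ≤
      (circleWeight c m * ‖fourierCoeff f m‖) *
        (circleWeight c (n - m) * ‖fourierCoeff g (n - m)‖) := by
  have := circleWeight_add_le hc m (n - m)
  rw [add_sub_cancel] at this
  rw [norm_mul]
  calc _ ≤ (circleWeight c m * circleWeight c (n - m)) *
        (‖fourierCoeff f m‖ * ‖fourierCoeff g (n - m)‖) := by gcongr
    _ = _ := by ring

lemma BeurlingSummable.mul {c : ℝ} (hc : 0 ≤ c) {f g : C(UnitAddCircle, ℂ)}
    (hf : BeurlingSummable c f) (hg : BeurlingSummable c g) : BeurlingSummable c (f * g) := by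
  have h1 : Summable fun p : ℤ × ℤ ↦ (circleWeight c p.1 * ‖fourierCoeff f p.1‖) *
      (circleWeight c p.2 * ‖fourierCoeff g p.2‖) :=
    Summable.mul_of_nonneg (f := fun n ↦ circleWeight c n * ‖fourierCoeff f n‖)
      (g := fun n ↦ circleWeight c n * ‖fourierCoeff g n‖) hf hg
      (fun _ ↦ mul_nonneg (circleWeight_nonneg _ _) (norm_nonneg _))
      (fun _ ↦ mul_nonneg (circleWeight_nonneg _ _) (norm_nonneg _))
  let e : ℤ × ℤ ≃ ℤ × ℤ :=
    { toFun := fun p ↦ (p.2, p.1 - p.2)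
      invFun := fun p ↦ (p.1 + p.2, p.1)
      left_inv := fun p ↦ by simp
      right_inv := fun p ↦ by simp }
  have h2 := e.summable_iff.2 h1
  have h3 : Summable fun p : ℤ × ℤ ↦
      circleWeight c p.1 * ‖fourierCoeff f p.2 * fourierCoeff g (p.1 - p.2)‖ :=
    Summable.of_nonneg_of_le (fun _ ↦ mul_nonneg (circleWeight_nonneg _ _) (norm_nonneg _))
      (fun p ↦ circleWeight_mul_norm_le hc f g p.2 p.1) h2
  refine Summable.of_nonneg_of_le (fun _ ↦ mul_nonneg (circleWeight_nonneg _ _) (norm_nonneg _))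
    (fun n ↦ ?_) h3.prod
  rw [← (hasSum_fourierCoeff_conv (hf.summable hc) g n).tsum_eq]
  dsimp only
  rw [tsum_mul_left]
  refine mul_le_mul_of_nonneg_left (norm_tsum_le_tsum_norm ?_) (circleWeight_nonneg _ _)
  have := h3.prod_factor n
  dsimp only at this
  rwa [summable_mul_left_iff (by linarith [one_le_circleWeight hc n])] at this

lemma circleWeight_mul_norm_sub_le {c : ℝ} (hc : 0 ≤ c) {f g : C(UnitAddCircle, ℂ)}
    (hf : BeurlingSummable c f) (hg : BeurlingSummable c g) (hf0 : fourierCoeff f 0 = 1) {δ : ℝ}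
    (hfδ : ∀ n ≠ 0, circleWeight c n * ‖fourierCoeff f n‖ ≤ δ) (n : ℤ) :
    circleWeight c n * ‖fourierCoeff (f * g) n - fourierCoeff g n‖ ≤
      δ * ∑' m, circleWeight c m * ‖fourierCoeff g m‖ := by
  have h1 := hasSum_fourierCoeff_conv (hf.summable hc) g n
  have h2 : HasSum (fun m ↦ if m = 0 then 0 else fourierCoeff f m * fourierCoeff g (n - m))
      (fourierCoeff (f * g) n - fourierCoeff g n) := by
    have := h1.sub (hasSum_ite_eq (0 : ℤ) (fourierCoeff g n))
    refine this.congr_fun fun m ↦ ?_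
    split_ifs with h
    · simp [h, hf0]
    · simp
  have h3 : HasSum (fun m ↦ δ * (circleWeight c (n - m) * ‖fourierCoeff g (n - m)‖))
      (δ * ∑' m, circleWeight c m * ‖fourierCoeff g m‖) :=
    ((Equiv.subLeft n).hasSum_iff.2 hg.hasSum).mul_left δ
  have hw : circleWeight c n ≠ 0 := by linarith [one_le_circleWeight hc n]
  have hδ : 0 ≤ δ := (mul_nonneg (circleWeight_nonneg _ _) (norm_nonneg _)).trans
    (hfδ 1 one_ne_zero)
  have h4 := h2.mul_left (circleWeight c n : ℂ)
  have h5 := tsum_of_norm_bounded h3 (f := fun m ↦ (circleWeight c n : ℂ) *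
    if m = 0 then 0 else fourierCoeff f m * fourierCoeff g (n - m)) (fun m ↦ by
      rw [norm_mul, Complex.norm_real, Real.norm_of_nonneg (circleWeight_nonneg _ _)]
      split_ifs with h
      · rw [norm_zero, mul_zero]
        exact mul_nonneg hδ (mul_nonneg (circleWeight_nonneg _ _) (norm_nonneg _))
      · refine (circleWeight_mul_norm_le hc f g m n).trans ?_
        exact mul_le_mul_of_nonneg_right (hfδ m h)
          (mul_nonneg (circleWeight_nonneg _ _) (norm_nonneg _)))
  rw [h4.tsum_eq, norm_mul, Complex.norm_real,
    Real.norm_of_nonneg (circleWeight_nonneg _ _)] at h5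
  exact h5

lemma norm_fourierCoeff_circleTent_le_rpow {ε : ℝ} (hε : 0 < ε) (hε' : ε ≤ 1 / 2) {n : ℤ}
    (hn : n ≠ 0) {s : ℝ} (hs : 0 ≤ s) (hs' : s ≤ 2) :
    ‖fourierCoeff (circleOfReal (circleTent ε)) n‖ ≤ (ε * |(n : ℝ)|) ^ (-s) := by
  have hpos : 0 < ε * |(n : ℝ)| := by positivity
  rcases le_total 1 (ε * |(n : ℝ)|) with h | h
  · refine (norm_fourierCoeff_circleTent_le hε hε' hn).trans ?_
    rw [Real.rpow_neg hpos.le]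
    refine inv_anti₀ (by positivity) ?_
    calc (ε * |(n : ℝ)|) ^ s ≤ (ε * |(n : ℝ)|) ^ (2 : ℝ) := Real.rpow_le_rpow_of_exponent_le h hs'
      _ = _ := by norm_cast
  · refine (norm_fourierCoeff_circleOfReal_le _ (circleTent_nonneg hε) n).trans ?_
    rw [integral_circleTent hε hε']
    exact Real.one_le_rpow_of_pos_of_le_one_of_nonpos hpos h (by linarith)

lemma summable_fourierCoeff_circleTent {ε : ℝ} (hε : 0 < ε) (hε' : ε ≤ 1 / 2) :
    Summable (fourierCoeff (circleOfReal (circleTent ε))) := by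
  refine Summable.of_norm_bounded_eventually
    (g := fun n : ℤ ↦ ε ^ (-2 : ℝ) * |(n : ℝ)| ^ (-2 : ℝ))
    ((Real.summable_abs_int_rpow one_lt_two).mul_left _) ?_
  filter_upwards [(Set.finite_singleton (0 : ℤ)).compl_mem_cofinite] with n hn
  rw [← Real.mul_rpow hε.le (abs_nonneg _)]
  exact norm_fourierCoeff_circleTent_le_rpow hε hε' hn zero_le_two le_rfl

/-- The average over `M ≤ q < 2 M` of the tent functions `x ↦ circleTent ε (q • x)`. -/
noncomputable def circleComb (M : ℕ) (ε : ℝ) : C(UnitAddCircle, ℝ) :=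
  (M : ℝ)⁻¹ • ∑ q ∈ Finset.Ico M (2 * M), (circleTent ε).comp (circleNsmul q)

lemma circleComb_apply (M : ℕ) (ε : ℝ) (x : UnitAddCircle) :
    circleComb M ε x = (M : ℝ)⁻¹ * ∑ q ∈ Finset.Ico M (2 * M), circleTent ε (q • x) := by
  simp [circleComb]

lemma fourierCoeff_circleComb {M : ℕ} (hM : 0 < M) {ε : ℝ} (hε : 0 < ε) (hε' : ε ≤ 1 / 2) (n : ℤ) :
    fourierCoeff (circleOfReal (circleComb M ε)) n =
      (M : ℂ)⁻¹ * ∑ q ∈ Finset.Ico M (2 * M),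
        if (q : ℤ) ∣ n then fourierCoeff (circleOfReal (circleTent ε)) (n / q) else 0 := by
  have hint (q : ℕ) : Integrable ((circleOfReal (circleTent ε)).comp (circleNsmul q))
      AddCircle.haarAddCircle :=
    (ContinuousMap.continuous _).integrable_of_hasCompactSupport
      (HasCompactSupport.of_compactSpace _)
  have h1 : (circleOfReal (circleComb M ε) : UnitAddCircle → ℂ) = fun x ↦ (M : ℂ)⁻¹ *
      (∑ q ∈ Finset.Ico M (2 * M),
        ((circleOfReal (circleTent ε)).comp (circleNsmul q) : UnitAddCircle → ℂ)) x := by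
    ext x
    simp [circleComb_apply]
  rw [h1, fourierCoeff.const_mul, fourierCoeff.sum _ _ (fun q _ ↦ hint q), Finset.sum_apply]
  congr 1
  refine Finset.sum_congr rfl fun q hq ↦ ?_
  exact fourierCoeff_comp_nsmul (summable_fourierCoeff_circleTent hε hε')
    (by have := (Finset.mem_Ico.1 hq).1; omega) n

lemma norm_fourierCoeff_circleComb_le {M : ℕ} (hM : 0 < M) {ε : ℝ} (hε : 0 < ε) (hε' : ε ≤ 1 / 2)
    {n : ℤ} (hn : n ≠ 0) {s : ℝ} (hs : 0 ≤ s) (hs' : s ≤ 2) :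
    ‖fourierCoeff (circleOfReal (circleComb M ε)) n‖ ≤
      (M : ℝ)⁻¹ * ((min M n.natAbs.divisors.card : ℕ) * (ε * |(n : ℝ)| / (2 * M)) ^ (-s)) := by
  have hM' : (0 : ℝ) < M := by exact_mod_cast hM
  rw [fourierCoeff_circleComb hM hε hε', norm_mul, norm_inv, Complex.norm_natCast]
  refine mul_le_mul_of_nonneg_left ?_ (by positivity)
  rw [← Finset.sum_filter]
  refine (norm_sum_le_of_le (f := fun q : ℕ ↦ fourierCoeff (circleOfReal (circleTent ε)) (n / q)) _
    (n := fun _ ↦ (ε * |(n : ℝ)| / (2 * M)) ^ (-s)) fun q hq ↦ ?_).trans ?_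
  · obtain ⟨hq1, j, rfl⟩ := Finset.mem_filter.1 hq
    obtain ⟨hq2, hq3⟩ := Finset.mem_Ico.1 hq1
    have hq0 : (0 : ℝ) < q := by exact_mod_cast hM.trans_le hq2
    have hqM : (q : ℝ) ≤ 2 * M := by exact_mod_cast hq3.le
    have hj : j ≠ 0 := by rintro rfl; simp at hn
    rw [Int.mul_ediv_cancel_left _ (left_ne_zero_of_mul hn)]
    refine (norm_fourierCoeff_circleTent_le_rpow hε hε' hj hs hs').trans ?_
    refine Real.rpow_le_rpow_of_nonpos (by positivity) ?_ (by linarith)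
    push_cast
    rw [abs_mul, abs_of_pos hq0, div_le_iff₀ (by positivity)]
    calc ε * (q * |(j : ℝ)|) = ε * |(j : ℝ)| * q := by ring
      _ ≤ _ := by gcongr
  · rw [Finset.sum_const, nsmul_eq_mul]
    refine mul_le_mul_of_nonneg_right ?_ (by positivity)
    refine Nat.cast_le.2 (le_min ?_ ?_)
    · refine (Finset.card_filter_le _ _).trans ?_
      rw [Nat.card_Ico]; omega
    · refine Finset.card_le_card fun q hq ↦ ?_
      rw [Nat.mem_divisors]
      exact ⟨Int.natCast_dvd.1 (Finset.mem_filter.1 hq).2, by simpa using hn⟩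

/-- The points `x` with `‖q • x‖ ≤ ε` for some `M ≤ q < 2 M`. -/
def circleCombSupport (M : ℕ) (ε : ℝ) : Set UnitAddCircle :=
  ⋃ q ∈ Finset.Ico M (2 * M), circleNsmul q ⁻¹' Metric.closedBall 0 ε

lemma isClosed_circleCombSupport (M : ℕ) (ε : ℝ) : IsClosed (circleCombSupport M ε) :=
  isClosed_biUnion_finset fun q _ ↦ Metric.isClosed_closedBall.preimage (circleNsmul q).continuous

lemma volume_circleCombSupport_le {M : ℕ} (hM : 0 < M) (ε : ℝ) :
    volume (circleCombSupport M ε) ≤ ENNReal.ofReal (M * (2 * ε)) := by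
  refine (measure_biUnion_finset_le _ _).trans ?_
  calc ∑ q ∈ Finset.Ico M (2 * M), volume (circleNsmul q ⁻¹' Metric.closedBall 0 ε)
      ≤ ∑ q ∈ Finset.Ico M (2 * M), ENNReal.ofReal (2 * ε) := by
        refine Finset.sum_le_sum fun q hq ↦ ?_
        have hq0 : (q : ℤ) ≠ 0 := by have := (Finset.mem_Ico.1 hq).1; omega
        have hmp : MeasurePreserving (circleNsmul q) volume volume := by
          have := Measure.measurePreserving_zsmul (volume : Measure UnitAddCircle) hq0
          simp only [natCast_zsmul] at this; exact this
        rw [hmp.measure_preimage Metric.isClosed_closedBall.measurableSet.nullMeasurableSet,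
          AddCircle.volume_closedBall]
        exact ENNReal.ofReal_le_ofReal (min_le_right _ _)
    _ = _ := by
        rw [Finset.sum_const, Nat.card_Ico, show 2 * M - M = M by omega, nsmul_eq_mul,
          ENNReal.ofReal_mul (p := (M : ℝ)) (by positivity), ENNReal.ofReal_natCast]

lemma circleComb_eq_zero {M : ℕ} {ε : ℝ} (hε : 0 < ε) {x : UnitAddCircle}
    (hx : x ∉ circleCombSupport M ε) : circleComb M ε x = 0 := by
  rw [circleComb_apply, Finset.sum_eq_zero, mul_zero]
  intro q hq
  refine circleTent_eq_zero hε (le_of_lt ?_)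
  simp only [circleCombSupport, Set.mem_iUnion, not_exists, Set.mem_preimage,
    mem_closedBall_zero_iff, not_le, circleNsmul_apply] at hx
  exact hx q hq

lemma circleWeight_le {c : ℝ} (hc : 0 ≤ c) (hc1 : c ≤ 1) {n : ℤ} (hn : n ≠ 0) :
    circleWeight c n ≤ 2 * |(n : ℝ)| ^ c := by
  have h1 : 1 ≤ |(n : ℝ)| := by exact_mod_cast Int.one_le_abs hn
  calc circleWeight c n ≤ (2 * |(n : ℝ)|) ^ c :=
        Real.rpow_le_rpow (by positivity) (by linarith) hc
    _ = 2 ^ c * |(n : ℝ)| ^ c := Real.mul_rpow zero_le_two (abs_nonneg _)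
    _ ≤ 2 ^ (1 : ℝ) * |(n : ℝ)| ^ c := by
        gcongr
        exact one_le_two
    _ = _ := by rw [Real.rpow_one]

lemma beurlingSummable_circleComb {c : ℝ} (hc : 0 ≤ c) (hc1 : c < 1) {M : ℕ} (hM : 0 < M) {ε : ℝ}
    (hε : 0 < ε) (hε' : ε ≤ 1 / 2) : BeurlingSummable c (circleOfReal (circleComb M ε)) := by
  have hM' : (0 : ℝ) < M := by exact_mod_cast hM
  refine Summable.of_norm_bounded_eventually
    (g := fun n : ℤ ↦ (2 * (ε / (2 * M)) ^ (-2 : ℝ)) * |(n : ℝ)| ^ (-(2 - c)))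
    ((Real.summable_abs_int_rpow (by linarith)).mul_left _) ?_
  filter_upwards [(Set.finite_singleton (0 : ℤ)).compl_mem_cofinite] with n hn
  have hn' : 0 < |(n : ℝ)| := by
    have : (n : ℝ) ≠ 0 := by exact_mod_cast hn
    positivity
  rw [Real.norm_of_nonneg (mul_nonneg (circleWeight_nonneg _ _) (norm_nonneg _))]
  have h1 : ‖fourierCoeff (circleOfReal (circleComb M ε)) n‖ ≤
      (ε / (2 * M)) ^ (-2 : ℝ) * |(n : ℝ)| ^ (-2 : ℝ) := by
    refine (norm_fourierCoeff_circleComb_le hM hε hε' hn zero_le_two le_rfl).trans ?_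
    rw [mul_div_right_comm, Real.mul_rpow (by positivity) (by positivity), ← mul_assoc]
    refine mul_le_of_le_one_left (by positivity) ?_
    rw [inv_mul_le_one₀ hM']
    exact_mod_cast min_le_left _ _
  calc _ ≤ (2 * |(n : ℝ)| ^ c) * ((ε / (2 * M)) ^ (-2 : ℝ) * |(n : ℝ)| ^ (-2 : ℝ)) := by
        gcongr
        exact circleWeight_le hc hc1.le hn
    _ = (2 * (ε / (2 * M)) ^ (-2 : ℝ)) * (|(n : ℝ)| ^ c * |(n : ℝ)| ^ (-2 : ℝ)) := by ring
    _ = _ := by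
        rw [← Real.rpow_add hn']
        congr 2
        ring

/-- Smoothed indicators of well-approximable points give densities with small, decaying Fourier
coefficients that are concentrated on small closed sets. -/
lemma exists_density_of_small_support {c : ℝ} (hc0 : 0 < c) (hc : c < 1 / 2) {δ : ℝ} (hδ : 0 < δ) :
    ∃ (F : C(UnitAddCircle, ℝ)) (E : Set UnitAddCircle), (∀ x, 0 ≤ F x) ∧
      fourierCoeff (circleOfReal F) 0 = 1 ∧ BeurlingSummable c (circleOfReal F) ∧
      (∀ n ≠ 0, circleWeight c n * ‖fourierCoeff (circleOfReal F) n‖ ≤ δ) ∧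
      IsClosed E ∧ volume E ≤ ENNReal.ofReal δ ∧ ∀ x ∉ E, F x = 0 := by
  set s : ℝ := (c + 1 / 2) / 2 with hs
  have hs0 : 0 < s := by positivity
  have hs1 : s < 1 / 2 := by rw [hs]; linarith
  have hcs : 0 < s - c := by rw [hs]; linarith
  set t : ℝ := (1 / s - 2) / 2 with ht
  have ht0 : 0 < t := by
    have : 2 < 1 / s := by rw [lt_div_iff₀ hs0]; linarith
    rw [ht]; linarith
  set κ : ℝ := 1 - (2 + t) * s with hκ
  have hκ0 : 0 < κ := by
    have : (2 + t) * s = (1 + 2 * s) / 2 := by rw [ht]; field_simp; ring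
    rw [hκ, this]; linarith
  obtain ⟨C, hC, hdiv⟩ := exists_card_divisors_le_rpow hcs
  have hlim (a b : ℝ) (ha : 0 < a) : ∀ᶠ M : ℕ in atTop, b * (M : ℝ) ^ (-a) < δ := by
    have := (((tendsto_rpow_neg_atTop ha).comp tendsto_natCast_atTop_atTop).const_mul b)
    rw [mul_zero] at this
    exact this.eventually_lt_const hδ
  obtain ⟨M, hM2, hM3, hM4⟩ := ((eventually_ge_atTop 2).and
    ((hlim t 2 ht0).and (hlim κ (4 * C) hκ0))).exists
  have hM : 0 < M := by omega
  have hM' : (0 : ℝ) < M := by exact_mod_cast hM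
  have hM2' : (2 : ℝ) ≤ M := by exact_mod_cast hM2
  set ε : ℝ := (M : ℝ) ^ (-1 - t) with hεdef
  have hε : 0 < ε := by positivity
  have hε' : ε ≤ 1 / 2 := by
    calc ε ≤ (M : ℝ) ^ (-1 : ℝ) :=
          Real.rpow_le_rpow_of_exponent_le (by linarith) (by linarith)
      _ = (M : ℝ)⁻¹ := Real.rpow_neg_one _
      _ ≤ 1 / 2 := by rw [one_div]; gcongr
  refine ⟨circleComb M ε, circleCombSupport M ε, fun x ↦ ?_, ?_,
    beurlingSummable_circleComb hc0.le (by linarith) hM hε hε', fun n hn ↦ ?_,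
    isClosed_circleCombSupport M ε, ?_, fun x hx ↦ circleComb_eq_zero hε hx⟩
  · rw [circleComb_apply]
    exact mul_nonneg (by positivity) (Finset.sum_nonneg fun q _ ↦ circleTent_nonneg hε _)
  · rw [fourierCoeff_circleComb hM hε hε']
    simp only [dvd_zero, if_true, Int.zero_ediv, fourierCoeff_zero_circleOfReal,
      integral_circleTent hε hε', Finset.sum_const, Nat.card_Ico]
    rw [show 2 * M - M = M by omega]
    simp [hM.ne']
  · have hn' : 0 < |(n : ℝ)| := by positivity
    have h1 : (ε * |(n : ℝ)| / (2 * M)) ^ (-s) =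
        |(n : ℝ)| ^ (-s) * (2 ^ s * (M : ℝ) ^ ((2 + t) * s)) := by
      have h2 : ε * |(n : ℝ)| / (2 * M) = |(n : ℝ)| * (2 * (M : ℝ) ^ (2 + t))⁻¹ := by
        have h3 : ε = (M : ℝ) * ((M : ℝ) ^ (2 + t))⁻¹ := by
          rw [hεdef, ← Real.rpow_neg hM'.le]
          nth_rewrite 2 [← Real.rpow_one (M : ℝ)]
          rw [← Real.rpow_add hM']
          congr 1
          ring
        rw [h3]
        field_simp
      rw [h2, Real.mul_rpow (by positivity) (by positivity), Real.rpow_neg (x := (_)⁻¹) (by positivity),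
        Real.inv_rpow (by positivity), inv_inv, Real.mul_rpow (by positivity) (by positivity),
        ← Real.rpow_mul hM'.le]
    have h4 : ((min M n.natAbs.divisors.card : ℕ) : ℝ) ≤ C * |(n : ℝ)| ^ (s - c) := by
      have := hdiv n.natAbs (by simpa using hn)
      rw [Nat.cast_natAbs, Int.cast_abs] at this
      exact le_trans (by exact_mod_cast min_le_right _ _) this
    have h5 : (2 : ℝ) ^ s ≤ 2 := by
      calc (2 : ℝ) ^ s ≤ 2 ^ (1 : ℝ) :=
            Real.rpow_le_rpow_of_exponent_le one_le_two (by linarith)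
        _ = 2 := Real.rpow_one 2
    calc circleWeight c n * ‖fourierCoeff (circleOfReal (circleComb M ε)) n‖
        ≤ (2 * |(n : ℝ)| ^ c) * ((M : ℝ)⁻¹ * ((C * |(n : ℝ)| ^ (s - c)) *
          (|(n : ℝ)| ^ (-s) * (2 * (M : ℝ) ^ ((2 + t) * s))))) := by
          refine mul_le_mul (circleWeight_le hc0.le (by linarith) hn) ?_ (norm_nonneg _)
            (by positivity)
          refine (norm_fourierCoeff_circleComb_le hM hε hε' hn hs0.le (by linarith)).trans ?_
          rw [h1]
          gcongr
      _ = 4 * C * ((M : ℝ) ^ ((2 + t) * s) * (M : ℝ) ^ (-1 : ℝ)) *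
          (|(n : ℝ)| ^ c * |(n : ℝ)| ^ (s - c) * |(n : ℝ)| ^ (-s)) := by
          rw [Real.rpow_neg_one]; ring
      _ = 4 * C * (M : ℝ) ^ (-κ) := by
          rw [← Real.rpow_add hn', ← Real.rpow_add hn', ← Real.rpow_add hM',
            show c + (s - c) + -s = 0 by ring, Real.rpow_zero, mul_one, hκ]
          congr 2
          ring
      _ ≤ δ := hM4.le
  · refine (volume_circleCombSupport_le hM _).trans (ENNReal.ofReal_le_ofReal ?_)
    refine le_trans (le_of_eq ?_) hM3.le
    rw [show -t = 1 + (-1 - t) by ring, Real.rpow_add hM', Real.rpow_one]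
    ring

/-- A nonnegative density with Fourier coefficients within `r` of those of the constant `1`, in the
norm weighted by `(1 + |n|) ^ c`. -/
structure IsNearUniformDensity (c r : ℝ) (f : C(UnitAddCircle, ℝ)) : Prop where
  nonneg : ∀ x, 0 ≤ f x
  beurlingSummable : BeurlingSummable c (circleOfReal f)
  near : ∀ n, circleWeight c n * ‖fourierCoeff (circleOfReal f) n - if n = 0 then 1 else 0‖ ≤ r

lemma isNearUniformDensity_one (c : ℝ) : IsNearUniformDensity c 0 1 := by
  have h (n : ℤ) : fourierCoeff (circleOfReal 1) n = if n = 0 then 1 else 0 := by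
    rw [← fourierCoeff_continuousMap_one]
    congr 1
  refine ⟨fun x ↦ zero_le_one, ?_, fun n ↦ by simp [h]⟩
  refine summable_of_ne_finset_zero (s := {0}) fun n hn ↦ ?_
  rw [h, if_neg (by simpa using hn), norm_zero, mul_zero]

lemma IsNearUniformDensity.exists_succ {c : ℝ} (hc0 : 0 < c) (hc : c < 1 / 2) {r : ℝ}
    {f : C(UnitAddCircle, ℝ)} (hf : IsNearUniformDensity c r f) {δ : ℝ} (hδ : 0 < δ) :
    ∃ (g : C(UnitAddCircle, ℝ)) (E : Set UnitAddCircle), IsNearUniformDensity c (r + δ) g ∧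
      IsClosed E ∧ volume E ≤ ENNReal.ofReal δ ∧ (∀ x ∉ E, g x = 0) ∧ ∀ x, f x = 0 → g x = 0 := by
  set N : ℝ := ∑' n, circleWeight c n * ‖fourierCoeff (circleOfReal f) n‖ with hN
  have hN0 : 0 ≤ N := tsum_nonneg fun n ↦ mul_nonneg (circleWeight_nonneg _ _) (norm_nonneg _)
  have hδ' : 0 < δ / (N + 1) := by positivity
  obtain ⟨F, E, hF0, hF1, hFs, hFδ, hE, hEvol, hFE⟩ := exists_density_of_small_support hc0 hc hδ'
  have hmul : circleOfReal (F * f) = circleOfReal F * circleOfReal f := by ext x; simp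
  refine ⟨F * f, E, ⟨fun x ↦ mul_nonneg (hF0 x) (hf.nonneg x), ?_, fun n ↦ ?_⟩, hE,
    hEvol.trans (ENNReal.ofReal_le_ofReal (div_le_self hδ.le (by linarith))),
    fun x hx ↦ by simp [hFE x hx], fun x hx ↦ by simp [hx]⟩
  · rw [hmul]
    exact hFs.mul hc0.le hf.beurlingSummable
  · have h1 := circleWeight_mul_norm_sub_le hc0.le hFs hf.beurlingSummable hF1 hFδ n
    have h2 : δ / (N + 1) * N ≤ δ := by
      rw [div_mul_eq_mul_div, div_le_iff₀ (by linarith)]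
      nlinarith
    rw [hmul]
    calc _ ≤ circleWeight c n * (‖fourierCoeff (circleOfReal f) n - if n = 0 then 1 else 0‖ +
          ‖fourierCoeff (circleOfReal F * circleOfReal f) n - fourierCoeff (circleOfReal f) n‖) := by
          refine mul_le_mul_of_nonneg_left ?_ (circleWeight_nonneg _ _)
          rw [add_comm]
          exact norm_sub_le_norm_sub_add_norm_sub _ _ _
      _ ≤ r + δ := by
          rw [mul_add]
          exact add_le_add (hf.near n) (h1.trans h2)

lemma exists_seq_isNearUniformDensity {c : ℝ} (hc0 : 0 < c) (hc : c < 1 / 2) :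
    ∃ (f : ℕ → C(UnitAddCircle, ℝ)) (E : ℕ → Set UnitAddCircle),
      (∀ k, IsNearUniformDensity c (1 / 2) (f k)) ∧ (∀ k, IsClosed (E k)) ∧
      (∀ k, volume (E k) ≤ ENNReal.ofReal ((1 / 2) ^ k)) ∧ ∀ k, ∀ x ∉ E k, ∀ j > k, f j x = 0 := by
  set r : ℕ → ℝ := fun k ↦ (1 - (1 / 2) ^ k) / 2 with hr
  have hstep (k : ℕ) (f : {f // IsNearUniformDensity c (r k) f}) :
      ∃ (g : {g // IsNearUniformDensity c (r (k + 1)) g}) (E : Set UnitAddCircle),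
        IsClosed E ∧ volume E ≤ ENNReal.ofReal ((1 / 2) ^ k) ∧ (∀ x ∉ E, g.1 x = 0) ∧
          ∀ x, f.1 x = 0 → g.1 x = 0 := by
    obtain ⟨g, E, hg, hE, hvol, h1, h2⟩ := f.2.exists_succ hc0 hc
      (δ := (1 / 2) ^ k / 4) (by positivity)
    have hrk : r k + (1 / 2) ^ k / 4 = r (k + 1) := by simp only [hr]; ring
    refine ⟨⟨g, hrk ▸ hg⟩, E, hE, hvol.trans (ENNReal.ofReal_le_ofReal ?_), h1, h2⟩
    exact div_le_self (by positivity) (by norm_num)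
  choose next E hE hvol hzero hmono using hstep
  let f : ∀ k, {f // IsNearUniformDensity c (r k) f} := fun k ↦
    Nat.rec ⟨1, by simpa [hr] using isNearUniformDensity_one c⟩ (fun k f ↦ next k f) k
  have hf (k : ℕ) : f (k + 1) = next k (f k) := rfl
  refine ⟨fun k ↦ (f k).1, fun k ↦ E k (f k), fun k ↦ ?_, fun k ↦ hE k _, fun k ↦ hvol k _,
    fun k x hx j hj ↦ ?_⟩
  · obtain ⟨h1, h2, h3⟩ := (f k).2
    refine ⟨h1, h2, fun n ↦ (h3 n).trans ?_⟩
    have : (0 : ℝ) ≤ (1 / 2) ^ k := by positivity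
    simp only [hr]
    linarith
  · induction j, hj using Nat.le_induction with
    | base => exact hzero k (f k) x hx
    | succ j _ ih => exact hmono j (f j) x ih

lemma exists_probabilityMeasure_of_density {f : C(UnitAddCircle, ℝ)} (hf : ∀ x, 0 ≤ f x)
    (hm : 0 < ∫ x, f x ∂AddCircle.haarAddCircle) :
    ∃ μ : ProbabilityMeasure UnitAddCircle,
      (∀ n : ℤ, ∫ x, (fourier (-n) x : ℂ) ∂(μ : Measure UnitAddCircle) =
        fourierCoeff (circleOfReal f) n / fourierCoeff (circleOfReal f) 0) ∧
      ∀ G : Set UnitAddCircle, MeasurableSet G → (∀ x ∈ G, f x = 0) →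
        (μ : Measure UnitAddCircle) G = 0 := by
  set m : ℝ := ∫ x, f x ∂AddCircle.haarAddCircle with hmdef
  have hint : Integrable f AddCircle.haarAddCircle :=
    f.continuous.integrable_of_hasCompactSupport (HasCompactSupport.of_compactSpace _)
  set d : UnitAddCircle → ENNReal := fun x ↦ ENNReal.ofReal (f x / m) with hd
  have hdm : Measurable d := by
    have : Measurable f := f.continuous.measurable
    simp only [hd]
    fun_prop
  have hprob : IsProbabilityMeasure (AddCircle.haarAddCircle.withDensity d) := by
    constructor
    rw [withDensity_apply _ MeasurableSet.univ, Measure.restrict_univ, hd,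
      ← ofReal_integral_eq_lintegral_ofReal (hint.div_const m)
        (ae_of_all _ fun x ↦ div_nonneg (hf x) hm.le), integral_div, ← hmdef, div_self hm.ne',
      ENNReal.ofReal_one]
  refine ⟨⟨_, hprob⟩, fun n ↦ ?_, fun G hG hfG ↦ ?_⟩
  · change ∫ x, (fourier (-n) x : ℂ) ∂(AddCircle.haarAddCircle.withDensity d) = _
    rw [integral_withDensity_eq_integral_toReal_smul hdm
      (ae_of_all _ fun x ↦ ENNReal.ofReal_lt_top), fourierCoeff_zero_circleOfReal, ← hmdef]
    change _ = (∫ x, (fourier (-n) x : ℂ) • circleOfReal f x ∂AddCircle.haarAddCircle) / (m : ℂ)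
    rw [← integral_div]
    refine integral_congr_ae (ae_of_all _ fun x ↦ ?_)
    simp only [hd, ENNReal.toReal_ofReal (div_nonneg (hf x) hm.le), circleOfReal_apply,
      smul_eq_mul, Complex.real_smul]
    push_cast
    ring
  · change AddCircle.haarAddCircle.withDensity d G = 0
    rw [withDensity_apply _ hG, setLIntegral_congr_fun (g := fun _ ↦ 0) hG, lintegral_zero]
    intro x hx
    simp [hd, hfG x hx]

/-- There is a singular probability measure on the circle whose Fourier coefficients decay like
`|n| ^ (-c)`, for `c < 1 / 2`. -/
lemma exists_singular_probabilityMeasure_circle {c : ℝ} (hc0 : 0 < c) (hc : c < 1 / 2) :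
    ∃ (μ : Measure UnitAddCircle) (S : Set UnitAddCircle), IsProbabilityMeasure μ ∧
      MeasurableSet S ∧ μ S = 0 ∧ volume Sᶜ = 0 ∧
      ∀ n ≠ 0, ‖∫ x, (fourier (-n) x : ℂ) ∂μ‖ ≤ |(n : ℝ)| ^ (-c) := by
  obtain ⟨f, E, hf, hE, hvol, hzero⟩ := exists_seq_isNearUniformDensity hc0 hc
  have hmass (k : ℕ) : 1 / 2 ≤ ∫ x, f k x ∂AddCircle.haarAddCircle := by
    have h := (hf k).near 0
    rw [if_pos rfl, fourierCoeff_zero_circleOfReal, ← Complex.ofReal_one, ← Complex.ofReal_sub,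
      Complex.norm_real, Real.norm_eq_abs] at h
    have h1 := (le_mul_of_one_le_left (abs_nonneg _) (one_le_circleWeight hc0.le 0)).trans h
    linarith [(abs_le.1 h1).1]
  choose μ hμ hμ0 using fun k ↦ exists_probabilityMeasure_of_density (hf k).nonneg
    (one_half_pos.trans_le (hmass k))
  obtain ⟨ν, hν⟩ : ∃ ν, Tendsto μ (hyperfilter ℕ) (nhds ν) :=
    ⟨_, Ultrafilter.le_nhds_lim ((hyperfilter ℕ).map μ)⟩
  have hbound (k : ℕ) (n : ℤ) (hn : n ≠ 0) :
      ‖∫ x, (fourier (-n) x : ℂ) ∂(μ k : Measure UnitAddCircle)‖ ≤ |(n : ℝ)| ^ (-c) := by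
    have hn' : 0 < |(n : ℝ)| := by positivity
    have h := (hf k).near n
    rw [if_neg hn, sub_zero] at h
    have h1 : |(n : ℝ)| ^ c * ‖fourierCoeff (circleOfReal (f k)) n‖ ≤ 1 / 2 := by
      refine (mul_le_mul_of_nonneg_right ?_ (norm_nonneg _)).trans h
      exact Real.rpow_le_rpow hn'.le (by linarith) hc0.le
    rw [hμ, norm_div, fourierCoeff_zero_circleOfReal, Complex.norm_real,
      Real.norm_of_nonneg (by linarith [hmass k]), div_le_iff₀ (by linarith [hmass k]),
      Real.rpow_neg hn'.le, inv_mul_eq_div, le_div_iff₀ (by positivity), mul_comm]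
    exact h1.trans (hmass k)
  refine ⟨ν, ⋃ k, (E k)ᶜ, inferInstance,
    MeasurableSet.iUnion fun k ↦ (hE k).measurableSet.compl, ?_, ?_, fun n hn ↦ ?_⟩
  · refine measure_iUnion_null fun k ↦ ?_
    have h := ProbabilityMeasure.le_liminf_measure_open_of_tendsto hν (hE k).isOpen_compl
    have h0 : ∀ᶠ j in (hyperfilter ℕ : Filter ℕ), (μ j : Measure UnitAddCircle) (E k)ᶜ = 0 := by
      refine Nat.hyperfilter_le_atTop ?_
      filter_upwards [eventually_gt_atTop k] with j hj
      exact hμ0 j _ (hE k).measurableSet.compl fun x hx ↦ hzero k x hx j hj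
    rw [liminf_congr h0, liminf_const] at h
    exact le_antisymm h zero_le
  · rw [Set.compl_iUnion]
    simp only [compl_compl]
    have hlim : Tendsto (fun k : ℕ ↦ ENNReal.ofReal ((1 / 2 : ℝ) ^ k)) atTop (nhds 0) := by
      rw [← ENNReal.ofReal_zero]
      exact ENNReal.tendsto_ofReal (tendsto_pow_atTop_nhds_zero_of_lt_one (by norm_num) (by norm_num))
    exact le_antisymm (ge_of_tendsto' hlim fun k ↦
      (measure_mono (Set.iInter_subset _ k)).trans (hvol k)) zero_le
  · have h := (ProbabilityMeasure.tendsto_iff_forall_integral_rclike_tendsto ℂ).1 hν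
      (BoundedContinuousFunction.mkOfCompact (fourier (-n)))
    exact le_of_tendsto h.norm (Eventually.of_forall fun k ↦ hbound k n hn)

/-- (Wiener–Wintner) For every `0 < c < 1/2` there exists a probability Borel measure
`σ` on `[0,1)` mutually singular with Lebesgue measure with `σ̂(n) = O(|n|^{-c})`. -/
theorem stmt_14 (c : ℝ) (hc0 : 0 < c) (hc : c < 1 / 2) :
    ∃ σ : Measure ℝ, IsProbabilityMeasure σ ∧
      σ (Set.Ico (0:ℝ) 1)ᶜ = 0 ∧
      σ ⟂ₘ (MeasureTheory.volume.restrict (Set.Ico (0:ℝ) 1)) ∧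
      (fun n : ℤ => fourierCoeffM σ n) =O[cofinite]
        (fun n : ℤ => (|n| : ℝ) ^ (-c)) := by
  obtain ⟨μ, S, hμ, hS, hμS, hSvol, hdecay⟩ := exists_singular_probabilityMeasure_circle hc0 hc
  set e : UnitAddCircle → ℝ := fun x ↦ (AddCircle.equivIco 1 0 x : ℝ) with he
  have hem : Measurable e :=
    measurable_subtype_coe.comp (AddCircle.measurableEquivIco 1 0).measurable
  have he_coe (x : UnitAddCircle) : (e x : UnitAddCircle) = x := AddCircle.coe_equivIco
  have he_mem (x : UnitAddCircle) : e x ∈ Set.Ico (0 : ℝ) 1 := by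
    simpa using (AddCircle.equivIco 1 0 x).2
  have hmk : Measurable fun x : ℝ ↦ (x : UnitAddCircle) := AddCircle.measurable_mk'
  refine ⟨μ.map e, Measure.isProbabilityMeasure_map hem.aemeasurable, ?_, ?_, ?_⟩
  · rw [Measure.map_apply hem measurableSet_Ico.compl]
    convert measure_empty (μ := μ)
    ext x
    simp [he_mem x]
  · refine ⟨(fun x : ℝ ↦ (x : UnitAddCircle)) ⁻¹' S, hmk hS, ?_, ?_⟩
    · rw [Measure.map_apply hem (hmk hS), ← Set.preimage_comp]
      convert hμS
      ext x
      simp [he_coe]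
    · have h := (UnitAddCircle.measurePreserving_mk 0).measure_preimage hS.compl.nullMeasurableSet
      rw [hSvol, zero_add] at h
      rwa [restrict_Ico_eq_restrict_Ioc]
  · have hcoeff (n : ℤ) : fourierCoeffM (μ.map e) n = ∫ x, (fourier (-n) x : ℂ) ∂μ := by
      rw [fourierCoeffM, integral_map hem.aemeasurable (by fun_prop)]
      refine integral_congr_ae (ae_of_all _ fun x ↦ ?_)
      rw [← he_coe x, fourier_coe_apply, he_coe x]
      push_cast
      ring_nf
    refine IsBigO.of_bound 1 ?_
    filter_upwards [(Set.finite_singleton (0 : ℤ)).compl_mem_cofinite] with n hn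
    rw [hcoeff, one_mul, Real.norm_of_nonneg (by positivity)]
    simpa using hdecay n hn
end
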